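/- arXiv:1901.10347 — 6 statements merged into one kernel-verified Lean document; each statement's English description precedes it below -/
import Mathlib

section
/- For every repulsion parameter β ∈ ℝ and every a priori probability measure α on {-1,0,1} with α(s) > 0 for all s, the pressure of the mean-field soft-core Widom-Rowlinson model exists and is given by the variational formula: lim_{N→∞} (1/N) log ( Σ_{ω ∈ {-1,0,1}^N} exp( −(β/(2N)) Σ_{1≤i,j≤N} 1[ω_i ω_j = −1] ) ∏_{j=1}^N α(ω_j) ) = sup_{ν ∈ M₁({-1,0,1})} ( −β ν(1) ν(−1) − I(ν|α) ), where the supremum is over all probability measures ν on {-1,0,1}. -/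
open Real Filter Finset Topology

/-- The local state space `{-1, 0, 1}` of the Widom-Rowlinson model. -/
abbrev Spin : Finset ℤ := {-1, 0, 1}

/-- A probability vector on `{-1, 0, 1}`, encoded as a function `ℤ → ℝ`
supported on `{-1, 0, 1}`. -/
def IsProbVec (ν : ℤ → ℝ) : Prop :=
  (∀ s, 0 ≤ ν s) ∧ (∀ s, s ∉ Spin → ν s = 0) ∧ ∑ s ∈ Spin, ν s = 1

/-- Relative entropy `I(ν | α)` on `{-1,0,1}` (with the convention `0 log 0 = 0`,
which holds automatically since `Real.log 0 = 0`). -/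
noncomputable def relEnt (ν α : ℤ → ℝ) : ℝ :=
  ∑ s ∈ Spin, ν s * Real.log (ν s / α s)

/-- The (unnormalized) Boltzmann weight of the mean-field soft-core Widom-Rowlinson
model with repulsion parameter `β` and a priori measure `α`, at system size `N`. -/
noncomputable def wrWeight (β : ℝ) (α : ℤ → ℝ) {N : ℕ} (ω : Fin N → Spin) : ℝ :=
  Real.exp (-(β / (2 * (N : ℝ))) * ∑ i : Fin N, ∑ j : Fin N,
      (if ((ω i : ℤ) * (ω j : ℤ) = -1) then (1 : ℝ) else 0))
    * ∏ j : Fin N, α (ω j : ℤ)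

/-- The expectation of a product of single-site functions under a product weight. -/
lemma sum_prod_spin {N : ℕ} (f : Fin N → ℤ → ℝ) :
    ∑ ω : Fin N → Spin, ∏ k, f k (ω k : ℤ) = ∏ k, ∑ s ∈ Spin, f k s := by
  have h : ∀ k, ∑ s ∈ Spin, f k s = ∑ s : Spin, f k (s : ℤ) := fun k =>
    (Finset.sum_coe_sort Spin (f k)).symm
  simp_rw [h]
  rw [Finset.prod_univ_sum, Fintype.piFinset_univ]

lemma sum_prod_eq_one {ν : ℤ → ℝ} (hν : IsProbVec ν) (N : ℕ) :
    ∑ ω : Fin N → Spin, ∏ k, ν (ω k : ℤ) = 1 := by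
  rw [sum_prod_spin fun _ => ν]
  simp only [hν.2.2, Finset.prod_const_one]

lemma sum_prod_mul_apply {ν : ℤ → ℝ} (hν : IsProbVec ν) {N : ℕ} (i : Fin N) (g : ℤ → ℝ) :
    ∑ ω : Fin N → Spin, (∏ k, ν (ω k : ℤ)) * g (ω i) = ∑ s ∈ Spin, ν s * g s := by
  have h := sum_prod_spin fun k s => ν s * if k = i then g s else 1
  simp only [Finset.prod_mul_distrib, Finset.prod_ite_eq', Finset.mem_univ, if_true] at h
  rw [h, Finset.prod_eq_single i]
  · simp
  · intro k _ hk
    simpa [hk] using hν.2.2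
  · simp

lemma sum_prod_mul_apply_mul_apply {ν : ℤ → ℝ} (hν : IsProbVec ν) {N : ℕ} {i j : Fin N}
    (hij : i ≠ j) (g h : ℤ → ℝ) :
    ∑ ω : Fin N → Spin, (∏ k, ν (ω k : ℤ)) * (g (ω i) * h (ω j)) =
      (∑ s ∈ Spin, ν s * g s) * ∑ s ∈ Spin, ν s * h s := by
  have H := sum_prod_spin fun k s =>
    ν s * ((if k = i then g s else 1) * (if k = j then h s else 1))
  simp only [Finset.prod_mul_distrib, Finset.prod_ite_eq', Finset.mem_univ, if_true] at H
  rw [H, ← Finset.mul_prod_erase _ _ (Finset.mem_univ i),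
    ← Finset.mul_prod_erase _ _ (Finset.mem_erase.2 ⟨hij.symm, Finset.mem_univ j⟩),
    Finset.prod_eq_one]
  · simp [hij, hij.symm]
  · intro k hk
    simp only [Finset.mem_erase] at hk
    simpa [hk.1, hk.2.1] using hν.2.2

lemma ite_mul_eq_neg_one (s t : Spin) :
    (if (s : ℤ) * (t : ℤ) = -1 then (1 : ℝ) else 0) =
      (if (s : ℤ) = 1 then 1 else 0) * (if (t : ℤ) = -1 then 1 else 0) +
      (if (s : ℤ) = -1 then 1 else 0) * (if (t : ℤ) = 1 then 1 else 0) := by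
  obtain ⟨s, hs⟩ := s
  obtain ⟨t, ht⟩ := t
  simp only [Finset.mem_insert, Finset.mem_singleton] at hs ht
  rcases hs with rfl | rfl | rfl <;> rcases ht with rfl | rfl | rfl <;> norm_num

/-- The expected number of ordered pairs of repelling particles under the product measure. -/
lemma sum_prod_mul_interaction {ν : ℤ → ℝ} (hν : IsProbVec ν) (N : ℕ) :
    ∑ ω : Fin N → Spin, (∏ k, ν (ω k : ℤ)) * (∑ i : Fin N, ∑ j : Fin N,
      (if ((ω i : ℤ) * (ω j : ℤ) = -1) then (1 : ℝ) else 0)) =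
      2 * N * (N - 1) * (ν 1 * ν (-1)) := by
  have hpair : ∀ i j : Fin N, ∑ ω : Fin N → Spin, (∏ k, ν (ω k : ℤ)) *
      (if ((ω i : ℤ) * (ω j : ℤ) = -1) then (1 : ℝ) else 0) =
      2 * (ν 1 * ν (-1)) - if i = j then 2 * (ν 1 * ν (-1)) else 0 := by
    intro i j
    by_cases hij : i = j
    · subst hij
      simp only [if_true, sub_self]
      refine Finset.sum_eq_zero fun ω _ => ?_
      rw [if_neg (by nlinarith [mul_self_nonneg (ω i : ℤ)]), mul_zero]
    · simp only [ite_mul_eq_neg_one, mul_add, Finset.sum_add_distrib]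
      rw [sum_prod_mul_apply_mul_apply hν hij (fun s => if s = 1 then 1 else 0)
          (fun s => if s = -1 then 1 else 0),
        sum_prod_mul_apply_mul_apply hν hij (fun s => if s = -1 then 1 else 0)
          (fun s => if s = 1 then 1 else 0)]
      simp [hij]
      ring
  simp_rw [Finset.mul_sum]
  rw [Finset.sum_comm]
  have : ∀ i : Fin N, ∑ ω : Fin N → Spin, ∑ j, (∏ k, ν (ω k : ℤ)) *
      (if ((ω i : ℤ) * (ω j : ℤ) = -1) then (1 : ℝ) else 0) =
      (N - 1) * (2 * (ν 1 * ν (-1))) := by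
    intro i
    rw [Finset.sum_comm]
    simp only [hpair, Finset.sum_sub_distrib, Finset.sum_ite_eq, Finset.mem_univ, if_true,
      Finset.sum_const, Finset.card_univ, Fintype.card_fin, nsmul_eq_mul]
    ring
  simp only [this, Finset.sum_const, Finset.card_univ, Fintype.card_fin, nsmul_eq_mul]
  ring

lemma sum_prod_mul_sum {ν : ℤ → ℝ} (hν : IsProbVec ν) (N : ℕ) (g : ℤ → ℝ) :
    ∑ ω : Fin N → Spin, (∏ k, ν (ω k : ℤ)) * ∑ j, g (ω j) = N * ∑ s ∈ Spin, ν s * g s := by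
  simp_rw [Finset.mul_sum (s := (Finset.univ : Finset (Fin N)))]
  rw [Finset.sum_comm]
  simp only [sum_prod_mul_apply hν, Finset.sum_const, Finset.card_univ, Fintype.card_fin,
    nsmul_eq_mul]

lemma wrWeight_pos (β : ℝ) {α : ℤ → ℝ} (hpos : ∀ s ∈ Spin, 0 < α s) {N : ℕ}
    (ω : Fin N → Spin) : 0 < wrWeight β α ω :=
  mul_pos (exp_pos _) (Finset.prod_pos fun j _ => hpos _ (ω j).2)

/-- The Gibbs variational lower bound, tested against product measures. -/
lemma le_log_partition (β : ℝ) {α ν : ℤ → ℝ} (hpos : ∀ s ∈ Spin, 0 < α s)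
    (hν : IsProbVec ν) {N : ℕ} (hN : 0 < N) :
    -β * (N - 1) * (ν 1 * ν (-1)) - N * relEnt ν α ≤
      Real.log (∑ ω : Fin N → Spin, wrWeight β α ω) := by
  have hN' : (N : ℝ) ≠ 0 := by positivity
  let f : (Fin N → Spin) → ℝ := fun ω =>
    -(β / (2 * (N : ℝ))) * (∑ i : Fin N, ∑ j : Fin N,
      (if ((ω i : ℤ) * (ω j : ℤ) = -1) then (1 : ℝ) else 0)) +
    ∑ j, -Real.log (ν (ω j) / α (ω j))
  have hmean : ∑ ω : Fin N → Spin, (∏ k, ν (ω k : ℤ)) * f ω =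
      -β * (N - 1) * (ν 1 * ν (-1)) - N * relEnt ν α := by
    simp only [f, mul_add, Finset.sum_add_distrib]
    rw [sum_prod_mul_sum hν N (fun s => -Real.log (ν s / α s))]
    simp_rw [mul_left_comm _ (-(β / (2 * (N : ℝ))))]
    rw [← Finset.mul_sum, sum_prod_mul_interaction hν]
    simp only [relEnt, mul_neg, Finset.sum_neg_distrib]
    field_simp
    ring
  have hjensen := convexOn_exp.map_sum_le (t := Finset.univ)
    (w := fun ω : Fin N → Spin => ∏ k, ν (ω k : ℤ)) (p := f)
    (fun ω _ => Finset.prod_nonneg fun k _ => hν.1 _) (sum_prod_eq_one hν N)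
    (fun _ _ => Set.mem_univ _)
  simp only [smul_eq_mul, hmean] at hjensen
  rw [Real.le_log_iff_exp_le
    (Finset.sum_pos (fun ω _ => wrWeight_pos β hpos ω) ⟨fun _ => ⟨0, by simp⟩, Finset.mem_univ _⟩)]
  refine hjensen.trans (Finset.sum_le_sum fun ω _ => ?_)
  by_cases h0 : ∃ k, ν (ω k) = 0
  · obtain ⟨k, hk⟩ := h0
    rw [Finset.prod_eq_zero (Finset.mem_univ k) hk, zero_mul]
    exact (wrWeight_pos β hpos ω).le
  · push Not at h0
    refine le_of_eq ?_
    simp only [f, wrWeight, Real.exp_add, Real.exp_sum]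
    rw [mul_left_comm, ← Finset.prod_mul_distrib]
    congr 1
    refine Finset.prod_congr rfl fun k _ => ?_
    have h1 : 0 < ν (ω k) := lt_of_le_of_ne (hν.1 _) (h0 k).symm
    have h2 := hpos _ (ω k).2
    rw [Real.exp_neg, Real.exp_log (div_pos h1 h2)]
    field_simp

/-- The empirical distribution of a spin configuration. -/
noncomputable def empirical {N : ℕ} (ω : Fin N → Spin) (s : ℤ) : ℝ :=
  (∑ j, if (ω j : ℤ) = s then (1 : ℝ) else 0) / N

lemma sum_empirical_mul {N : ℕ} (ω : Fin N → Spin) (f : ℤ → ℝ) :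
    ∑ s ∈ Spin, empirical ω s * f s = (∑ j, f (ω j)) / N := by
  simp only [empirical, div_mul_eq_mul_div, Finset.sum_mul, ← Finset.sum_div]
  rw [Finset.sum_comm]
  congr 1
  refine Finset.sum_congr rfl fun j _ => ?_
  simp only [ite_mul, one_mul, zero_mul]
  rw [Finset.sum_ite_eq, if_pos (ω j).2]

lemma isProbVec_empirical {N : ℕ} (hN : 0 < N) (ω : Fin N → Spin) :
    IsProbVec (empirical ω) := by
  refine ⟨fun s => ?_, fun s hs => ?_, ?_⟩
  · exact div_nonneg (Finset.sum_nonneg fun j _ => by split_ifs <;> norm_num) (by positivity)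
  · rw [empirical, Finset.sum_eq_zero, zero_div]
    intro j _
    rw [if_neg]
    rintro rfl
    exact hs (ω j).2
  · have h := sum_empirical_mul ω fun _ => 1
    have hN' : (N : ℝ) ≠ 0 := by positivity
    simpa [hN'] using h

lemma empirical_apply_pos {N : ℕ} (ω : Fin N → Spin) (j : Fin N) : 0 < empirical ω (ω j) := by
  have : 0 < N := j.pos
  refine div_pos (Finset.sum_pos' (fun k _ => by split_ifs <;> norm_num)
    ⟨j, Finset.mem_univ j, by simp⟩) (by positivity)

lemma wrWeight_eq_empirical (β : ℝ) {α : ℤ → ℝ} (hpos : ∀ s ∈ Spin, 0 < α s) {N : ℕ}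
    (hN : 0 < N) (ω : Fin N → Spin) :
    wrWeight β α ω = Real.exp (N * (-β * empirical ω 1 * empirical ω (-1) -
      relEnt (empirical ω) α)) * ∏ j, empirical ω (ω j) := by
  have hN' : (N : ℝ) ≠ 0 := by positivity
  have hent : N * relEnt (empirical ω) α =
      ∑ j, Real.log (empirical ω (ω j) / α (ω j)) := by
    rw [relEnt, sum_empirical_mul ω fun s => Real.log (empirical ω s / α s)]
    field_simp
  have hint : ∑ i : Fin N, ∑ j : Fin N,
      (if ((ω i : ℤ) * (ω j : ℤ) = -1) then (1 : ℝ) else 0) =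
      2 * N ^ 2 * (empirical ω 1 * empirical ω (-1)) := by
    simp only [ite_mul_eq_neg_one, Finset.sum_add_distrib, ← Finset.mul_sum, ← Finset.sum_mul,
      empirical]
    field_simp
    ring
  rw [wrWeight, hint, mul_sub, hent, sub_eq_add_neg, Real.exp_add,
    ← Finset.sum_neg_distrib, Real.exp_sum, mul_assoc (Real.exp _), ← Finset.prod_mul_distrib]
  congr 1
  · congr 1
    field_simp
  · refine Finset.prod_congr rfl fun j _ => ?_
    have h1 := empirical_apply_pos ω j
    have h2 := hpos _ (ω j).2
    rw [Real.exp_neg, Real.exp_log (div_pos h1 h2)]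
    field_simp

open Classical in
lemma card_image_empirical_le (N : ℕ) :
    (Finset.univ.image fun ω : Fin N → Spin => empirical ω).card ≤ (N + 1) ^ 3 := by
  let F : (Spin → Fin (N + 1)) → ℤ → ℝ := fun k s =>
    if h : s ∈ Spin then ((k ⟨s, h⟩ : ℕ) : ℝ) / N else 0
  have hsub : (Finset.univ.image fun ω : Fin N → Spin => empirical ω) ⊆
      Finset.univ.image F := by
    intro ν hν
    obtain ⟨ω, -, rfl⟩ := Finset.mem_image.1 hν
    refine Finset.mem_image.2 ⟨fun s => ⟨(Finset.univ.filter fun j => (ω j : ℤ) = s).card,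
      Nat.lt_succ_of_le ((Finset.card_le_univ _).trans (by simp))⟩, Finset.mem_univ _, ?_⟩
    funext s
    simp only [F]
    split_ifs with h
    · simp [empirical]
    · rw [empirical, Finset.sum_eq_zero, zero_div]
      intro j _
      rw [if_neg]
      rintro rfl
      exact h (ω j).2
  refine (Finset.card_le_card hsub).trans (Finset.card_image_le.trans (le_of_eq ?_))
  rw [Finset.card_univ, Fintype.card_fun, Fintype.card_fin, Fintype.card_coe]
  rfl

open Classical in
/-- The method-of-types upper bound. -/
lemma partition_le (β : ℝ) {α : ℤ → ℝ} (hpos : ∀ s ∈ Spin, 0 < α s) {N : ℕ} (hN : 0 < N)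
    {p : ℝ} (hp : ∀ ν, IsProbVec ν → -β * ν 1 * ν (-1) - relEnt ν α ≤ p) :
    ∑ ω : Fin N → Spin, wrWeight β α ω ≤ Real.exp (N * p) * (N + 1) ^ 3 := by
  set T := Finset.univ.image fun ω : Fin N → Spin => empirical ω
  have hprob : ∀ ν ∈ T, IsProbVec ν := by
    intro ν hν
    obtain ⟨ω, -, rfl⟩ := Finset.mem_image.1 hν
    exact isProbVec_empirical hN ω
  calc ∑ ω : Fin N → Spin, wrWeight β α ω
      ≤ ∑ ω : Fin N → Spin, Real.exp (N * p) * ∑ ν ∈ T, ∏ j, ν (ω j : ℤ) := by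
        refine Finset.sum_le_sum fun ω _ => ?_
        rw [wrWeight_eq_empirical β hpos hN]
        have hle : ∏ j, empirical ω (ω j) ≤ ∑ ν ∈ T, ∏ j, ν (ω j : ℤ) :=
          Finset.single_le_sum (f := fun ν : ℤ → ℝ => ∏ j, ν (ω j : ℤ))
            (fun ν hν => Finset.prod_nonneg fun j _ => (hprob ν hν).1 _)
            (Finset.mem_image_of_mem _ (Finset.mem_univ ω))
        have := hp _ (isProbVec_empirical hN ω)
        have := Finset.prod_nonneg fun j (_ : j ∈ Finset.univ) => (empirical_apply_pos ω j).le
        gcongr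
    _ = Real.exp (N * p) * T.card := by
        rw [← Finset.mul_sum, Finset.sum_comm,
          Finset.sum_congr rfl fun ν hν => sum_prod_eq_one (hprob ν hν) N]
        simp
    _ ≤ Real.exp (N * p) * (N + 1) ^ 3 := by
        gcongr
        exact_mod_cast card_image_empirical_le N

/-- The product-measure lower bound on the finite-volume pressure. -/
lemma functional_sub_le_pressure (β : ℝ) {α ν : ℤ → ℝ} (hpos : ∀ s ∈ Spin, 0 < α s)
    (hν : IsProbVec ν) {N : ℕ} (hN : 0 < N) :
    -β * ν 1 * ν (-1) - relEnt ν α - |β| / N ≤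
      (1 / (N : ℝ)) * Real.log (∑ ω : Fin N → Spin, wrWeight β α ω) := by
  have hN' : (0 : ℝ) < N := by positivity
  have h := le_log_partition β hpos hν hN
  have hsum := hν.2.2
  have hle : ∀ s ∈ Spin, ν s ≤ 1 := fun s hs =>
    hsum ▸ Finset.single_le_sum (fun t _ => hν.1 t) hs
  have h0 : 0 ≤ ν 1 * ν (-1) := mul_nonneg (hν.1 _) (hν.1 _)
  have h1 : ν 1 * ν (-1) ≤ 1 :=
    mul_le_one₀ (hle 1 (by simp)) (hν.1 _) (hle (-1) (by simp))
  have hβ : -|β| ≤ β * (ν 1 * ν (-1)) := by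
    refine neg_le_of_abs_le ?_
    rw [abs_mul, abs_of_nonneg h0]
    exact mul_le_of_le_one_right (abs_nonneg β) h1
  rw [one_div_mul_eq_div, le_div_iff₀ hN', sub_mul _ (|β| / N), div_mul_cancel₀ _ hN'.ne']
  linarith

/-- The pressure of the mean-field soft-core Widom-Rowlinson model exists and is given
by the mean-field variational formula
`p(β,α) = sup_ν ( -β ν(1) ν(-1) - I(ν|α) )`. -/
theorem mean_field_pressure (β : ℝ) (α : ℤ → ℝ) (hα : IsProbVec α)
    (hpos : ∀ s ∈ Spin, 0 < α s) :
    Tendsto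
      (fun N : ℕ => (1 / (N : ℝ)) * Real.log (∑ ω : Fin N → Spin, wrWeight β α ω))
      atTop
      (𝓝 (sSup {y : ℝ | ∃ ν : ℤ → ℝ, IsProbVec ν ∧
        y = -β * ν 1 * ν (-1) - relEnt ν α})) := by
  set S := {y : ℝ | ∃ ν : ℤ → ℝ, IsProbVec ν ∧ y = -β * ν 1 * ν (-1) - relEnt ν α}
  have hbdd : BddAbove S := by
    refine ⟨(1 / ((1 : ℕ) : ℝ)) * Real.log (∑ ω : Fin 1 → Spin, wrWeight β α ω) +
      |β| / (1 : ℕ), ?_⟩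
    rintro y ⟨ν, hν, rfl⟩
    exact sub_le_iff_le_add.1 (functional_sub_le_pressure β hpos hν one_pos)
  have hne : S.Nonempty := ⟨_, α, hα, rfl⟩
  have hlog : Tendsto (fun N : ℕ => Real.log ((N : ℝ) + 1) / N) atTop (𝓝 0) := by
    have h := (Real.tendsto_pow_log_div_mul_add_atTop 1 (-1) 1 one_ne_zero).comp
      (tendsto_atTop_add_const_right atTop (1 : ℝ) (tendsto_natCast_atTop_atTop (R := ℝ)))
    refine h.congr fun N => ?_
    simp
  have hlower : Tendsto (fun N : ℕ => sSup S - |β| / N) atTop (𝓝 (sSup S)) := by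
    simpa using (tendsto_const_div_atTop_nhds_zero_nat |β|).const_sub (sSup S)
  have hupper : Tendsto (fun N : ℕ => sSup S + 3 * (Real.log ((N : ℝ) + 1) / N)) atTop
      (𝓝 (sSup S)) := by
    simpa using (hlog.const_mul 3).const_add (sSup S)
  refine tendsto_of_tendsto_of_tendsto_of_le_of_le' hlower hupper ?_ ?_
  · filter_upwards [eventually_gt_atTop 0] with N hN
    rw [sub_le_iff_le_add]
    refine csSup_le hne ?_
    rintro y ⟨ν, hν, rfl⟩
    exact sub_le_iff_le_add.1 (functional_sub_le_pressure β hpos hν hN)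
  · filter_upwards [eventually_gt_atTop 0] with N hN
    have hN' : (0 : ℝ) < N := by positivity
    have hZ : 0 < ∑ ω : Fin N → Spin, wrWeight β α ω :=
      Finset.sum_pos (fun ω _ => wrWeight_pos β hpos ω)
        ⟨fun _ => ⟨0, by simp⟩, Finset.mem_univ _⟩
    have h := Real.log_le_log hZ
      (partition_le β hpos hN fun ν hν => le_csSup hbdd ⟨ν, hν, rfl⟩)
    rw [Real.log_mul (exp_pos _).ne' (by positivity), Real.log_exp, Real.log_pow] at h
    rw [one_div_mul_eq_div, div_le_iff₀ hN']
    refine h.trans (le_of_eq ?_)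
    push_cast
    field_simp
end

section
/- Let α be a symmetric a priori probability measure on {-1,0,1}, i.e., α(1) = α(−1) > 0 and α(0) > 0, and set β_c = 2 + e·α(0)/α(1). Then the variational functional Φ_{β,α}(ν) = −β ν(1) ν(−1) − I(ν|α) on probability measures ν on {-1,0,1} has a unique global maximizer for every 0 < β ≤ β_c, and this maximizer satisfies ν(1) = ν(−1); while for every β > β_c it has exactly two global maximizers, which are exchanged under the swap of the values +1 and −1 and each satisfy ν(1) ≠ ν(−1). -/
open Real Filter Finset Topology

/-- The variational functional `Φ_{β,α}(ν) = -β ν(1) ν(-1) - I(ν|α)` of the mean-field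
soft-core Widom-Rowlinson model. -/
noncomputable def Phi (β : ℝ) (α ν : ℤ → ℝ) : ℝ :=
  -β * ν 1 * ν (-1) - relEnt ν α

/-- `ν` is a global maximizer of `Φ_{β,α}` on the simplex of probability vectors. -/
def IsMaximizer (β : ℝ) (α ν : ℤ → ℝ) : Prop :=
  IsProbVec ν ∧ ∀ ν' : ℤ → ℝ, IsProbVec ν' → Phi β α ν' ≤ Phi β α ν

/-- The swap of the spin values `+1` and `-1` acting on probability vectors. -/
def spinSwap (ν : ℤ → ℝ) : ℤ → ℝ := fun s => ν (-s)

theorem IsProbVec.sum_eq {ν : ℤ → ℝ} (hν : IsProbVec ν) : ν (-1) + ν 0 + ν 1 = 1 := by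
  have h := hν.2.2
  simp [Spin] at h
  linarith

theorem IsProbVec.ext {μ ν : ℤ → ℝ} (hμ : IsProbVec μ) (hν : IsProbVec ν)
    (hpos : μ 1 = ν 1) (hneg : μ (-1) = ν (-1)) : μ = ν := by
  funext s
  by_cases hs : s ∈ Spin
  · simp only [Spin, Finset.mem_insert, Finset.mem_singleton] at hs
    have := hμ.sum_eq
    have := hν.sum_eq
    rcases hs with rfl | rfl | rfl
    · exact hneg
    · linarith
    · exact hpos
  · rw [hμ.2.1 s hs, hν.2.1 s hs]

/-- The vector on `{-1, 0, 1}` with mass `x` at `1`, mass `y` at `-1` and total mass `1`. -/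
def spinVec (x y : ℝ) : ℤ → ℝ := fun s =>
  if s = 1 then x else if s = -1 then y else if s = 0 then 1 - x - y else 0

theorem isProbVec_spinVec {x y : ℝ} (hx : 0 ≤ x) (hy : 0 ≤ y) (hxy : x + y ≤ 1) :
    IsProbVec (spinVec x y) := by
  refine ⟨fun s => ?_, fun s hs => ?_, ?_⟩
  · unfold spinVec
    split_ifs <;> linarith
  · simp only [Spin, Finset.mem_insert, Finset.mem_singleton, not_or] at hs
    simp [spinVec, hs]
  · simp [Spin, spinVec]
    ring

theorem IsProbVec.spinSwap {ν : ℤ → ℝ} (hν : IsProbVec ν) : IsProbVec (spinSwap ν) := by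
  refine ⟨fun s => hν.1 _, fun s hs => hν.2.1 _ ?_, ?_⟩
  · simp only [Spin, Finset.mem_insert, Finset.mem_singleton, not_or] at hs ⊢
    omega
  · have := hν.sum_eq
    simp [Spin, _root_.spinSwap]
    linarith

theorem mul_log_div_eq (x : ℝ) {a : ℝ} (ha : 0 < a) :
    x * log (x / a) = -(negMulLog x + x * log a) := by
  rcases eq_or_ne x 0 with rfl | hx
  · simp
  · rw [log_div hx ha.ne', negMulLog]
    ring

/-- Strict Gibbs inequality for a single atom. -/
theorem negMulLog_add_mul_log_lt {t p : ℝ} (ht : 0 ≤ t) (hp : 0 < p) (hne : t ≠ p) :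
    negMulLog t + t * log p < p - t := by
  rcases ht.eq_or_lt with rfl | ht
  · simpa using hp
  · have hpt : p / t ≠ 1 := fun h => hne ((div_eq_one_iff_eq ht.ne').1 h).symm
    have h := mul_lt_mul_of_pos_left (log_lt_sub_one_of_pos (div_pos hp ht) hpt) ht
    rw [log_div hp.ne' ht.ne', mul_sub, mul_sub, mul_div_cancel₀ _ ht.ne'] at h
    rw [negMulLog]
    linarith

theorem negMulLog_add_mul_log_le {t p : ℝ} (ht : 0 ≤ t) (hp : 0 < p) :
    negMulLog t + t * log p ≤ p - t := by
  rcases eq_or_ne t p with rfl | hne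
  · simp [negMulLog]
  · exact (negMulLog_add_mul_log_lt ht hp hne).le

theorem Phi_eq {α : ℤ → ℝ} (hsym : α 1 = α (-1)) (h1 : 0 < α 1) (h0 : 0 < α 0) (β : ℝ)
    (ν : ℤ → ℝ) :
    Phi β α ν = -β * ν 1 * ν (-1) + negMulLog (ν 1) + negMulLog (ν (-1)) + negMulLog (ν 0)
      + (ν 1 + ν (-1)) * log (α 1) + ν 0 * log (α 0) := by
  have h : relEnt ν α = ν (-1) * log (ν (-1) / α (-1)) + ν 0 * log (ν 0 / α 0)
      + ν 1 * log (ν 1 / α 1) := by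
    simp [relEnt, Spin]
    ring
  rw [Phi, h, ← hsym, mul_log_div_eq _ h1, mul_log_div_eq _ h1, mul_log_div_eq _ h0]
  ring

theorem Phi_spinSwap {α : ℤ → ℝ} (hsym : α 1 = α (-1)) (h1 : 0 < α 1) (h0 : 0 < α 0) (β : ℝ)
    (ν : ℤ → ℝ) : Phi β α (spinSwap ν) = Phi β α ν := by
  rw [Phi_eq hsym h1 h0, Phi_eq hsym h1 h0]
  simp [spinSwap]
  ring

theorem IsMaximizer.spinSwap {α ν : ℤ → ℝ} {β : ℝ} (hsym : α 1 = α (-1)) (h1 : 0 < α 1)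
    (h0 : 0 < α 0) (hν : IsMaximizer β α ν) : IsMaximizer β α (spinSwap ν) :=
  ⟨hν.1.spinSwap, fun μ hμ => (hν.2 μ hμ).trans_eq (Phi_spinSwap hsym h1 h0 β ν).symm⟩

theorem isCompact_setOf_isProbVec : IsCompact {ν : ℤ → ℝ | IsProbVec ν} := by
  refine (isCompact_univ_pi fun _ : ℤ => isCompact_Icc (a := (0 : ℝ)) (b := 1)).of_isClosed_subset
    ?_ fun ν hν s _ => ⟨hν.1 s, ?_⟩
  · have h : {ν : ℤ → ℝ | IsProbVec ν} = (⋂ s, {ν | 0 ≤ ν s}) ∩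
        ((⋂ s, ⋂ (_ : s ∉ Spin), {ν | ν s = 0}) ∩ {ν | ∑ s ∈ Spin, ν s = 1}) := by
      ext ν
      simp only [IsProbVec, Set.mem_inter_iff, Set.mem_iInter, Set.mem_ofPred_eq]
    rw [h]
    refine (isClosed_iInter fun s => isClosed_le continuous_const (continuous_apply s)).inter
      ((isClosed_iInter fun s => isClosed_iInter fun _ =>
        isClosed_eq (continuous_apply s) continuous_const).inter
      (isClosed_eq (by fun_prop) continuous_const))
  · by_cases hs : s ∈ Spin
    · exact (Finset.single_le_sum (fun i _ => hν.1 i) hs).trans_eq hν.2.2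
    · rw [hν.2.1 s hs]
      exact zero_le_one

theorem exists_isMaximizer {α : ℤ → ℝ} (hsym : α 1 = α (-1)) (h1 : 0 < α 1) (h0 : 0 < α 0)
    (β : ℝ) : ∃ ν, IsMaximizer β α ν := by
  have hcont : Continuous (Phi β α) := by
    rw [funext (Phi_eq hsym h1 h0 β)]
    have (s : ℤ) : Continuous fun ν : ℤ → ℝ => negMulLog (ν s) :=
      continuous_negMulLog.comp (continuous_apply s)
    have h_pos := this 1
    have h_neg := this (-1)
    have h_zero := this 0
    fun_prop
  obtain ⟨ν, hν, hmax⟩ := isCompact_setOf_isProbVec.exists_isMaxOn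
    ⟨spinVec 0 0, isProbVec_spinVec le_rfl le_rfl (by simp)⟩ hcont.continuousOn
  exact ⟨ν, hν, fun μ hμ => hmax hμ⟩

/-- The mean-field equation, from optimality under mass exchange between the states `1` and `0`. -/
theorem IsMaximizer.mean_field_eq {α ν : ℤ → ℝ} {β : ℝ} (hsym : α 1 = α (-1)) (h1 : 0 < α 1)
    (h0 : 0 < α 0) (hν : IsMaximizer β α ν) :
    ν 1 * α 0 = ν 0 * (α 1 * exp (-β * ν (-1))) := by
  set A := α 1 * exp (-β * ν (-1)) with hA
  have hApos : 0 < A := by positivity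
  have hlogA : log A = log (α 1) + -β * ν (-1) := by
    rw [hA, log_mul h1.ne' (exp_pos _).ne', log_exp]
  have hx := hν.1.1 1
  have hy := hν.1.1 (-1)
  have hz := hν.1.1 0
  have hsum := hν.1.sum_eq
  set σ := ν 1 + ν 0 with hσ
  rcases (add_nonneg hx hz).eq_or_lt with hσ0 | hσpos
  · rw [show ν 1 = 0 by linarith, show ν 0 = 0 by linarith]
    simp
  · have hS : 0 < A + α 0 := by positivity
    set p := σ * A / (A + α 0) with hp
    set q := σ * α 0 / (A + α 0) with hq
    have hσpos' : 0 < σ := hσpos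
    have hppos : 0 < p := by positivity
    have hqpos : 0 < q := by positivity
    have hpq : p + q = σ := by
      rw [hp, hq]
      field_simp
    have hlogp : log p = log σ + log A - log (A + α 0) := by
      rw [hp, log_div (by positivity) hS.ne', log_mul hσpos'.ne' hApos.ne']
    have hlogq : log q = log σ + log (α 0) - log (A + α 0) := by
      rw [hq, log_div (by positivity) hS.ne', log_mul hσpos'.ne' h0.ne']
    by_contra hne
    have hxp : ν 1 ≠ p := by
      intro h
      apply hne
      have hz : ν 0 = q := by linarith
      rw [h, hz, hp, hq]
      ring
    have hle := hν.2 _ (isProbVec_spinVec hppos.le hy (by linarith))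
    rw [Phi_eq hsym h1 h0, Phi_eq hsym h1 h0] at hle
    have hq' : 1 - p - ν (-1) = q := by linarith
    simp only [spinVec, if_true, show ((-1 : ℤ) = 1) = False by simp, if_false,
      show ((0 : ℤ) = 1) = False by simp, show ((0 : ℤ) = -1) = False by simp, hq'] at hle
    have hlt := negMulLog_add_mul_log_lt hx hppos hxp
    have hle' := negMulLog_add_mul_log_le hz hqpos
    simp only [negMulLog] at hle hlt hle'
    rw [hlogp] at hle hlt
    rw [hlogq] at hle hle'
    rw [hlogA] at hle hlt
    have e1 : p * (log σ - log (A + α 0)) + q * (log σ - log (A + α 0))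
        = σ * (log σ - log (A + α 0)) := by rw [← hpq]; ring
    have e2 : ν 1 * (log σ - log (A + α 0)) + ν 0 * (log σ - log (A + α 0))
        = σ * (log σ - log (A + α 0)) := by rw [hσ]; ring
    linarith

theorem sinh_lt_self_mul_cosh {u : ℝ} (hu : 0 < u) : sinh u < u * cosh u := by
  have hmono : StrictMonoOn (fun v : ℝ => v * cosh v - sinh v) (Set.Ici 0) := by
    refine strictMonoOn_of_hasDerivWithinAt_pos (f' := fun v => v * sinh v) (convex_Ici 0)
      (by fun_prop) (fun v _ => ?_) fun v hv => ?_
    · exact ((((hasDerivAt_id v).mul (hasDerivAt_cosh v)).sub (hasDerivAt_sinh v)).congr_deriv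
        (by simp)).hasDerivWithinAt
    · rw [interior_Ici] at hv
      exact mul_pos hv (sinh_pos_iff.2 hv)
  have h := hmono Set.self_mem_Ici hu.le hu
  simp only [sinh_zero, zero_mul, sub_zero] at h
  linarith

/-- The function `u ↦ u coth u`. -/
noncomputable def mulCoth (u : ℝ) : ℝ := u * cosh u / sinh u

theorem one_lt_mulCoth {u : ℝ} (hu : 0 < u) : 1 < mulCoth u :=
  (one_lt_div (sinh_pos_iff.2 hu)).2 (sinh_lt_self_mul_cosh hu)

theorem hasDerivAt_mulCoth {u : ℝ} (hu : 0 < u) :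
    HasDerivAt mulCoth ((sinh u * cosh u - u) / sinh u ^ 2) u := by
  have hs := sinh_pos_iff.2 hu
  refine (((hasDerivAt_id u).mul (hasDerivAt_cosh u)).div (hasDerivAt_sinh u) hs.ne').congr_deriv ?_
  simp only [Pi.mul_apply, id]
  congr 1
  linear_combination (-u) * cosh_sq u

theorem strictMonoOn_mulCoth : StrictMonoOn mulCoth (Set.Ioi 0) := by
  refine strictMonoOn_of_hasDerivWithinAt_pos (convex_Ioi 0)
    (fun v hv => (hasDerivAt_mulCoth hv).continuousAt.continuousWithinAt)
    (fun v hv => (hasDerivAt_mulCoth (by simpa using hv)).hasDerivWithinAt) fun v hv => ?_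
  have hv : 0 < v := by simpa using hv
  have h1 := self_lt_sinh_iff.2 hv
  have h2 := one_lt_cosh.2 hv.ne'
  have hs := sinh_pos_iff.2 hv
  have : 0 < sinh v * cosh v - v := by nlinarith
  positivity

/-- The function `u ↦ log (u / sinh u) + u coth u`, whose exponential appears in the equation for
the asymmetric solutions of the mean-field equations. -/
noncomputable def asymLog (u : ℝ) : ℝ := log u - log (sinh u) + mulCoth u

theorem exp_asymLog {u : ℝ} (hu : 0 < u) : exp (asymLog u) = u / sinh u * exp (mulCoth u) := by
  rw [asymLog, exp_add, exp_sub, exp_log hu, exp_log (sinh_pos_iff.2 hu)]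

theorem strictMonoOn_asymLog : StrictMonoOn asymLog (Set.Ioi 0) := by
  have hderiv {v : ℝ} (hv : 0 < v) :
      HasDerivAt asymLog (v⁻¹ - cosh v / sinh v + (sinh v * cosh v - v) / sinh v ^ 2) v :=
    ((hasDerivAt_log hv.ne').sub ((hasDerivAt_sinh v).log (sinh_pos_iff.2 hv).ne')).add
      (hasDerivAt_mulCoth hv)
  refine strictMonoOn_of_hasDerivWithinAt_pos (convex_Ioi 0)
    (fun v hv => (hderiv hv).continuousAt.continuousWithinAt)
    (fun v hv => (hderiv (by simpa using hv)).hasDerivWithinAt) fun v hv => ?_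
  have hv : 0 < v := by simpa using hv
  have hs := sinh_pos_iff.2 hv
  have h : v⁻¹ - cosh v / sinh v + (sinh v * cosh v - v) / sinh v ^ 2
      = (sinh v ^ 2 - v ^ 2) / (v * sinh v ^ 2) := by
    field_simp
    ring
  rw [h]
  have h1 := self_lt_sinh_iff.2 hv
  have : 0 < sinh v ^ 2 - v ^ 2 := by nlinarith
  positivity

theorem one_lt_asymLog {u : ℝ} (hu : 0 < u) : 1 < asymLog u := by
  refine lt_of_le_of_lt ?_ (strictMonoOn_asymLog (half_pos hu) hu (half_lt_self hu))
  have hlim : Tendsto (fun ε : ℝ => 1 - log (cosh ε)) (𝓝[>] 0) (𝓝 1) := by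
    have hcont : Continuous fun ε : ℝ => 1 - log (cosh ε) :=
      continuous_const.sub (continuous_cosh.log fun ε => (cosh_pos ε).ne')
    simpa using (hcont.tendsto 0).mono_left nhdsWithin_le_nhds
  refine le_of_tendsto hlim ?_
  filter_upwards [Ioo_mem_nhdsGT (half_pos hu)] with ε hε
  have h := strictMonoOn_asymLog hε.1 (half_pos hu) hε.2
  have hlog := log_le_log (sinh_pos_iff.2 hε.1) (sinh_lt_self_mul_cosh hε.1).le
  rw [log_mul hε.1.ne' (cosh_pos ε).ne'] at hlog
  have hcoth := one_lt_mulCoth hε.1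
  rw [asymLog] at h
  linarith

/-- Parametrization of the asymmetric solutions of the mean-field equations. -/
theorem exists_asym_param {a c β x y : ℝ} (hc : 0 < c) (hβ : 0 < β)
    (hyx : y < x) (hx_eq : x * c = (1 - x - y) * (a * exp (-β * y)))
    (hy_eq : y * c = (1 - x - y) * (a * exp (-β * x))) :
    ∃ u, 0 < u ∧ x = u * exp u / (β * sinh u) ∧ y = u * exp (-u) / (β * sinh u) ∧
      c * exp (asymLog u) = a * (β - 2 * mulCoth u) := by
  set u := β * (x - y) / 2 with hu_def
  have hu : 0 < u := by
    have : 0 < x - y := sub_pos.2 hyx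
    positivity
  have hs := sinh_pos_iff.2 hu
  have hr : x * exp (-u) = y * exp u := by
    have h1 : exp (-β * y) * exp (-u) = exp (-β * x) * exp u := by
      rw [← exp_add, ← exp_add, hu_def]
      ring_nf
    apply mul_right_cancel₀ hc.ne'
    linear_combination exp (-u) * hx_eq - exp u * hy_eq + (1 - x - y) * a * h1
  have hee : exp u * exp (-u) = 1 := by rw [← exp_add]; simp
  have hxr : x = x * exp (-u) * exp u := by linear_combination (-x) * hee
  have hyr : y = x * exp (-u) * exp (-u) := by
    linear_combination (-y) * hee - exp (-u) * hr
  set r := x * exp (-u) with hr_def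
  have hru : β * r * sinh u = u := by
    rw [sinh_eq]
    linear_combination (-β / 2) * hxr + (β / 2) * hyr
  have hr_eq : r = u / (β * sinh u) := by
    rw [eq_div_iff (by positivity)]
    linear_combination hru
  have hw : mulCoth u = β * (x + y) / 2 := by
    have hsum : x + y = 2 * r * cosh u := by
      rw [cosh_eq]
      linear_combination hxr + hyr
    rw [mulCoth, div_eq_iff hs.ne', hsum]
    linear_combination (-cosh u) * hru
  refine ⟨u, hu, ?_, ?_, ?_⟩
  · rw [hxr, hr_eq]
    ring
  · rw [hyr, hr_eq]
    ring
  · rw [exp_asymLog hu, show u / sinh u = β * r by rw [div_eq_iff hs.ne', hru]]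
    have hexp : exp (mulCoth u) = exp u * exp (β * y) := by
      rw [← exp_add, hw, hu_def]
      ring_nf
    have hyy : exp (-β * y) * exp (β * y) = 1 := by rw [← exp_add]; simp
    rw [hexp, hw]
    linear_combination (-β * c * exp (β * y)) * hxr + β * exp (β * y) * hx_eq
      + β * (1 - x - y) * a * hyy

/-- A symmetric point is improved by a small asymmetric perturbation when `β x > 1`. -/
theorem exists_negMulLog_perturbation {β x : ℝ} (hx : 0 < x) (hβx : 1 < β * x) :
    ∃ t, 0 < t ∧ t < x ∧
      2 * negMulLog x < β * t ^ 2 + negMulLog (x + t) + negMulLog (x - t) := by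
  obtain ⟨m, hm, hm'⟩ := exists_between (lt_min (half_pos one_pos)
    (div_pos (sub_pos.2 hβx) (by norm_num : (0 : ℝ) < 4)))
  obtain ⟨hm_half, hm_small⟩ := lt_min_iff.1 hm'
  have habs : |m| = m := abs_of_pos hm
  have herr : m ^ 3 / (1 - m) ≤ 2 * m ^ 3 := by
    rw [div_le_iff₀ (by linarith)]
    nlinarith [pow_pos hm 3]
  have h1 := abs_le.1 (abs_log_sub_add_sum_range_le (x := m) (by rw [habs]; linarith) 2)
  have h2 := abs_le.1 (abs_log_sub_add_sum_range_le (x := -m) (by rw [abs_neg, habs]; linarith) 2)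
  simp only [Finset.sum_range_succ, Finset.sum_range_zero, abs_neg, habs, sub_neg_eq_add] at h1 h2
  norm_num at h1 h2
  have hlog_sub : log (1 - m) ≤ -m - m ^ 2 / 2 + 2 * m ^ 3 := by linarith
  have hlog_add : log (1 + m) ≤ m - m ^ 2 / 2 + 2 * m ^ 3 := by linarith
  refine ⟨x * m, by positivity, by nlinarith, ?_⟩
  have e1 : negMulLog (x + x * m) = -(x * (1 + m)) * (log x + log (1 + m)) := by
    rw [negMulLog, ← log_mul hx.ne' (by linarith)]
    ring_nf
  have e2 : negMulLog (x - x * m) = -(x * (1 - m)) * (log x + log (1 - m)) := by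
    rw [negMulLog, ← log_mul hx.ne' (by linarith)]
    ring_nf
  rw [e1, e2, negMulLog]
  have b1 := mul_le_mul_of_nonneg_left hlog_add (by linarith : 0 ≤ 1 + m)
  have b2 := mul_le_mul_of_nonneg_left hlog_sub (by linarith : 0 ≤ 1 - m)
  have b3 : (1 + m) * log (1 + m) + (1 - m) * log (1 - m) < β * x * m ^ 2 := by
    nlinarith [mul_pos (pow_pos hm 2) (sub_pos.2 hm_small)]
  nlinarith [mul_lt_mul_of_pos_left b3 hx]

theorem IsMaximizer.pos {α ν : ℤ → ℝ} {β : ℝ} (hsym : α 1 = α (-1)) (h1 : 0 < α 1)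
    (h0 : 0 < α 0) (hν : IsMaximizer β α ν) : 0 < ν 1 ∧ 0 < ν (-1) ∧ 0 < ν 0 := by
  have hx_eq := hν.mean_field_eq hsym h1 h0
  have hy_eq := (hν.spinSwap hsym h1 h0).mean_field_eq hsym h1 h0
  simp only [_root_.spinSwap, neg_neg, neg_zero] at hy_eq
  have hsum := hν.1.sum_eq
  have hz : 0 < ν 0 := by
    refine (hν.1.1 0).lt_of_ne fun h => ?_
    rw [← h, zero_mul, mul_eq_zero, or_iff_left h0.ne'] at hx_eq hy_eq
    linarith
  refine ⟨pos_of_mul_pos_left (b := α 0) ?_ h0.le, pos_of_mul_pos_left (b := α 0) ?_ h0.le, hz⟩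
  · rw [hx_eq]
    positivity
  · rw [hy_eq]
    positivity

/-- Parametrization of the maximizers favouring the state `1`. -/
theorem IsMaximizer.exists_asym_param {α ν : ℤ → ℝ} {β : ℝ} (hsym : α 1 = α (-1))
    (h1 : 0 < α 1) (h0 : 0 < α 0) (hβ : 0 < β) (hν : IsMaximizer β α ν) (hlt : ν (-1) < ν 1) :
    ∃ u, 0 < u ∧ ν 1 = u * exp u / (β * sinh u) ∧ ν (-1) = u * exp (-u) / (β * sinh u) ∧
      α 0 * exp (asymLog u) = α 1 * (β - 2 * mulCoth u) := by
  have hx_eq := hν.mean_field_eq hsym h1 h0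
  have hy_eq := (hν.spinSwap hsym h1 h0).mean_field_eq hsym h1 h0
  simp only [_root_.spinSwap, neg_neg, neg_zero] at hy_eq
  have hz : ν 0 = 1 - ν 1 - ν (-1) := by linarith [hν.1.sum_eq]
  rw [hz] at hx_eq hy_eq
  exact _root_.exists_asym_param h0 hβ hlt hx_eq hy_eq

theorem IsMaximizer.critical_lt_of_lt {α ν : ℤ → ℝ} {β : ℝ} (hsym : α 1 = α (-1))
    (h1 : 0 < α 1) (h0 : 0 < α 0) (hβ : 0 < β) (hν : IsMaximizer β α ν) (hlt : ν (-1) < ν 1) :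
    2 + exp 1 * α 0 / α 1 < β := by
  obtain ⟨u, hu, -, -, h⟩ := hν.exists_asym_param hsym h1 h0 hβ hlt
  have he := mul_lt_mul_of_pos_left (exp_lt_exp.2 (one_lt_asymLog hu)) h0
  have hw := mul_lt_mul_of_pos_left (one_lt_mulCoth hu) h1
  rw [← lt_sub_iff_add_lt', div_lt_iff₀ h1]
  linarith

theorem IsMaximizer.eq_of_lt {α μ ν : ℤ → ℝ} {β : ℝ} (hsym : α 1 = α (-1))
    (h1 : 0 < α 1) (h0 : 0 < α 0) (hβ : 0 < β) (hμ : IsMaximizer β α μ) (hν : IsMaximizer β α ν)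
    (hμlt : μ (-1) < μ 1) (hνlt : ν (-1) < ν 1) : μ = ν := by
  obtain ⟨u, hu, hux, huy, hu_eq⟩ := hμ.exists_asym_param hsym h1 h0 hβ hμlt
  obtain ⟨v, hv, hvx, hvy, hv_eq⟩ := hν.exists_asym_param hsym h1 h0 hβ hνlt
  have hmono : StrictMonoOn (fun u => α 0 * exp (asymLog u) + 2 * α 1 * mulCoth u)
      (Set.Ioi 0) := by
    intro u hu v hv huv
    have he := mul_lt_mul_of_pos_left (exp_lt_exp.2 (strictMonoOn_asymLog hu hv huv)) h0
    have hw := mul_lt_mul_of_pos_left (strictMonoOn_mulCoth hu hv huv) h1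
    simp only
    linarith
  have huv : u = v := hmono.injOn hu hv (by linarith)
  subst huv
  exact hμ.1.ext hν.1 (hux.trans hvx.symm) (huy.trans hvy.symm)

theorem IsMaximizer.eq_of_symm {α μ ν : ℤ → ℝ} {β : ℝ} (hsym : α 1 = α (-1))
    (h1 : 0 < α 1) (h0 : 0 < α 0) (hβ : 0 < β) (hμ : IsMaximizer β α μ) (hν : IsMaximizer β α ν)
    (hμs : μ 1 = μ (-1)) (hνs : ν 1 = ν (-1)) : μ = ν := by
  have hle {μ ν : ℤ → ℝ} (hμ : IsMaximizer β α μ) (hν : IsMaximizer β α ν)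
      (hμs : μ 1 = μ (-1)) (hνs : ν 1 = ν (-1)) : ν 1 ≤ μ 1 := by
    by_contra! hlt
    have hμ_eq := hμ.mean_field_eq hsym h1 h0
    have hν_eq := hν.mean_field_eq hsym h1 h0
    have hz : ν 0 < μ 0 := by linarith [hμ.1.sum_eq, hν.1.sum_eq]
    have hexp : exp (-β * ν (-1)) < exp (-β * μ (-1)) := by
      rw [exp_lt_exp, ← hμs, ← hνs]
      nlinarith
    have hprod : ν 0 * (α 1 * exp (-β * ν (-1))) < μ 0 * (α 1 * exp (-β * μ (-1))) :=
      mul_lt_mul hz (mul_le_mul_of_nonneg_left hexp.le h1.le) (by positivity) (hμ.1.1 0)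
    have := mul_lt_mul_of_pos_right hlt h0
    linarith
  have h := (hle hν hμ hνs hμs).antisymm (hle hμ hν hμs hνs)
  exact hμ.1.ext hν.1 h (by rw [← hμs, ← hνs, h])

theorem IsMaximizer.ne_of_critical_lt {α ν : ℤ → ℝ} {β : ℝ} (hsym : α 1 = α (-1))
    (h1 : 0 < α 1) (h0 : 0 < α 0) (hβc : 2 + exp 1 * α 0 / α 1 < β) (hν : IsMaximizer β α ν) :
    ν 1 ≠ ν (-1) := by
  intro hs
  have hβ : 0 < β := lt_trans (by positivity) hβc
  have hx := (hν.pos hsym h1 h0).1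
  have hsum := hν.1.sum_eq
  have hx_eq := hν.mean_field_eq hsym h1 h0
  rw [← hs, show ν 0 = 1 - 2 * ν 1 by linarith] at hx_eq
  have hβx : 1 < β * ν 1 := by
    by_contra! hle
    have hexp : exp (β * ν 1) ≤ exp 1 := exp_le_exp.2 hle
    have hee : exp (-β * ν 1) * exp (β * ν 1) = 1 := by rw [← exp_add]; simp
    have hx_eq' : β * ν 1 * α 0 * exp (β * ν 1) = (β - 2 * (β * ν 1)) * α 1 := by
      linear_combination β * exp (β * ν 1) * hx_eq + β * (1 - 2 * ν 1) * α 1 * hee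
    have hprod : β * ν 1 * α 0 * exp (β * ν 1) ≤ 1 * α 0 * exp 1 := by gcongr
    rw [← lt_sub_iff_add_lt', div_lt_iff₀ h1] at hβc
    have := mul_le_mul_of_nonneg_right hle h1.le
    linarith
  obtain ⟨t, ht, htx, hlt⟩ := exists_negMulLog_perturbation hx hβx
  have hz := hν.1.1 0
  have hle := hν.2 _ (isProbVec_spinVec (x := ν 1 + t) (y := ν 1 - t) (by linarith) (by linarith)
    (by linarith))
  rw [Phi_eq hsym h1 h0, Phi_eq hsym h1 h0, ← hs] at hle
  simp only [spinVec, if_true, show ((-1 : ℤ) = 1) = False by simp, if_false,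
    show ((0 : ℤ) = 1) = False by simp, show ((0 : ℤ) = -1) = False by simp,
    show 1 - (ν 1 + t) - (ν 1 - t) = ν 0 by linarith] at hle
  linarith

/-- Second-order phase transition for the symmetric mean-field soft-core
Widom-Rowlinson model at `β_c = 2 + e·α(0)/α(1)`: for `0 < β ≤ β_c` the variational
functional has a unique global maximizer and it is symmetric; for `β > β_c` it has
exactly two global maximizers, exchanged by the spin swap, each asymmetric. -/
theorem wr_mean_field_phase_transition (α : ℤ → ℝ) (hα : IsProbVec α)
    (hsym : α 1 = α (-1)) (h1 : 0 < α 1) (h0 : 0 < α 0) (β : ℝ) :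
    (0 < β → β ≤ 2 + Real.exp 1 * α 0 / α 1 →
      (∃! ν : ℤ → ℝ, IsMaximizer β α ν) ∧
        ∀ ν : ℤ → ℝ, IsMaximizer β α ν → ν 1 = ν (-1)) ∧
    (2 + Real.exp 1 * α 0 / α 1 < β →
      ∃ ν₁ ν₂ : ℤ → ℝ, ν₁ ≠ ν₂ ∧ IsMaximizer β α ν₁ ∧ IsMaximizer β α ν₂ ∧
        ν₂ = spinSwap ν₁ ∧ ν₁ 1 ≠ ν₁ (-1) ∧ ν₂ 1 ≠ ν₂ (-1) ∧
        ∀ ν : ℤ → ℝ, IsMaximizer β α ν → ν = ν₁ ∨ ν = ν₂) := by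
  refine ⟨fun hβ hβc => ?_, fun hβc => ?_⟩
  · have hs (ν : ℤ → ℝ) (hν : IsMaximizer β α ν) : ν 1 = ν (-1) := by
      rcases lt_trichotomy (ν 1) (ν (-1)) with h | h | h
      · refine absurd ((hν.spinSwap hsym h1 h0).critical_lt_of_lt hsym h1 h0 hβ ?_) hβc.not_gt
        simpa [spinSwap] using h
      · exact h
      · exact absurd (hν.critical_lt_of_lt hsym h1 h0 hβ h) hβc.not_gt
    obtain ⟨ν, hν⟩ := exists_isMaximizer hsym h1 h0 β
    exact ⟨⟨ν, hν, fun μ hμ => hμ.eq_of_symm hsym h1 h0 hβ hν (hs μ hμ) (hs ν hν)⟩, hs⟩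
  · have hβ : 0 < β := lt_trans (by positivity) hβc
    have hswap (ν : ℤ → ℝ) : spinSwap (spinSwap ν) = ν := by
      funext s
      simp [spinSwap]
    obtain ⟨ν, hν, hlt⟩ : ∃ ν, IsMaximizer β α ν ∧ ν (-1) < ν 1 := by
      obtain ⟨ν, hν⟩ := exists_isMaximizer hsym h1 h0 β
      rcases (hν.ne_of_critical_lt hsym h1 h0 hβc).lt_or_gt with h | h
      · exact ⟨spinSwap ν, hν.spinSwap hsym h1 h0, by simpa [spinSwap] using h⟩
      · exact ⟨ν, hν, h⟩
    have hν' := hν.spinSwap hsym h1 h0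
    refine ⟨ν, spinSwap ν, fun h => hlt.ne' (congrFun h 1), hν, hν', rfl, hlt.ne',
      hν'.ne_of_critical_lt hsym h1 h0 hβc, fun μ hμ => ?_⟩
    rcases (hμ.ne_of_critical_lt hsym h1 h0 hβc).lt_or_gt with h | h
    · right
      rw [← hswap μ, (hμ.spinSwap hsym h1 h0).eq_of_lt hsym h1 h0 hβ hν
        (by simpa [spinSwap] using h) hlt]
    · exact Or.inl (hμ.eq_of_lt hsym h1 h0 hβ hν h hlt)
end

section
/- Let α be a probability measure on {-1,0,1} with α(s) > 0 for all s, with coordinates h = (1/2) log(α(1)/α(−1)) and l = log((1−α(0))/α(0)), and let β > 0. Suppose ν, parametrized by (x,m) via (ν(−1), ν(0), ν(1)) = ( (x/2)(1−m), 1−x, (x/2)(1+m) ) with x ∈ (0,1) and m ∈ (0,1), is a global maximizer of Φ_{β,α}(ν) = −β ν(1) ν(−1) − I(ν|α). Then, with I(m) = ((1−m)/2) log((1−m)/2) + ((1+m)/2) log((1+m)/2) and I'(m) = (1/2) log((1+m)/(1−m)), the pair (x,m) satisfies β = (2/m)(I'(m) − h) · (1 + e^{−l + log(2 cosh h) + (1/m)(I'(m)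 − h) − m I'(m) + I(m)}) and x = (1 + e^{−l + log(2 cosh h) + (1/m)(I'(m) − h) − m I'(m) + I(m)})^{−1}. -/
open Real Filter Finset Topology

/-- The probability vector on `{-1,0,1}` with occupation density `x` and
magnetization `m`: `(ν(-1), ν(0), ν(1)) = ((x/2)(1-m), 1-x, (x/2)(1+m))`. -/
noncomputable def coordMeasure (x m : ℝ) : ℤ → ℝ := fun s =>
  if s = -1 then x / 2 * (1 - m)
  else if s = 0 then 1 - x
  else if s = 1 then x / 2 * (1 + m)
  else 0

/-- Magnetic-field coordinate `h = (1/2) log(α(1)/α(-1))` of the a priori measure. -/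
noncomputable def hField (α : ℤ → ℝ) : ℝ := (1 / 2) * Real.log (α 1 / α (-1))

/-- Occupation-bias coordinate `l = log((1 - α(0))/α(0))` of the a priori measure. -/
noncomputable def lBias (α : ℤ → ℝ) : ℝ := Real.log ((1 - α 0) / α 0)

/-- Spin entropy `I(m)` (with the convention `0 log 0 = 0`). -/
noncomputable def Ient (m : ℝ) : ℝ :=
  (1 - m) / 2 * Real.log ((1 - m) / 2) + (1 + m) / 2 * Real.log ((1 + m) / 2)

/-- Derivative of the spin entropy, `I'(m) = (1/2) log((1+m)/(1-m))`. -/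
noncomputable def Iprime (m : ℝ) : ℝ := (1 / 2) * Real.log ((1 + m) / (1 - m))

/-- Derivative at `0` of a relative-entropy summand along a line. -/
lemma hasDerivAt_mul_log_div_line {p a : ℝ} (hp : 0 < p) (ha : 0 < a) (d : ℝ) :
    HasDerivAt (fun t : ℝ => (p + t * d) * Real.log ((p + t * d) / a))
      (d * Real.log (p / a) + d) 0 := by
  have hline : HasDerivAt (fun t : ℝ => p + t * d) d 0 := by
    simpa using ((hasDerivAt_id (0 : ℝ)).mul_const d).const_add p
  have hne : (p + 0 * d) / a ≠ 0 := by
    simpa using ⟨hp.ne', ha.ne'⟩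
  refine (hline.mul ((hline.div_const a).log hne)).congr_deriv ?_
  simp only [zero_mul, add_zero]
  field_simp

/-- First-order condition for a maximizer with full support, in a direction `d` tangent
to the simplex. -/
lemma IsMaximizer.stationary {β : ℝ} {α ν d : ℤ → ℝ} (hpos : ∀ s ∈ Spin, 0 < α s)
    (hmax : IsMaximizer β α ν) (hν : ∀ s ∈ Spin, 0 < ν s)
    (hd : ∀ s, s ∉ Spin → d s = 0) (hsum : ∑ s ∈ Spin, d s = 0) :
    β * (d 1 * ν (-1) + ν 1 * d (-1)) + ∑ s ∈ Spin, d s * Real.log (ν s / α s) = 0 := by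
  obtain ⟨⟨-, hsupp, htot⟩, hle⟩ := hmax
  have hline : ∀ s, HasDerivAt (fun t : ℝ => ν s + t * d s) (d s) 0 := fun s => by
    simpa using ((hasDerivAt_id (0 : ℝ)).mul_const (d s)).const_add (ν s)
  have hev : ∀ᶠ t in 𝓝 (0 : ℝ), ∀ s ∈ Spin, 0 < ν s + t * d s :=
    (Finset.eventually_all Spin).2 fun s hs =>
      (hline s).continuousAt.eventually_const_lt (by simpa using hν s hs)
  have hlocal : IsLocalMax (fun t : ℝ => Phi β α (fun s => ν s + t * d s)) 0 := by
    filter_upwards [hev] with t ht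
    simp only [zero_mul, add_zero]
    refine hle _ ⟨fun s => ?_, fun s hs => by simp [hsupp s hs, hd s hs], ?_⟩
    · by_cases hs : s ∈ Spin
      · exact (ht s hs).le
      · simp [hsupp s hs, hd s hs]
    · rw [Finset.sum_add_distrib, ← Finset.mul_sum, htot, hsum]
      simp
  have hent : HasDerivAt (fun t : ℝ => relEnt (fun s => ν s + t * d s) α)
      (∑ s ∈ Spin, (d s * Real.log (ν s / α s) + d s)) 0 :=
    HasDerivAt.fun_sum fun s hs => hasDerivAt_mul_log_div_line (hν s hs) (hpos s hs) (d s)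
  have hderiv := (((hline 1).const_mul (-β)).mul (hline (-1))).sub hent
  have hzero := hlocal.hasDerivAt_eq_zero hderiv
  rw [Finset.sum_add_distrib, hsum] at hzero
  linear_combination -hzero

/-- In terms of the field, `α(1) + α(-1) = 2 cosh h · √(α(1) α(-1))`, in logarithmic form. -/
lemma log_two_mul_cosh_hField {α : ℤ → ℝ} (h₁ : 0 < α 1) (h₂ : 0 < α (-1)) :
    Real.log (2 * Real.cosh (hField α)) =
      Real.log (α 1 + α (-1)) - (Real.log (α 1) + Real.log (α (-1))) / 2 := by
  have hprod : 2 * Real.cosh (hField α) *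
      Real.exp ((Real.log (α 1) + Real.log (α (-1))) / 2) = α 1 + α (-1) := by
    rw [Real.cosh_eq, hField, Real.log_div h₁.ne' h₂.ne', mul_div_cancel₀ _ two_ne_zero,
      add_mul, ← Real.exp_add, ← Real.exp_add]
    ring_nf
    rw [Real.exp_log h₁, Real.exp_log h₂]
  rw [← hprod, Real.log_mul (by positivity) (Real.exp_pos _).ne', Real.log_exp]
  ring

/-- Parametrization of the global maximizers of the mean-field soft-core
Widom-Rowlinson variational functional in `(x, m)` coordinates. -/
theorem maximizer_parametrization (β : ℝ) (hβ : 0 < β) (α : ℤ → ℝ)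
    (hα : IsProbVec α) (hpos : ∀ s ∈ Spin, 0 < α s)
    (x m : ℝ) (hx0 : 0 < x) (hx1 : x < 1) (hm0 : 0 < m) (hm1 : m < 1)
    (hmax : IsMaximizer β α (coordMeasure x m)) :
    β = 2 / m * (Iprime m - hField α) *
        (1 + Real.exp (-(lBias α) + Real.log (2 * Real.cosh (hField α))
          + (1 / m) * (Iprime m - hField α) - m * Iprime m + Ient m)) ∧
    x = (1 + Real.exp (-(lBias α) + Real.log (2 * Real.cosh (hField α))
          + (1 / m) * (Iprime m - hField α) - m * Iprime m + Ient m))⁻¹ := by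
  obtain ⟨-, -, hαsum⟩ := hα
  have hα₁ : 0 < α 1 := hpos 1 (by decide)
  have hα₀ : 0 < α 0 := hpos 0 (by decide)
  have hα₂ : 0 < α (-1) := hpos (-1) (by decide)
  have hp : 0 < 1 + m := by linarith
  have hq : 0 < 1 - m := by linarith
  have hy : 0 < 1 - x := by linarith
  have hν₁ : coordMeasure x m 1 = x * ((1 + m) / 2) := by simp [coordMeasure]; ring
  have hν₀ : coordMeasure x m 0 = 1 - x := by simp [coordMeasure]
  have hν₂ : coordMeasure x m (-1) = x * ((1 - m) / 2) := by simp [coordMeasure]; ring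
  have hν : ∀ s ∈ Spin, 0 < coordMeasure x m s := by
    intro s hs
    simp only [Finset.mem_insert, Finset.mem_singleton] at hs
    rcases hs with rfl | rfl | rfl
    · rw [hν₂]; positivity
    · rwa [hν₀]
    · rw [hν₁]; positivity
  have hplus := hmax.stationary (d := fun s => if s = 1 then 1 else if s = 0 then -1 else 0)
    hpos hν (fun s hs => by simp at hs; simp [hs]) (by simp)
  have hminus := hmax.stationary (d := fun s => if s = -1 then 1 else if s = 0 then -1 else 0)
    hpos hν (fun s hs => by simp at hs; simp [hs]) (by simp)
  simp [hν₁, hν₀, hν₂] at hplus hminus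
  have hlog₁ : Real.log (x * ((1 + m) / 2) / α 1) =
      Real.log x + Real.log ((1 + m) / 2) - Real.log (α 1) := by
    rw [Real.log_div (by positivity) hα₁.ne', Real.log_mul hx0.ne' (by positivity)]
  have hlog₂ : Real.log (x * ((1 - m) / 2) / α (-1)) =
      Real.log x + Real.log ((1 - m) / 2) - Real.log (α (-1)) := by
    rw [Real.log_div (by positivity) hα₂.ne', Real.log_mul hx0.ne' (by positivity)]
  have hI : Iprime m = (Real.log ((1 + m) / 2) - Real.log ((1 - m) / 2)) / 2 := by
    rw [Iprime, ← Real.log_div (by positivity) (by positivity),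
      div_div_div_cancel_right₀ two_ne_zero]
    ring
  have hh : hField α = (Real.log (α 1) - Real.log (α (-1))) / 2 := by
    rw [hField, Real.log_div hα₁.ne' hα₂.ne']
    ring
  have hl : lBias α = Real.log (α 1 + α (-1)) - Real.log (α 0) := by
    have hsum : 1 - α 0 = α 1 + α (-1) := by
      simp at hαsum
      linarith
    rw [lBias, hsum, Real.log_div (by positivity) hα₀.ne']
  rw [hlog₁, Real.log_div hy.ne' hα₀.ne'] at hplus
  rw [hlog₂, Real.log_div hy.ne' hα₀.ne'] at hminus
  have hmag : β * x * m = 2 * (Iprime m - hField α) := by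
    rw [hI, hh]
    linear_combination hminus - hplus
  have hβx : 1 / m * (Iprime m - hField α) = β * x / 2 := by
    field_simp
    linear_combination -hmag
  have hexp : -(lBias α) + Real.log (2 * Real.cosh (hField α))
      + (1 / m) * (Iprime m - hField α) - m * Iprime m + Ient m = Real.log ((1 - x) / x) := by
    rw [hβx, log_two_mul_cosh_hField hα₁ hα₂, hl, Real.log_div hy.ne' hx0.ne', Ient]
    have hmag' := hmag
    rw [hh] at hmag'
    linear_combination (1 + m) / 2 * hplus + (1 - m) / 2 * hminus + m / 2 * hmag'
  have hinv : 1 + (1 - x) / x = x⁻¹ := by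
    field_simp
    ring
  rw [hexp, Real.exp_log (by positivity), hinv, inv_inv]
  refine ⟨?_, rfl⟩
  field_simp
  linear_combination hmag
end

section
/- Fix α(0) ∈ (0,1), let α be the symmetric a priori measure on {-1,0,1} with α(1) = α(−1) = (1−α(0))/2, and let β_c = 2 + e·α(0)/α(1). For h > 0 let α_h be the probability measure with α_h(0) = α(0) and α_h(±1) = e^{±h}(1−α(0))/(2 cosh h), and let m(β_c, h) denote the magnetization coordinate m of a global maximizer of Φ_{β_c, α_h}, where ν is parametrized by (x,m) via (ν(−1), ν(0), ν(1)) = ( (x/2)(1−m), 1−x, (x/2)(1+m) ). Then there exists a constant c' > 0 such that lim_{h↓0} m(β_c, h)/h^{1/3} = c'; in particular the mean-field soft-core Widom-Rowlinson model has the mean-field critical exponent 1/3 for the magnetization in the external-field direction at criticality. -/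
open Real Filter Finset Topology

/-- The tilted a priori measure `α_h` with `α_h(0) = a0` and
`α_h(±1) = e^{±h}(1 - a0)/(2 cosh h)`. -/
noncomputable def tiltedAlpha (a0 h : ℝ) : ℤ → ℝ := fun s =>
  if s = 0 then a0
  else if s = 1 then Real.exp h * (1 - a0) / (2 * Real.cosh h)
  else if s = -1 then Real.exp (-h) * (1 - a0) / (2 * Real.cosh h)
  else 0

/-- The function `y ↦ negMulLog y + negMulLog (w - y) + A y` on `[0, w]` is maximal only at the
interior point where `log y - log (w - y) = A`. -/
lemma pos_and_log_sub_log_eq_of_isMax {y z A : ℝ} (hy : 0 ≤ y) (hz : 0 ≤ z) (hyz : 0 < y + z)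
    (H : ∀ y' z' : ℝ, 0 ≤ y' → 0 ≤ z' → y' + z' = y + z →
      negMulLog y' + negMulLog z' + A * y' ≤ negMulLog y + negMulLog z + A * y) :
    0 < y ∧ 0 < z ∧ log y - log z = A := by
  set w := y + z with hw
  have hE : 0 < 1 + exp A := by positivity
  set z₀ := w / (1 + exp A) with hz₀
  set y₀ := exp A * z₀ with hy₀
  have hz₀pos : 0 < z₀ := by positivity
  have hy₀pos : 0 < y₀ := by positivity
  have hsum : y₀ + z₀ = w := by rw [hy₀, hz₀]; field_simp; ring
  have hlog : log y₀ = A + log z₀ := by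
    rw [hy₀, log_mul (exp_ne_zero A) hz₀pos.ne', log_exp]
  have hmax := H y₀ z₀ hy₀pos.le hz₀pos.le hsum
  have kl (a c : ℝ) (ha : 0 ≤ a) (hc : 0 < c) :
      c * InformationTheory.klFun (a / c) = a * log a - a * log c + c - a := by
    unfold InformationTheory.klFun
    rcases ha.eq_or_lt with rfl | ha
    · simp
    · rw [log_div ha.ne' hc.ne']; field_simp
  have hky := kl y y₀ hy hy₀pos
  have hkz := kl z z₀ hz hz₀pos
  have hny : 0 ≤ y₀ * InformationTheory.klFun (y / y₀) :=
    mul_nonneg hy₀pos.le (InformationTheory.klFun_nonneg (by positivity))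
  have hnz : 0 ≤ z₀ * InformationTheory.klFun (z / z₀) :=
    mul_nonneg hz₀pos.le (InformationTheory.klFun_nonneg (by positivity))
  have hy0 : y₀ * InformationTheory.klFun (y / y₀) = 0 := by
    simp only [negMulLog, hlog] at hmax
    rw [hlog] at hky
    have e : y₀ = y + z - z₀ := by linarith
    have : z₀ * log z₀ + y₀ * log z₀ = y * log z₀ + z * log z₀ := by rw [e]; ring
    nlinarith
  have hyy : y = y₀ := by
    have := (mul_eq_zero.1 hy0).resolve_left hy₀pos.ne'
    rw [InformationTheory.klFun_eq_zero_iff (by positivity)] at this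
    field_simp at this
    exact this
  have hzz : z = z₀ := by linarith
  refine ⟨hyy ▸ hy₀pos, hzz ▸ hz₀pos, ?_⟩
  rw [hyy, hzz, hlog]; ring

/-- The vector with masses `q, r, p` at `-1, 0, 1`. -/
def massVec (q r p : ℝ) : ℤ → ℝ := fun s =>
  if s = -1 then q else if s = 0 then r else if s = 1 then p else 0

lemma isProbVec_massVec {q r p : ℝ} :
    IsProbVec (massVec q r p) ↔ 0 ≤ q ∧ 0 ≤ r ∧ 0 ≤ p ∧ q + r + p = 1 := by
  constructor
  · rintro ⟨h0, -, h1⟩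
    have a := h0 (-1)
    have b := h0 0
    have c := h0 1
    simp [massVec, Spin] at a b c h1
    exact ⟨a, b, c, by linarith⟩
  · rintro ⟨hq, hr, hp, hs⟩
    refine ⟨fun s => ?_, fun s hs => ?_, ?_⟩
    · unfold massVec; split_ifs <;> simp [*]
    · simp [Spin] at hs; simp [massVec, hs]
    · simp [massVec, Spin]; linarith

lemma mul_log_div {y c : ℝ} (hc : 0 < c) : y * log (y / c) = -negMulLog y - y * log c := by
  by_cases hy : y = 0
  · simp [hy]
  · rw [log_div hy hc.ne', negMulLog]; ring

lemma Phi_massVec (β : ℝ) {a0 h : ℝ} (ha0 : a0 ∈ Set.Ioo (0 : ℝ) 1) (q r p : ℝ) :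
    Phi β (tiltedAlpha a0 h) (massVec q r p) =
      -β * p * q + negMulLog q + negMulLog r + negMulLog p
        + r * log a0 + (p + q) * (log ((1 - a0) / 2) - log (cosh h)) + (p - q) * h := by
  have hc := cosh_pos h
  have h1 : 0 < 1 - a0 := by linarith [ha0.2]
  have e (s : ℝ) : log (exp s * (1 - a0) / (2 * cosh h))
      = s + (log ((1 - a0) / 2) - log (cosh h)) := by
    rw [← log_div (by positivity) hc.ne', mul_div_assoc, log_mul (exp_ne_zero _) (by positivity),
      log_exp, div_div]
  have e₁ : 0 < exp h * (1 - a0) / (2 * cosh h) := by positivity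
  have e₂ : 0 < exp (-h) * (1 - a0) / (2 * cosh h) := by positivity
  have hr : relEnt (massVec q r p) (tiltedAlpha a0 h)
      = q * log (q / (exp (-h) * (1 - a0) / (2 * cosh h))) + r * log (r / a0)
        + p * log (p / (exp h * (1 - a0) / (2 * cosh h))) := by
    simp [relEnt, Spin, massVec, tiltedAlpha]; ring
  rw [Phi, hr, mul_log_div e₁, mul_log_div e₂, mul_log_div ha0.1, e, e]
  simp [massVec]; ring

/-- A maximizer has full support, satisfies the stationarity equations, and for `h > 0` charges
`1` more than `-1`. -/
lemma IsMaximizer.stationary_s5 {β a0 h q r p : ℝ} (ha0 : a0 ∈ Set.Ioo (0 : ℝ) 1) (hh : 0 < h)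
    (H : IsMaximizer β (tiltedAlpha a0 h) (massVec q r p)) :
    0 < q ∧ 0 < r ∧ q < p ∧ q + r + p = 1 ∧
      log p - log r = h + log ((1 - a0) / 2) - log a0 - log (cosh h) - β * q ∧
      log q - log r = -h + log ((1 - a0) / 2) - log a0 - log (cosh h) - β * p := by
  obtain ⟨hν, hmax⟩ := H
  obtain ⟨hq, hr, hp, hs⟩ := isProbVec_massVec.1 hν
  have key (q' r' p' : ℝ) (hq' : 0 ≤ q') (hr' : 0 ≤ r') (hp' : 0 ≤ p') (hs' : q' + r' + p' = 1) :=
    hmax _ (isProbVec_massVec.2 ⟨hq', hr', hp', hs'⟩)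
  simp only [Phi_massVec β ha0] at key
  have hle : q ≤ p := by
    have := key p r q hp hr hq (by linarith)
    nlinarith
  have hp_pair (hpr : 0 < p + r) :=
    pos_and_log_sub_log_eq_of_isMax
      (A := h + log ((1 - a0) / 2) - log a0 - log (cosh h) - β * q) hp hr hpr
      (fun p' r' hp' hr' hs' => by
        have := key q r' p' hq hr' hp' (by linarith)
        have e : r' = p + r - p' := by linarith
        have : r' * log a0 = (p + r - p') * log a0 := by rw [e]
        linarith)
  have hq_pair (hqr : 0 < q + r) :=
    pos_and_log_sub_log_eq_of_isMax
      (A := -h + log ((1 - a0) / 2) - log a0 - log (cosh h) - β * p) hq hr hqr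
      (fun q' r' hq' hr' hs' => by
        have := key q' r' p hq' hr' hp (by linarith)
        have e : r' = q + r - q' := by linarith
        have : r' * log a0 = (q + r - q') * log a0 := by rw [e]
        linarith)
  have hrpos : 0 < r := by
    rcases hr.eq_or_lt with h0 | h0
    · exact (hp_pair (by linarith)).2.1
    · exact h0
  obtain ⟨hp0, -, ep⟩ := hp_pair (by linarith)
  obtain ⟨hq0, -, eq⟩ := hq_pair (by linarith)
  refine ⟨hq0, hrpos, lt_of_le_of_ne hle ?_, hs, ep, eq⟩
  rintro rfl
  linarith

lemma coordMeasure_eq_massVec (x m : ℝ) :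
    coordMeasure x m = massVec (x / 2 * (1 - m)) (1 - x) (x / 2 * (1 + m)) := rfl

/-- The mean-field equations at criticality in the variables `t = artanh m` and `u = β x / 2`,
where `b = β / 2`. -/
def CriticalSystem (b h t u : ℝ) : Prop :=
  0 < u ∧ u < b ∧ 0 < t ∧ t = u * tanh t + h ∧
    log u + u - 1 + (log (b - 1) - log (b - u)) = log (cosh t) - log (cosh h)

lemma IsMaximizer.criticalSystem {a0 b h x m : ℝ} (ha0 : a0 ∈ Set.Ioo (0 : ℝ) 1)
    (hb : b = 1 + exp 1 * a0 / (1 - a0)) (hh : 0 < h)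
    (H : IsMaximizer (2 * b) (tiltedAlpha a0 h) (coordMeasure x m)) :
    ∃ t u, CriticalSystem b h t u ∧ m = tanh t := by
  rw [coordMeasure_eq_massVec] at H
  obtain ⟨hq, hr, hqp, -, e₁, e₂⟩ := H.stationary_s5 ha0 hh
  have h1 : 0 < 1 - a0 := by linarith [ha0.2]
  have ha := ha0.1
  have hx : 0 < x := by nlinarith
  have hm0 : 0 < m := by
    by_contra! hm
    nlinarith
  have hm1 : m < 1 := by
    by_contra! hm
    nlinarith
  have hb1 : 0 < b - 1 := by rw [hb]; simp; positivity
  have hm : m ∈ Set.Ioo (-1 : ℝ) 1 := ⟨by linarith, hm1⟩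
  have ht : tanh (artanh m) = m := tanh_artanh hm
  have lp : log (x / 2 * (1 + m)) = log x - log 2 + log (1 + m) := by
    rw [log_mul (by positivity) (by linarith), log_div hx.ne' two_ne_zero]
  have lq : log (x / 2 * (1 - m)) = log x - log 2 + log (1 - m) := by
    rw [log_mul (by positivity) (by linarith), log_div hx.ne' two_ne_zero]
  rw [lp] at e₁
  rw [lq] at e₂
  have hart : artanh m = (log (1 + m) - log (1 - m)) / 2 := by
    rw [artanh_eq_half_log ⟨by linarith, hm1.le⟩, log_div (by linarith) (by linarith)]
    ring
  have hcosh : log (cosh (artanh m)) = -(log (1 + m) + log (1 - m)) / 2 := by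
    rw [cosh_artanh hm, one_div, log_inv, log_sqrt (by nlinarith),
      show 1 - m ^ 2 = (1 + m) * (1 - m) by ring, log_mul (by linarith) (by linarith)]
    ring
  have hK : log ((1 - a0) / 2) - log a0 = 1 - log 2 - log (b - 1) := by
    rw [hb, add_sub_cancel_left, log_div (by positivity) h1.ne', log_mul (by positivity) ha.ne',
      log_exp, log_div h1.ne' two_ne_zero]
    ring
  refine ⟨artanh m, b * x, ⟨by nlinarith, by nlinarith, artanh_pos ⟨hm0, hm1⟩, ?_, ?_⟩, ht.symm⟩
  · rw [ht, hart]; linarith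
  · rw [hcosh, log_mul (by linarith) hx.ne', show b - b * x = b * (1 - x) by ring,
      log_mul (by linarith) hr.ne']
    linarith

lemma tanh_pos_of_pos {t : ℝ} (ht : 0 < t) : 0 < tanh t := by
  rw [tanh_eq_sinh_div_cosh]
  exact div_pos (sinh_pos_iff.2 ht) (cosh_pos t)

lemma tanh_le_tanh_of_le {s t : ℝ} (h : s ≤ t) : tanh s ≤ tanh t := by
  rw [tanh_eq_sinh_div_cosh, tanh_eq_sinh_div_cosh, div_le_div_iff₀ (cosh_pos _) (cosh_pos _)]
  have := sinh_nonneg_iff.2 (sub_nonneg.2 h)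
  rw [sinh_sub] at this
  linarith

lemma tendsto_sinh_div_self : Tendsto (fun t : ℝ => sinh t / t) (𝓝[>] 0) (𝓝 1) := by
  have := (hasDerivAt_sinh 0).tendsto_slope_zero_right
  simpa [div_eq_inv_mul] using this

lemma tendsto_cosh_nhdsGT_zero : Tendsto (fun t : ℝ => cosh t) (𝓝[>] 0) (𝓝 1) := by
  have : Tendsto (fun t : ℝ => cosh t) (𝓝 0) (𝓝 (cosh 0)) := continuous_cosh.tendsto 0
  rw [cosh_zero] at this
  exact this.mono_left nhdsWithin_le_nhds

lemma tendsto_tanh_div_self : Tendsto (fun t : ℝ => tanh t / t) (𝓝[>] 0) (𝓝 1) := by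
  have := tendsto_sinh_div_self.div tendsto_cosh_nhdsGT_zero one_ne_zero
  rw [div_one] at this
  refine this.congr fun t => ?_
  simp only [Pi.div_apply, tanh_eq_sinh_div_cosh]
  rw [div_right_comm]

lemma tendsto_log_cosh_div_sq :
    Tendsto (fun t : ℝ => log (cosh t) / t ^ 2) (𝓝[>] 0) (𝓝 (1 / 2)) := by
  refine HasDerivAt.lhopital_zero_nhdsGT (f' := fun t => tanh t) (g' := fun t => 2 * t)
    ?_ ?_ ?_ ?_ ?_ ?_
  · refine Eventually.of_forall fun t => ?_
    rw [tanh_eq_sinh_div_cosh]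
    exact (hasDerivAt_cosh t).log (cosh_pos t).ne'
  · refine Eventually.of_forall fun t => ?_
    simpa using hasDerivAt_pow 2 t
  · filter_upwards [self_mem_nhdsWithin] with t ht
    exact mul_ne_zero two_ne_zero (ne_of_gt ht)
  · simpa using tendsto_cosh_nhdsGT_zero.log one_ne_zero
  · have : Tendsto (fun t : ℝ => t ^ 2) (𝓝 0) (𝓝 (0 ^ 2)) := (continuous_pow 2).tendsto 0
    simpa using this.mono_left nhdsWithin_le_nhds
  · refine (tendsto_tanh_div_self.div_const 2).congr fun t => ?_
    rw [div_div, mul_comm t]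

lemma tendsto_self_sub_tanh_div_cube :
    Tendsto (fun t : ℝ => (t - tanh t) / t ^ 3) (𝓝[>] 0) (𝓝 (1 / 3)) := by
  have key : Tendsto (fun t : ℝ => (t * cosh t - sinh t) / t ^ 3) (𝓝[>] 0) (𝓝 (1 / 3)) := by
    refine HasDerivAt.lhopital_zero_nhdsGT (f' := fun t => t * sinh t) (g' := fun t => 3 * t ^ 2)
      ?_ ?_ ?_ ?_ ?_ ?_
    · refine Eventually.of_forall fun t => ?_
      refine (((hasDerivAt_id t).mul (hasDerivAt_cosh t)).sub (hasDerivAt_sinh t)).congr_deriv ?_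
      simp
    · refine Eventually.of_forall fun t => ?_
      simpa using hasDerivAt_pow 3 t
    · filter_upwards [self_mem_nhdsWithin] with t ht
      exact mul_ne_zero three_ne_zero (pow_ne_zero 2 (ne_of_gt ht))
    · have : Continuous fun t : ℝ => t * cosh t - sinh t := by fun_prop
      simpa using (this.tendsto 0).mono_left nhdsWithin_le_nhds
    · have : Tendsto (fun t : ℝ => t ^ 3) (𝓝 0) (𝓝 (0 ^ 3)) := (continuous_pow 3).tendsto 0
      simpa using this.mono_left nhdsWithin_le_nhds
    · refine (tendsto_sinh_div_self.div_const 3).congr' ?_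
      filter_upwards [self_mem_nhdsWithin] with t ht
      have : t ≠ 0 := ne_of_gt ht
      field_simp
  have := key.div tendsto_cosh_nhdsGT_zero one_ne_zero
  rw [div_one] at this
  refine this.congr fun t => ?_
  have := (cosh_pos t).ne'
  simp only [Pi.div_apply, tanh_eq_sinh_div_cosh]
  rw [div_right_comm]
  congr 1
  field_simp

/-- The excess of `log u + u - 1` over `log (cosh t)` at zero field, where `u = t / tanh t`. -/
noncomputable def zeroFieldGap (t : ℝ) : ℝ :=
  log t - log (sinh t) + t * cosh t / sinh t - 1

lemma zeroFieldGap_strictMonoOn : StrictMonoOn zeroFieldGap (Set.Ioi 0) := by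
  have hd (t : ℝ) (ht : 0 < t) :
      HasDerivAt zeroFieldGap (1 / t - t / sinh t ^ 2) t := by
    have hs := (sinh_pos_iff.2 ht).ne'
    have := (((hasDerivAt_log ht.ne').sub ((hasDerivAt_sinh t).log hs)).add
      (((hasDerivAt_id t).mul (hasDerivAt_cosh t)).div (hasDerivAt_sinh t) hs)).sub_const 1
    refine this.congr_deriv ?_
    simp only [id, Pi.mul_apply]
    have h2 := cosh_sq t
    field_simp
    linear_combination (-t ^ 2) * h2
  refine strictMonoOn_of_deriv_pos (convex_Ioi 0)
    (fun t ht => (hd t ht).continuousAt.continuousWithinAt) fun t ht => ?_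
  rw [interior_Ioi] at ht
  have ht : 0 < t := ht
  have hlt := self_lt_sinh_iff.2 ht
  rw [(hd t ht).deriv, sub_pos, div_lt_div_iff₀ (by positivity) ht]
  nlinarith

lemma tendsto_zeroFieldGap : Tendsto zeroFieldGap (𝓝[>] 0) (𝓝 0) := by
  have h1 := tendsto_sinh_div_self.log one_ne_zero
  have h2 := tendsto_cosh_nhdsGT_zero.div tendsto_sinh_div_self one_ne_zero
  have := (h2.sub h1).sub_const 1
  simp only [log_one, div_one, sub_zero, sub_self] at this
  refine this.congr' ?_
  filter_upwards [self_mem_nhdsWithin] with t (ht : 0 < t)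
  have hs := sinh_pos_iff.2 ht
  simp only [Pi.div_apply, zeroFieldGap]
  rw [log_div hs.ne' ht.ne']
  field_simp
  ring

lemma zeroFieldGap_pos {t : ℝ} (ht : 0 < t) : 0 < zeroFieldGap t := by
  have hhalf : 0 < t / 2 := by positivity
  have h0 : 0 ≤ zeroFieldGap (t / 2) := by
    refine le_of_tendsto tendsto_zeroFieldGap ?_
    filter_upwards [Ioo_mem_nhdsGT hhalf] with s hs
    exact (zeroFieldGap_strictMonoOn hs.1 hhalf hs.2).le
  exact h0.trans_lt (zeroFieldGap_strictMonoOn hhalf ht (by linarith))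

namespace CriticalSystem

variable {b h t u : ℝ}

lemma field_lt (H : CriticalSystem b h t u) : h < t := by
  obtain ⟨hu, -, ht, e, -⟩ := H
  linarith [mul_pos hu (tanh_pos_of_pos ht)]

lemma one_lt (hb : 1 < b) (hh : 0 < h) (H : CriticalSystem b h t u) : 1 < u := by
  have hlt := H.field_lt
  obtain ⟨hu, hub, ht, -, e⟩ := H
  by_contra! hu1
  have h1 : log (b - 1) ≤ log (b - u) := log_le_log (by linarith) (by linarith)
  have h2 : log u ≤ 0 := log_nonpos hu.le hu1
  have h3 : log (cosh h) < log (cosh t) :=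
    log_lt_log (cosh_pos h) (cosh_lt_cosh.2 (by rwa [abs_of_pos hh, abs_of_pos ht]))
  linarith

lemma zeroFieldGap_mul_tanh_le (hb : 1 < b) (hh : 0 < h) (H : CriticalSystem b h t u) :
    zeroFieldGap t * tanh t ≤ 2 * h := by
  have hu1 := H.one_lt hb hh
  obtain ⟨hu, hub, ht, et, e⟩ := H
  have hT := tanh_pos_of_pos ht
  have hs := sinh_pos_iff.2 ht
  have hc := cosh_pos t
  have h1 : log (b - u) ≤ log (b - 1) := log_le_log (by linarith) (by linarith)
  have h2 : 0 ≤ log (cosh h) := log_nonneg (one_le_cosh h)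
  have hu0 : t / tanh t = u + h / tanh t := by
    field_simp
    linarith
  have hδ : 0 < h / tanh t := by positivity
  have hlog : log (t / tanh t) ≤ log u + h / tanh t := by
    have h3 := log_le_sub_one_of_pos (show 0 < t / tanh t / u by positivity)
    rw [log_div (by positivity) hu.ne', hu0, add_div, div_self hu.ne'] at h3
    have h4 : h / tanh t / u ≤ h / tanh t := div_le_self hδ.le hu1.le
    rw [hu0]
    linarith
  have hgap : zeroFieldGap t = log (t / tanh t) + t / tanh t - 1 - log (cosh t) := by
    rw [zeroFieldGap, log_div ht.ne' hT.ne', tanh_eq_sinh_div_cosh, log_div hs.ne' hc.ne',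
      div_div_eq_mul_div]
    ring
  have : zeroFieldGap t ≤ 2 * h / tanh t := by
    rw [hgap, mul_div_assoc]
    linarith
  rwa [le_div_iff₀ hT] at this

end CriticalSystem

/-- Along solutions of the critical system, `t` vanishes with the field. -/
lemma tendsto_nhdsGT_of_criticalSystem {b : ℝ} (hb : 1 < b) {t u : ℝ → ℝ}
    (H : ∀ h, 0 < h → CriticalSystem b h (t h) (u h)) :
    Tendsto t (𝓝[>] 0) (𝓝[>] 0) := by
  have hpos : ∀ᶠ h in 𝓝[>] (0 : ℝ), 0 < t h := by
    filter_upwards [self_mem_nhdsWithin] with h hh using (H h hh).2.2.1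
  refine tendsto_nhdsWithin_iff.2 ⟨?_, hpos⟩
  refine tendsto_order.2 ⟨fun a ha => hpos.mono fun h hh => ha.trans hh, fun ε hε => ?_⟩
  have hgap := zeroFieldGap_pos hε
  have hT := tanh_pos_of_pos hε
  have hη : 0 < zeroFieldGap ε * tanh ε / 2 := by positivity
  filter_upwards [Ioo_mem_nhdsGT hη] with h hh
  by_contra! hle
  have h1 := (H h hh.1).zeroFieldGap_mul_tanh_le hb hh.1
  have h2 : zeroFieldGap ε ≤ zeroFieldGap (t h) :=
    zeroFieldGap_strictMonoOn.monotoneOn hε (hε.trans_le hle) hle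
  have h3 := mul_le_mul h2 (tanh_le_tanh_of_le hle) hT.le (hgap.le.trans h2)
  linarith [hh.2]

/-- Along solutions of the critical system, `u` tends to its critical value `1` from above. -/
lemma tendsto_nhdsGT_one_of_criticalSystem {b : ℝ} (hb : 1 < b) {t u : ℝ → ℝ}
    (H : ∀ h, 0 < h → CriticalSystem b h (t h) (u h)) :
    Tendsto u (𝓝[>] 0) (𝓝[>] 1) := by
  have hone : ∀ᶠ h in 𝓝[>] (0 : ℝ), 1 < u h := by
    filter_upwards [self_mem_nhdsWithin] with h hh using (H h hh).one_lt hb hh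
  refine tendsto_nhdsWithin_iff.2 ⟨?_, hone⟩
  have hlim := (tendsto_tanh_div_self.comp (tendsto_nhdsGT_of_criticalSystem hb H)).inv₀ one_ne_zero
  rw [inv_one] at hlim
  refine tendsto_of_tendsto_of_tendsto_of_le_of_le' tendsto_const_nhds hlim
    (hone.mono fun _ => le_of_lt) ?_
  filter_upwards [self_mem_nhdsWithin] with h (hh : 0 < h)
  obtain ⟨-, -, ht, e, -⟩ := H h hh
  rw [Function.comp_apply, inv_div, le_div_iff₀ (tanh_pos_of_pos ht)]
  linarith

/-- The left side of the second critical equation vanishes at `u = 1` to first order. -/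
lemma tendsto_critical_slope {b : ℝ} (hb : 1 < b) :
    Tendsto (fun u => (log u + u - 1 + (log (b - 1) - log (b - u))) / (u - 1)) (𝓝[>] 1)
      (𝓝 ((2 * b - 1) / (b - 1))) := by
  have hb0 : b - 1 ≠ 0 := by linarith
  have hd : HasDerivAt (fun u => log u + u - 1 + (log (b - 1) - log (b - u)))
      ((2 * b - 1) / (b - 1)) 1 := by
    have := (((hasDerivAt_log one_ne_zero).add (hasDerivAt_id (1 : ℝ))).sub_const 1).add
      ((((hasDerivAt_id (1 : ℝ)).const_sub b).log hb0).const_sub (log (b - 1)))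
    refine this.congr_deriv ?_
    simp only [id]
    field_simp
    ring
  have := hd.tendsto_slope.mono_left (nhdsGT_le_nhdsNE 1)
  refine this.congr fun u => ?_
  simp [slope_def_field]

/-- Asymptotics of solutions of the critical system: `h ~ (b + 1) / (6 (2b - 1)) t ^ 3`. -/
lemma tendsto_field_div_cube {b : ℝ} (hb : 1 < b) {t u : ℝ → ℝ}
    (H : ∀ h, 0 < h → CriticalSystem b h (t h) (u h)) :
    Tendsto (fun h => h / t h ^ 3) (𝓝[>] 0) (𝓝 ((b + 1) / (6 * (2 * b - 1)))) := by
  have ht := tendsto_nhdsGT_of_criticalSystem hb H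
  have hu := tendsto_nhdsGT_one_of_criticalSystem hb H
  have htanh := tendsto_tanh_div_self.comp ht
  have hratio : Tendsto (fun h => h / t h) (𝓝[>] 0) (𝓝 0) := by
    have := ((hu.mono_right nhdsWithin_le_nhds).mul htanh).const_sub 1
    rw [one_mul, sub_self] at this
    refine this.congr' ?_
    filter_upwards [self_mem_nhdsWithin] with h (hh : 0 < h)
    obtain ⟨-, -, ht, e, -⟩ := H h hh
    simp only [Function.comp_apply]
    field_simp
    linarith
  have hrhs : Tendsto (fun h => (log (cosh (t h)) - log (cosh h)) / t h ^ 2) (𝓝[>] 0)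
      (𝓝 (1 / 2)) := by
    have := (tendsto_log_cosh_div_sq.comp ht).sub (tendsto_log_cosh_div_sq.mul (hratio.pow 2))
    rw [zero_pow two_ne_zero, mul_zero, sub_zero] at this
    refine this.congr' ?_
    filter_upwards [self_mem_nhdsWithin] with h (hh : 0 < h)
    obtain ⟨-, -, ht, -, -⟩ := H h hh
    simp only [Function.comp_apply]
    field_simp
  have hdev : Tendsto (fun h => (u h - 1) / t h ^ 2) (𝓝[>] 0)
      (𝓝 (1 / 2 / ((2 * b - 1) / (b - 1)))) := by
    refine (hrhs.div ((tendsto_critical_slope hb).comp hu)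
      (div_ne_zero (by linarith) (by linarith))).congr' ?_
    filter_upwards [self_mem_nhdsWithin] with h (hh : 0 < h)
    have hlt := (H h hh).field_lt
    have hu1 := (H h hh).one_lt hb hh
    obtain ⟨-, -, ht, -, e⟩ := H h hh
    have hne : log (cosh (t h)) - log (cosh h) ≠ 0 := by
      refine (sub_pos.2 (log_lt_log (cosh_pos h) (cosh_lt_cosh.2 ?_))).ne'
      rwa [abs_of_pos hh, abs_of_pos ht]
    have hu0 : u h - 1 ≠ 0 := by linarith
    simp only [Function.comp_apply, Pi.div_apply]
    rw [e]
    field_simp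
  have := (tendsto_self_sub_tanh_div_cube.comp ht).sub (hdev.mul htanh)
  have hlim : 1 / 3 - 1 / 2 / ((2 * b - 1) / (b - 1)) * 1 = (b + 1) / (6 * (2 * b - 1)) := by
    have h1 : 2 * b - 1 ≠ 0 := by linarith
    have h2 : b - 1 ≠ 0 := by linarith
    field_simp
    ring
  rw [hlim] at this
  refine this.congr' ?_
  filter_upwards [self_mem_nhdsWithin] with h (hh : 0 < h)
  obtain ⟨-, -, ht, e, -⟩ := H h hh
  simp only [Function.comp_apply]
  field_simp
  linarith

/-- Mean-field critical exponent `1/3` for the magnetization of the mean-field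
soft-core Widom-Rowlinson model in the external-field direction at criticality:
if `M h` denotes, for `h > 0`, the magnetization coordinate of a global maximizer
of `Φ_{β_c, α_h}`, then `M h / h^{1/3} → c' > 0` as `h ↓ 0`. -/
theorem critical_exponent_external_field (a0 : ℝ) (ha0 : a0 ∈ Set.Ioo (0 : ℝ) 1)
    (M : ℝ → ℝ)
    (hM : ∀ h : ℝ, 0 < h →
      ∃ x : ℝ, IsMaximizer (2 + Real.exp 1 * a0 / ((1 - a0) / 2)) (tiltedAlpha a0 h)
        (coordMeasure x (M h))) :
    ∃ c' : ℝ, 0 < c' ∧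
      Tendsto (fun h : ℝ => M h / h ^ ((1 : ℝ) / 3)) (𝓝[>] (0 : ℝ)) (𝓝 c') := by
  have h1 : 0 < 1 - a0 := by linarith [ha0.2]
  have ha := ha0.1
  set b := 1 + exp 1 * a0 / (1 - a0) with hbdef
  have hb : 1 < b := by rw [hbdef]; simp; positivity
  have hβ : 2 + exp 1 * a0 / ((1 - a0) / 2) = 2 * b := by rw [hbdef]; field_simp
  rw [hβ] at hM
  have hsol (h : ℝ) : ∃ t u, 0 < h → CriticalSystem b h t u ∧ M h = tanh t := by
    by_cases hh : 0 < h
    · obtain ⟨x, hx⟩ := hM h hh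
      obtain ⟨t, u, htu⟩ := hx.criticalSystem ha0 hbdef hh
      exact ⟨t, u, fun _ => htu⟩
    · exact ⟨0, 0, fun hh' => absurd hh' hh⟩
  choose t u htu using hsol
  have H (h : ℝ) (hh : 0 < h) := (htu h hh).1
  have hκ : 0 < (b + 1) / (6 * (2 * b - 1)) := div_pos (by linarith) (by linarith)
  have hcube := (((tendsto_tanh_div_self.comp (tendsto_nhdsGT_of_criticalSystem hb H)).pow 3).div
    (tendsto_field_div_cube hb H) hκ.ne').rpow_const (p := (1 : ℝ) / 3) (Or.inr (by norm_num))
  refine ⟨_, ?_, hcube.congr' ?_⟩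
  · positivity
  · filter_upwards [self_mem_nhdsWithin] with h (hh : 0 < h)
    have ht := (H h hh).2.2.1
    have hm : 0 < M h := (htu h hh).2 ▸ tanh_pos_of_pos ht
    have e : (tanh (t h) / t h) ^ 3 / (h / t h ^ 3) = M h ^ 3 / h := by
      rw [(htu h hh).2]
      field_simp
    simp only [Pi.div_apply, Function.comp_apply]
    rw [e, div_rpow (by positivity) hh.le, ← rpow_natCast, ← rpow_mul hm.le]
    norm_num
end

section
/- For every β ≥ 0 and every a priori probability measure α on {-1,0,1} with α(s) > 0 for all s, there exists a time t₀ > 0 such that for all 0 < t < t₀ the time-evolved mean-field soft-core Widom-Rowlinson model (μ_{N,t})_{N∈ℕ} is sequentially Gibbs, i.e., the set of bad empirical measures B^{WiRo}(β,t) is empty. -/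
open Real Filter Finset Topology

/-- Transition probabilities of the rate-one independent symmetric spin-flip
dynamics which keeps holes fixed. -/
noncomputable def pFlip (t : ℝ) (a b : ℤ) : ℝ :=
  if a = 0 ∧ b = 0 then 1
  else if (a = 1 ∧ b = 1) ∨ (a = -1 ∧ b = -1) then (1 + Real.exp (-2 * t)) / 2
  else if (a = 1 ∧ b = -1) ∨ (a = -1 ∧ b = 1) then (1 - Real.exp (-2 * t)) / 2
  else 0

/-- The (unnormalized) weight of the time-evolved mean-field soft-core
Widom-Rowlinson model at time `t`. -/
noncomputable def wrWeightT (β : ℝ) (α : ℤ → ℝ) (t : ℝ) {N : ℕ}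
    (η : Fin N → Spin) : ℝ :=
  ∑ ω : Fin N → Spin, wrWeight β α ω * ∏ i : Fin N, pFlip t (ω i : ℤ) (η i : ℤ)

/-- The single-site conditional probability `μ_{N+1,t}(η_1 = σ | rest = τ)` of the
time-evolved mean-field soft-core Widom-Rowlinson model. -/
noncomputable def wrCondProbT (β : ℝ) (α : ℤ → ℝ) (t : ℝ) {N : ℕ} (σ : Spin)
    (τ : Fin N → Spin) : ℝ :=
  wrWeightT β α t (Fin.cons σ τ) / ∑ σ' : Spin, wrWeightT β α t (Fin.cons σ' τ)

/-- The empirical distributions of the boundary conditions `τ N` converge to `ν`. -/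
def EmpConv (τ : (N : ℕ) → Fin N → Spin) (ν : ℤ → ℝ) : Prop :=
  ∀ s : ℤ, Tendsto
    (fun N : ℕ => ((univ.filter (fun i : Fin N => (τ N i : ℤ) = s)).card : ℝ) / N)
    atTop (𝓝 (ν s))

/-- `ν` is a bad empirical measure for the time-evolved mean-field soft-core
Widom-Rowlinson model at time `t`: there are two sequences of boundary conditions,
both with empirical distributions converging to `ν`, along which some single-site
conditional probability does not converge to the same limit. -/
def IsBadMeasure (β : ℝ) (α : ℤ → ℝ) (t : ℝ) (ν : ℤ → ℝ) : Prop :=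
  ∃ τ τ' : (N : ℕ) → Fin N → Spin, EmpConv τ ν ∧ EmpConv τ' ν ∧
    ∃ σ : Spin, ¬ ∃ L : ℝ,
      Tendsto (fun N : ℕ => wrCondProbT β α t σ (τ N)) atTop (𝓝 L) ∧
      Tendsto (fun N : ℕ => wrCondProbT β α t σ (τ' N)) atTop (𝓝 L)

namespace WidomRowlinson

/-- The joint weight of a spin with initial value `a` and value `s` at time `t`. -/
noncomputable def siteWeight (α : ℤ → ℝ) (t : ℝ) (a s : ℤ) : ℝ := α a * pFlip t a s

/-- The mean of an initial spin whose value at time `t` is `s`, in the effective field `z`;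
it is zero for holes. -/
noncomputable def siteMean (α : ℤ → ℝ) (t : ℝ) (s : ℤ) (z : ℝ) : ℝ :=
  (siteWeight α t 1 s * exp z - siteWeight α t (-1) s) /
    (siteWeight α t 1 s * exp z + siteWeight α t (-1) s)

/-- The total magnetization of a configuration. -/
def magnetization {N : ℕ} (ω : Fin N → Spin) : ℝ := ∑ i, ((ω i : ℤ) : ℝ)

/-- The number of occupied sites of a configuration. -/
def occupation {N : ℕ} (ω : Fin N → Spin) : ℝ := ∑ i, ((ω i : ℤ) : ℝ) ^ 2

/-- The weight of the initial configuration `ω` on `N` sites of a system of size `N + 1`,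
given the configuration `τ` at time `t`. -/
noncomputable def clampedWeight (β : ℝ) (α : ℤ → ℝ) (t : ℝ) {N : ℕ} (τ ω : Fin N → Spin) : ℝ :=
  exp (-(β / (2 * ((N + 1 : ℕ) : ℝ))) * ((occupation ω ^ 2 - magnetization ω ^ 2) / 2)) *
    ∏ j, siteWeight α t (ω j) (τ j)

/-- The expectation with respect to the normalized `clampedWeight`. -/
noncomputable def clampedMean (β : ℝ) (α : ℤ → ℝ) (t : ℝ) {N : ℕ} (τ : Fin N → Spin)
    (f : (Fin N → Spin) → ℝ) : ℝ :=
  (∑ ω, clampedWeight β α t τ ω * f ω) / ∑ ω, clampedWeight β α t τ ω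

/-- The spin flip on `{-1, 0, 1}`. -/
def flip (s : Spin) : Spin := ⟨-s, by
  obtain ⟨s, hs⟩ := s
  simp only [Spin, mem_insert, mem_singleton] at hs ⊢
  omega⟩

lemma flip_flip (s : Spin) : flip (flip s) = s := by
  simp [flip]

lemma spin_cases (s : Spin) : (s : ℤ) = -1 ∨ (s : ℤ) = 0 ∨ (s : ℤ) = 1 := by
  obtain ⟨s, hs⟩ := s
  simpa using hs

lemma abs_spin_le_one (s : Spin) : |((s : ℤ) : ℝ)| ≤ 1 := by
  rcases spin_cases s with h | h | h <;> simp [h]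

lemma indicator_eq (a b : Spin) :
    (if ((a : ℤ) * (b : ℤ) = -1) then (1 : ℝ) else 0) =
      (((a : ℤ) : ℝ) ^ 2 * ((b : ℤ) : ℝ) ^ 2 - ((a : ℤ) : ℝ) * ((b : ℤ) : ℝ)) / 2 := by
  rcases spin_cases a with h | h | h <;> rcases spin_cases b with h' | h' | h' <;>
    simp [h, h']

lemma sum_indicator_eq {N : ℕ} (a : Spin) (ω : Fin N → Spin) :
    ∑ j, (if ((a : ℤ) * (ω j : ℤ) = -1) then (1 : ℝ) else 0) =
      (((a : ℤ) : ℝ) ^ 2 * occupation ω - ((a : ℤ) : ℝ) * magnetization ω) / 2 := by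
  simp only [indicator_eq, occupation, magnetization, mul_sum, ← sum_sub_distrib, sum_div]

lemma sum_sum_indicator_eq {N : ℕ} (ω : Fin N → Spin) :
    ∑ i, ∑ j, (if ((ω i : ℤ) * (ω j : ℤ) = -1) then (1 : ℝ) else 0) =
      (occupation ω ^ 2 - magnetization ω ^ 2) / 2 := by
  simp only [sum_indicator_eq, ← sum_div, sum_sub_distrib, ← sum_mul]
  rw [occupation, magnetization]
  ring

lemma abs_magnetization_le {N : ℕ} (ω : Fin N → Spin) : |magnetization ω| ≤ N := by
  refine (abs_sum_le_sum_abs _ _).trans ?_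
  simpa using sum_le_sum fun i (_ : i ∈ univ) => abs_spin_le_one (ω i)

lemma abs_magnetization_sub_le {N : ℕ} (ω : Fin N → Spin) (i : Fin N) :
    |magnetization ω - ((ω i : ℤ) : ℝ)| ≤ N := by
  have h : magnetization ω - ((ω i : ℤ) : ℝ) = ∑ j ∈ univ.erase i, ((ω j : ℤ) : ℝ) := by
    rw [magnetization, ← add_sum_erase _ _ (mem_univ i)]
    ring
  rw [h]
  refine (abs_sum_le_sum_abs _ _).trans ?_
  refine (sum_le_sum_of_subset_of_nonneg (erase_subset _ _) fun _ _ _ => abs_nonneg _).trans ?_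
  simpa using sum_le_sum fun i (_ : i ∈ univ) => abs_spin_le_one (ω i)

lemma abs_exp_sub_exp_le {x y B : ℝ} (hx : x ≤ B) (hy : y ≤ B) :
    |exp x - exp y| ≤ exp B * |x - y| := by
  wlog h : y ≤ x generalizing x y
  · rw [abs_sub_comm, abs_sub_comm x]
    exact this hy hx (le_of_not_ge h)
  rw [abs_of_nonneg (sub_nonneg.2 (exp_le_exp.2 h)), abs_of_nonneg (sub_nonneg.2 h)]
  have h₁ : exp y = exp x * exp (y - x) := by rw [← exp_add]; ring_nf
  have h₂ := add_one_le_exp (y - x)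
  have h₃ := exp_le_exp.2 hx
  have h₄ := exp_pos x
  rw [h₁]
  nlinarith [mul_le_mul_of_nonneg_left h₂ h₄.le, mul_le_mul_of_nonneg_right h₃ (sub_nonneg.2 h)]

lemma exp_neg_two_mul_lt_one {t : ℝ} (ht : 0 < t) : exp (-2 * t) < 1 := by
  rw [exp_lt_one_iff]; linarith

lemma pFlip_nonneg {t : ℝ} (ht : 0 < t) (a b : ℤ) : 0 ≤ pFlip t a b := by
  have := exp_neg_two_mul_lt_one ht
  have := exp_pos (-2 * t)
  unfold pFlip
  split_ifs <;> linarith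

lemma pFlip_self_pos (t : ℝ) (s : Spin) : 0 < pFlip t s s := by
  rcases spin_cases s with h | h | h <;> simp [h, pFlip] <;> positivity

lemma siteWeight_pos_of_ne_zero {α : ℤ → ℝ} (hpos : ∀ s ∈ Spin, 0 < α s) {t : ℝ} (ht : 0 < t)
    {a s : Spin} (ha : (a : ℤ) ≠ 0) (hs : (s : ℤ) ≠ 0) : 0 < siteWeight α t a s := by
  have := exp_neg_two_mul_lt_one ht
  have := exp_pos (-2 * t)
  refine mul_pos (hpos _ a.2) ?_
  rcases spin_cases a with h | h | h <;> rcases spin_cases s with h' | h' | h' <;>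
    simp [h, h', pFlip, -neg_mul] at ha hs ⊢ <;> linarith

lemma siteWeight_hole_right (α : ℤ → ℝ) (t : ℝ) {a : ℤ} (ha : a ≠ 0) : siteWeight α t a 0 = 0 := by
  simp [siteWeight, pFlip, ha]

lemma siteWeight_hole_left (α : ℤ → ℝ) (t : ℝ) {s : ℤ} (hs : s ≠ 0) : siteWeight α t 0 s = 0 := by
  simp [siteWeight, pFlip, hs]

lemma siteMean_hole (α : ℤ → ℝ) (t z : ℝ) : siteMean α t 0 z = 0 := by
  simp [siteMean, siteWeight_hole_right]

section Weights

variable {β : ℝ} {α : ℤ → ℝ} {t : ℝ} {N : ℕ} {τ : Fin N → Spin}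

lemma siteWeight_nonneg (hpos : ∀ s ∈ Spin, 0 < α s) (ht : 0 < t) (a : Spin) (s : ℤ) :
    0 ≤ siteWeight α t a s :=
  mul_nonneg (hpos _ a.2).le (pFlip_nonneg ht _ _)

lemma clampedWeight_nonneg (hpos : ∀ s ∈ Spin, 0 < α s) (ht : 0 < t) (ω : Fin N → Spin) :
    0 ≤ clampedWeight β α t τ ω :=
  mul_nonneg (exp_pos _).le (prod_nonneg fun _ _ => siteWeight_nonneg hpos ht _ _)

lemma sum_clampedWeight_pos (hpos : ∀ s ∈ Spin, 0 < α s) (ht : 0 < t) :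
    0 < ∑ ω, clampedWeight β α t τ ω :=
  sum_pos' (fun ω _ => clampedWeight_nonneg hpos ht ω) ⟨τ, mem_univ _, mul_pos (exp_pos _)
    (prod_pos fun i _ => mul_pos (hpos _ (τ i).2) (pFlip_self_pos t (τ i)))⟩

lemma clampedWeight_eq_zero {ω : Fin N → Spin} {i : Fin N}
    (h : siteWeight α t (ω i) (τ i) = 0) : clampedWeight β α t τ ω = 0 := by
  rw [clampedWeight, prod_eq_zero (mem_univ i) h, mul_zero]

lemma sq_eq_sq_of_clampedWeight_ne_zero {ω : Fin N → Spin} (h : clampedWeight β α t τ ω ≠ 0)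
    (i : Fin N) : ((ω i : ℤ) : ℝ) ^ 2 = ((τ i : ℤ) : ℝ) ^ 2 := by
  have h' : siteWeight α t (ω i) (τ i) ≠ 0 := fun h' => h (clampedWeight_eq_zero h')
  rcases spin_cases (ω i) with ha | ha | ha <;> rcases spin_cases (τ i) with hb | hb | hb <;>
    simp [ha, hb, siteWeight, pFlip] at h' ⊢

lemma occupation_eq_of_clampedWeight_ne_zero {ω : Fin N → Spin}
    (h : clampedWeight β α t τ ω ≠ 0) : occupation ω = occupation τ :=
  sum_congr rfl fun i _ => sq_eq_sq_of_clampedWeight_ne_zero h i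

lemma magnetization_update_flip (ω : Fin N → Spin) (i : Fin N) :
    magnetization (Function.update ω i (flip (ω i))) = magnetization ω - 2 * ((ω i : ℤ) : ℝ) := by
  rw [magnetization, magnetization, ← add_sum_erase _ _ (mem_univ i),
    ← add_sum_erase univ (fun j => ((ω j : ℤ) : ℝ)) (mem_univ i),
    sum_congr rfl fun j hj => by rw [Function.update_of_ne (ne_of_mem_erase hj)]]
  simp [flip]
  ring

lemma occupation_update_flip (ω : Fin N → Spin) (i : Fin N) :
    occupation (Function.update ω i (flip (ω i))) = occupation ω := by
  refine sum_congr rfl fun j _ => ?_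
  rcases eq_or_ne j i with rfl | h
  · simp [flip]
  · rw [Function.update_of_ne h]

lemma clampedWeight_eq (ω : Fin N → Spin) (i : Fin N) :
    clampedWeight β α t τ ω =
      exp (-(β / (2 * ((N + 1 : ℕ) : ℝ))) * ((occupation ω ^ 2 - magnetization ω ^ 2) / 2)) *
        (siteWeight α t (ω i) (τ i) * ∏ j ∈ univ.erase i, siteWeight α t (ω j) (τ j)) := by
  rw [clampedWeight, mul_prod_erase univ (fun j => siteWeight α t (ω j) (τ j)) (mem_univ i)]

lemma clampedWeight_update_flip (ω : Fin N → Spin) (i : Fin N) :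
    clampedWeight β α t τ (Function.update ω i (flip (ω i))) * siteWeight α t (ω i) (τ i) =
      exp (-(β / ((N + 1 : ℕ) : ℝ)) * ((ω i : ℤ) : ℝ) *
        (magnetization ω - ((ω i : ℤ) : ℝ))) *
      (clampedWeight β α t τ ω * siteWeight α t (-(ω i : ℤ)) (τ i)) := by
  rw [clampedWeight_eq _ i, clampedWeight_eq ω i, occupation_update_flip,
    magnetization_update_flip,
    prod_congr rfl fun j hj => by rw [Function.update_of_ne (ne_of_mem_erase hj)]]
  have h : -(β / (2 * ((N + 1 : ℕ) : ℝ))) *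
      ((occupation ω ^ 2 - (magnetization ω - 2 * ((ω i : ℤ) : ℝ)) ^ 2) / 2) =
      -(β / (2 * ((N + 1 : ℕ) : ℝ))) * ((occupation ω ^ 2 - magnetization ω ^ 2) / 2) +
      -(β / ((N + 1 : ℕ) : ℝ)) * ((ω i : ℤ) : ℝ) * (magnetization ω - ((ω i : ℤ) : ℝ)) := by
    field_simp
    ring
  rw [h, exp_add]
  simp only [Function.update_self, flip]
  ring

/-- Given the other spins, the spin at `i` has mean `siteMean` in the field of those spins. -/
lemma sum_clampedWeight_mul_sub_siteMean (hpos : ∀ s ∈ Spin, 0 < α s) (ht : 0 < t) (i : Fin N)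
    (h : ℝ → ℝ) :
    ∑ ω, clampedWeight β α t τ ω * ((((ω i : ℤ) : ℝ) -
      siteMean α t (τ i) (β / ((N + 1 : ℕ) : ℝ) * (magnetization ω - ((ω i : ℤ) : ℝ)))) *
        h (magnetization ω - ((ω i : ℤ) : ℝ))) = 0 := by
  by_cases hτ : (τ i : ℤ) = 0
  · refine sum_eq_zero fun ω _ => ?_
    by_cases hω : (ω i : ℤ) = 0
    · simp [hτ, hω, siteMean_hole]
    · rw [clampedWeight_eq_zero (i := i) (by rw [hτ, siteWeight_hole_right _ _ hω]), zero_mul]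
  have hzero : ∀ ω : Fin N → Spin, (ω i : ℤ) = 0 → clampedWeight β α t τ ω = 0 := fun ω hω =>
    clampedWeight_eq_zero (i := i) (by rw [hω, siteWeight_hole_left _ _ hτ])
  refine sum_involution (fun ω _ => Function.update ω i (flip (ω i))) (fun ω _ => ?_)
    (fun ω _ hne heq => hne ?_) (fun _ _ => mem_univ _) (fun ω _ => ?_)
  · have hfield : magnetization (Function.update ω i (flip (ω i))) -
        (((Function.update ω i (flip (ω i)) i : Spin) : ℤ) : ℝ) =
        magnetization ω - ((ω i : ℤ) : ℝ) := by
      rw [magnetization_update_flip]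
      simp [flip]
      ring
    have hw := clampedWeight_update_flip (β := β) (α := α) (t := t) (τ := τ) ω i
    have hw0 := hzero ω
    have hw1 := hzero (Function.update ω i (flip (ω i)))
    rw [hfield]
    simp only [Function.update_self, flip, Int.cast_neg] at hw hw1 ⊢
    set W' := clampedWeight β α t τ (Function.update ω i ⟨-(ω i : ℤ), (flip (ω i)).2⟩)
    set W := clampedWeight β α t τ ω
    set x := magnetization ω - ((ω i : ℤ) : ℝ)
    have ha : 0 < siteWeight α t 1 (τ i) :=
      siteWeight_pos_of_ne_zero hpos ht (a := ⟨1, by simp⟩) (by simp) hτ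
    have hc : 0 < siteWeight α t (-1) (τ i) :=
      siteWeight_pos_of_ne_zero hpos ht (a := ⟨-1, by simp⟩) (by simp) hτ
    have hE := exp_pos (β / ((N + 1 : ℕ) : ℝ) * x)
    rw [siteMean]
    rcases spin_cases (ω i) with hs | hs | hs
    · simp only [hs, neg_neg, Int.cast_neg, Int.cast_one, mul_neg, mul_one] at hw ⊢
      set a := siteWeight α t 1 (τ i)
      set c := siteWeight α t (-1) (τ i)
      set E := exp (β / ((N + 1 : ℕ) : ℝ) * x)
      field_simp
      linear_combination (2 * h x) * hw
    · rw [hw0 hs, hw1 (by simp [hs])]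
      ring
    · simp only [hs, Int.cast_one, mul_one, neg_mul] at hw ⊢
      rw [exp_neg] at hw
      set a := siteWeight α t 1 (τ i)
      set c := siteWeight α t (-1) (τ i)
      set E := exp (β / ((N + 1 : ℕ) : ℝ) * x)
      field_simp at hw ⊢
      linear_combination (-2 * h x) * hw
  · have h0 : (ω i : ℤ) = 0 := by
      have := congrArg (fun s : Spin => (s : ℤ)) (congrFun heq i)
      simp only [Function.update_self, flip] at this
      omega
    rw [hzero ω h0, zero_mul]
  · simp [flip_flip]

end Weights

lemma abs_ratio_sub_le {a c B z z' : ℝ} (ha : 0 < a) (hc : 0 < c) (hz : z ≤ B) (hz' : z' ≤ B) :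
    |(a * exp z - c) / (a * exp z + c) - (a * exp z' - c) / (a * exp z' + c)| ≤
      2 * (a / c) * exp B * |z - z'| := by
  have h : (a * exp z - c) / (a * exp z + c) - (a * exp z' - c) / (a * exp z' + c) =
      2 * a * c * (exp z - exp z') / ((a * exp z + c) * (a * exp z' + c)) := by
    field_simp
    ring
  have hden : c * c ≤ (a * exp z + c) * (a * exp z' + c) :=
    mul_le_mul (le_add_of_nonneg_left (by positivity)) (le_add_of_nonneg_left (by positivity))
      hc.le (by positivity)
  rw [h, abs_div, abs_mul, abs_of_pos (show 0 < 2 * a * c by positivity),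
    abs_of_pos (show 0 < (a * exp z + c) * (a * exp z' + c) by positivity)]
  calc 2 * a * c * |exp z - exp z'| / ((a * exp z + c) * (a * exp z' + c))
      ≤ 2 * a * c * (exp B * |z - z'|) / (c * c) := by
        gcongr
        exact abs_exp_sub_exp_le hz hz'
    _ = 2 * (a / c) * exp B * |z - z'| := by field_simp

lemma ratio_symm {a c z : ℝ} (ha : 0 < a) (hc : 0 < c) :
    (a * exp z - c) / (a * exp z + c) = -((c * exp (-z) - a) / (c * exp (-z) + a)) := by
  rw [exp_neg]
  have := exp_pos z
  field_simp
  ring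

lemma abs_siteMean_sub_le {α : ℤ → ℝ} (hpos : ∀ s ∈ Spin, 0 < α s) {t : ℝ} (ht : 0 < t) (s : Spin)
    {z z' B : ℝ} (hz : |z| ≤ B) (hz' : |z'| ≤ B) :
    |siteMean α t s z - siteMean α t s z'| ≤
      4 * t * (α 1 / α (-1) + α (-1) / α 1) * exp B * |z - z'| := by
  have h1 : 0 < α 1 := hpos 1 (by simp)
  have h2 : 0 < α (-1) := hpos (-1) (by simp)
  have he := exp_neg_two_mul_lt_one ht
  have he' := add_one_le_exp (-2 * t)
  have he0 := exp_pos (-2 * t)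
  have hratio : (1 - exp (-2 * t)) / 2 / ((1 + exp (-2 * t)) / 2) ≤ 2 * t := by
    rw [div_le_iff₀ (by linarith)]
    nlinarith
  have hpp : siteWeight α t 1 1 = α 1 * ((1 + exp (-2 * t)) / 2) := by simp [siteWeight, pFlip]
  have hpm : siteWeight α t 1 (-1) = α 1 * ((1 - exp (-2 * t)) / 2) := by
    simp [siteWeight, pFlip]
  have hmp : siteWeight α t (-1) 1 = α (-1) * ((1 - exp (-2 * t)) / 2) := by
    simp [siteWeight, pFlip]
  have hmm : siteWeight α t (-1) (-1) = α (-1) * ((1 + exp (-2 * t)) / 2) := by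
    simp [siteWeight, pFlip]
  rw [abs_le] at hz hz'
  rcases spin_cases s with h | h | h
  · rw [h, siteMean, siteMean, hpm, hmm]
    refine (abs_ratio_sub_le (by apply mul_pos <;> linarith) (by positivity) hz.2 hz'.2).trans ?_
    rw [mul_div_mul_comm]
    calc 2 * (α 1 / α (-1) * ((1 - exp (-2 * t)) / 2 / ((1 + exp (-2 * t)) / 2))) *
          exp B * |z - z'|
        ≤ 2 * ((α 1 / α (-1) + α (-1) / α 1) * (2 * t)) * exp B * |z - z'| := by
          gcongr
          exact le_add_of_nonneg_right (by positivity)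
      _ = _ := by ring
  · rw [h, siteMean_hole, siteMean_hole, sub_zero, abs_zero]
    positivity
  · rw [h, siteMean, siteMean, hpp, hmp,
      ratio_symm (z := z) (by positivity) (by apply mul_pos <;> linarith),
      ratio_symm (z := z') (by positivity) (by apply mul_pos <;> linarith), neg_sub_neg,
      abs_sub_comm]
    refine (abs_ratio_sub_le (by apply mul_pos <;> linarith) (by positivity)
      (neg_le.1 hz.1) (neg_le.1 hz'.1)).trans ?_
    rw [mul_div_mul_comm]
    calc 2 * (α (-1) / α 1 * ((1 - exp (-2 * t)) / 2 / ((1 + exp (-2 * t)) / 2))) *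
          exp B * |-z - -z'|
        ≤ 2 * ((α 1 / α (-1) + α (-1) / α 1) * (2 * t)) * exp B * |-z - -z'| := by
          gcongr
          exact le_add_of_nonneg_left (by positivity)
      _ = _ := by
          rw [show -z - -z' = -(z - z') by ring, abs_neg]
          ring

lemma abs_siteMean_le_one {α : ℤ → ℝ} (hpos : ∀ s ∈ Spin, 0 < α s) {t : ℝ} (ht : 0 < t) (s : ℤ)
    (z : ℝ) : |siteMean α t s z| ≤ 1 := by
  have h1 := mul_nonneg (siteWeight_nonneg hpos ht ⟨1, by simp⟩ s) (exp_pos z).le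
  have h2 := siteWeight_nonneg hpos ht ⟨-1, by simp⟩ s
  dsimp only at h1 h2
  rw [siteMean, abs_div, abs_of_nonneg (add_nonneg h1 h2)]
  refine div_le_one_of_le₀ ?_ (add_nonneg h1 h2)
  rw [abs_le]
  constructor <;> linarith

/-- The empirical distribution of a configuration. -/
noncomputable def empirical {N : ℕ} (τ : Fin N → Spin) (s : ℤ) : ℝ :=
  ((univ.filter (fun i : Fin N => (τ i : ℤ) = s)).card : ℝ) / N

lemma sum_div_eq_sum_empirical {N : ℕ} (τ : Fin N → Spin) (f : ℤ → ℝ) :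
    (∑ i, f (τ i)) / N = ∑ s ∈ Spin, empirical τ s * f s := by
  rw [← sum_fiberwise_of_maps_to (s := univ) (t := Spin) (g := fun i => (τ i : ℤ))
    (fun i _ => (τ i).2), sum_div]
  refine sum_congr rfl fun s _ => ?_
  rw [sum_congr rfl fun i hi => by rw [(mem_filter.1 hi).2]]
  rw [sum_const, nsmul_eq_mul, empirical]
  ring

/-- The mean-field map for the magnetization given the empirical measure `ν` at time `t`. -/
noncomputable def meanFieldMap (β : ℝ) (α : ℤ → ℝ) (t : ℝ) (ν : ℤ → ℝ) (m : ℝ) : ℝ :=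
  ∑ s ∈ Spin, ν s * siteMean α t s (β * m)

lemma abs_meanFieldMap_sub_le {β K t : ℝ} (hβ : 0 ≤ β) {α ν : ℤ → ℝ} (hν : IsProbVec ν)
    (hK : ∀ s : Spin, ∀ z z' : ℝ, |z| ≤ β → |z'| ≤ β →
      |siteMean α t s z - siteMean α t s z'| ≤ K * |z - z'|)
    {m m' : ℝ} (hm : |m| ≤ 1) (hm' : |m'| ≤ 1) :
    |meanFieldMap β α t ν m - meanFieldMap β α t ν m'| ≤ β * K * |m - m'| := by
  rw [meanFieldMap, meanFieldMap, ← sum_sub_distrib]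
  refine (abs_sum_le_sum_abs _ _).trans ?_
  have hle : ∀ x : ℝ, |x| ≤ 1 → |β * x| ≤ β := fun x hx => by
    rw [abs_mul, abs_of_nonneg hβ]
    exact mul_le_of_le_one_right hβ hx
  have h : ∀ s ∈ Spin, |ν s * siteMean α t s (β * m) - ν s * siteMean α t s (β * m')| ≤
      ν s * (β * K * |m - m'|) := fun s hs => by
    rw [← mul_sub, abs_mul, abs_of_nonneg (hν.1 s)]
    refine mul_le_mul_of_nonneg_left ((hK ⟨s, hs⟩ _ _ (hle m hm) (hle m' hm')).trans_eq ?_)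
      (hν.1 s)
    rw [← mul_sub, abs_mul, abs_of_nonneg hβ]
    ring
  refine (sum_le_sum h).trans_eq ?_
  rw [← sum_mul, hν.2.2, one_mul]

lemma exists_meanFieldMap_eq_self {β K t : ℝ} (hβ : 0 ≤ β) {α ν : ℤ → ℝ}
    (hpos : ∀ s ∈ Spin, 0 < α s) (ht : 0 < t) (hν : IsProbVec ν)
    (hK : ∀ s : Spin, ∀ z z' : ℝ, |z| ≤ β → |z'| ≤ β →
      |siteMean α t s z - siteMean α t s z'| ≤ K * |z - z'|) :
    ∃ m : ℝ, |m| ≤ 1 ∧ meanFieldMap β α t ν m = m := by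
  have hcont : ContinuousOn (meanFieldMap β α t ν) (Set.Icc (-1) 1) := by
    refine (LipschitzOnWith.of_dist_le_mul (K := (β * K).toNNReal)
      fun x hx y hy => ?_).continuousOn
    rw [Real.dist_eq, Real.dist_eq]
    refine (abs_meanFieldMap_sub_le hβ hν hK (abs_le.2 hx) (abs_le.2 hy)).trans ?_
    exact mul_le_mul_of_nonneg_right (Real.le_coe_toNNReal _) (abs_nonneg _)
  have hmaps : Set.MapsTo (meanFieldMap β α t ν) (Set.Icc (-1) 1) (Set.Icc (-1) 1) := by
    intro x _
    rw [Set.mem_Icc, ← abs_le]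
    refine (abs_sum_le_sum_abs _ _).trans ?_
    rw [← hν.2.2]
    refine sum_le_sum fun s _ => ?_
    rw [abs_mul, abs_of_nonneg (hν.1 s)]
    exact mul_le_of_le_one_right (hν.1 s) (abs_siteMean_le_one hpos ht _ _)
  obtain ⟨m, hm, hfix⟩ := exists_mem_Icc_isFixedPt_of_mapsTo hcont (by norm_num) hmaps
  exact ⟨m, abs_le.2 hm, hfix⟩

/-- Moving one spin from its local field to the global magnetization costs `O(1 / N)`. -/
lemma local_field_error_le {β K t : ℝ} (hβ : 0 ≤ β) (hβK : β * K ≤ 1 / 2) {α : ℤ → ℝ}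
    (hpos : ∀ s ∈ Spin, 0 < α s) (ht : 0 < t)
    (hK : ∀ s : Spin, ∀ z z' : ℝ, |z| ≤ β → |z'| ≤ β →
      |siteMean α t s z - siteMean α t s z'| ≤ K * |z - z'|)
    {N : ℕ} (hN : 0 < N) (s : Spin) (ω : Fin N → Spin) (i : Fin N) {m : ℝ} (hm : |m| ≤ 1) :
    (((ω i : ℤ) : ℝ) - siteMean α t s (β * (magnetization ω / N))) * (magnetization ω / N - m) -
      4 / N ≤
    (((ω i : ℤ) : ℝ) -
      siteMean α t s (β / ((N + 1 : ℕ) : ℝ) * (magnetization ω - ((ω i : ℤ) : ℝ)))) *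
        ((magnetization ω - ((ω i : ℤ) : ℝ)) / N - m) := by
  have hN' : (0 : ℝ) < N := by exact_mod_cast hN
  have hD := abs_magnetization_le ω
  have hDi := abs_magnetization_sub_le ω i
  have hx := abs_spin_le_one (ω i)
  set D := magnetization ω
  set x := ((ω i : ℤ) : ℝ)
  have hz : |β * (D / N)| ≤ β := by
    rw [abs_mul, abs_of_nonneg hβ, abs_div, Nat.abs_cast]
    exact mul_le_of_le_one_right hβ (div_le_one_of_le₀ hD hN'.le)
  have hz' : |β / ((N + 1 : ℕ) : ℝ) * (D - x)| ≤ β := by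
    rw [abs_mul, abs_div, abs_of_nonneg hβ, Nat.abs_cast, div_mul_eq_mul_div, mul_div_assoc]
    refine mul_le_of_le_one_right hβ (div_le_one_of_le₀ (hDi.trans ?_) (by positivity))
    push_cast
    linarith
  have hzz : |β * (D / N) - β / ((N + 1 : ℕ) : ℝ) * (D - x)| ≤ β * (2 / N) := by
    have h : β * (D / N) - β / ((N + 1 : ℕ) : ℝ) * (D - x) =
        β * ((D + N * x) / (N * (N + 1))) := by
      push_cast
      field_simp
      ring
    rw [h, abs_mul, abs_of_nonneg hβ]
    refine mul_le_mul_of_nonneg_left ?_ hβ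
    rw [abs_div, abs_of_pos (show (0 : ℝ) < N * (N + 1) by positivity),
      div_le_div_iff₀ (by positivity) hN']
    have h' : |D + N * x| ≤ 2 * N := by
      refine (abs_add_le _ _).trans ?_
      rw [abs_mul, Nat.abs_cast]
      nlinarith
    nlinarith [mul_le_mul_of_nonneg_right h' hN'.le]
  have hΘ := (hK s _ _ hz hz')
  have hΘ1 := abs_siteMean_le_one hpos ht s (β * (D / N))
  set θ := siteMean α t s (β * (D / N))
  set θ' := siteMean α t s (β / ((N + 1 : ℕ) : ℝ) * (D - x))
  have hK0 : β * K * (2 / N) ≤ 1 / 2 * (2 / N) := mul_le_mul_of_nonneg_right hβK (by positivity)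
  have hθθ : |θ - θ'| ≤ 1 / N := by
    by_cases hK' : 0 ≤ K
    · refine (hΘ.trans (mul_le_mul_of_nonneg_left hzz hK')).trans ?_
      calc K * (β * (2 / N)) = β * K * (2 / N) := by ring
        _ ≤ 1 / 2 * (2 / N) := hK0
        _ = 1 / N := by ring
    · refine (hΘ.trans (mul_nonpos_of_nonpos_of_nonneg (not_le.1 hK').le (abs_nonneg _))).trans ?_
      positivity
  have hfst : |(x - θ) * (x / N)| ≤ 2 / N := by
    rw [abs_mul, abs_div, Nat.abs_cast, ← mul_div_assoc]
    gcongr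
    have := abs_sub x θ
    nlinarith [abs_nonneg x, abs_nonneg (x - θ)]
  have hsnd : |(θ - θ') * ((D - x) / N - m)| ≤ 2 / N := by
    rw [abs_mul]
    have : |(D - x) / N - m| ≤ 2 := by
      refine (abs_sub _ _).trans ?_
      have : |(D - x) / N| ≤ 1 := by
        rw [abs_div, Nat.abs_cast]
        exact div_le_one_of_le₀ hDi hN'.le
      linarith
    calc |θ - θ'| * |(D - x) / N - m| ≤ 1 / N * 2 :=
          mul_le_mul hθθ this (abs_nonneg _) (by positivity)
      _ = 2 / N := by ring
  have hid : (x - θ') * ((D - x) / N - m) - ((x - θ) * (D / N - m)) =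
      (θ - θ') * ((D - x) / N - m) - (x - θ) * (x / N) := by ring
  have h4 : (4 : ℝ) / N = 2 / N + 2 / N := by ring
  rw [abs_le] at hfst hsnd
  linarith

/-- The magnetization per site concentrates at a fixed point of the mean-field map. -/
lemma clampedMean_sq_le {β K t : ℝ} (hβ : 0 ≤ β) (hβK : β * K ≤ 1 / 2) {α ν : ℤ → ℝ}
    (hpos : ∀ s ∈ Spin, 0 < α s) (ht : 0 < t) (hν : IsProbVec ν)
    (hK : ∀ s : Spin, ∀ z z' : ℝ, |z| ≤ β → |z'| ≤ β →
      |siteMean α t s z - siteMean α t s z'| ≤ K * |z - z'|)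
    {m : ℝ} (hm : |m| ≤ 1) (hfix : meanFieldMap β α t ν m = m)
    {N : ℕ} (hN : 0 < N) (τ : Fin N → Spin) :
    clampedMean β α t τ (fun ω => (magnetization ω / N - m) ^ 2) ≤
      8 / N + 4 * ∑ s ∈ Spin, |empirical τ s - ν s| := by
  have hN' : (0 : ℝ) < N := by exact_mod_cast hN
  set δ := ∑ s ∈ Spin, |empirical τ s - ν s| with hδ
  set S : Fin N → (Fin N → Spin) → ℝ := fun i ω => (((ω i : ℤ) : ℝ) -
      siteMean α t (τ i) (β / ((N + 1 : ℕ) : ℝ) * (magnetization ω - ((ω i : ℤ) : ℝ)))) *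
        ((magnetization ω - ((ω i : ℤ) : ℝ)) / N - m) with hS
  have hpoint : ∀ ω : Fin N → Spin,
      (magnetization ω / N - m) ^ 2 ≤ 2 / N * ∑ i, S i ω + (8 / N + 4 * δ) := by
    intro ω
    set M := magnetization ω / N with hM
    have hM1 : |M| ≤ 1 := by
      rw [hM, abs_div, Nat.abs_cast]
      exact div_le_one_of_le₀ (abs_magnetization_le ω) hN'.le
    have hsum : (∑ i, (((ω i : ℤ) : ℝ) - siteMean α t (τ i) (β * M)) * (M - m)) - 4 ≤
        ∑ i, S i ω := by
      have := sum_le_sum fun i (_ : i ∈ univ) =>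
        local_field_error_le hβ hβK hpos ht hK hN (τ i) ω i hm
      rw [sum_sub_distrib, sum_const, card_univ, Fintype.card_fin, nsmul_eq_mul,
        mul_div_cancel₀ _ hN'.ne'] at this
      exact this
    have hemp : (∑ i, (((ω i : ℤ) : ℝ) - siteMean α t (τ i) (β * M)) * (M - m)) / N =
        (M - meanFieldMap β α t (empirical τ) M) * (M - m) := by
      rw [← sum_mul, sum_sub_distrib, mul_div_right_comm, sub_div,
        sum_div_eq_sum_empirical τ fun s => siteMean α t s (β * M)]
      rfl
    have hclose : |meanFieldMap β α t (empirical τ) M - meanFieldMap β α t ν M| ≤ δ := by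
      rw [meanFieldMap, meanFieldMap, ← sum_sub_distrib]
      refine (abs_sum_le_sum_abs _ _).trans (sum_le_sum fun s _ => ?_)
      rw [← sub_mul, abs_mul]
      exact mul_le_of_le_one_right (abs_nonneg _) (abs_siteMean_le_one hpos ht _ _)
    have hlip : |meanFieldMap β α t ν M - m| ≤ 1 / 2 * |M - m| := by
      have := abs_meanFieldMap_sub_le hβ hν hK hM1 hm
      rw [hfix] at this
      exact this.trans (mul_le_mul_of_nonneg_right hβK (abs_nonneg _))
    have hh : |M - m| ≤ 2 := (abs_sub _ _).trans (by linarith)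
    have hdiv : (M - meanFieldMap β α t (empirical τ) M) * (M - m) - 4 / N ≤
        (∑ i, S i ω) / N := by
      rw [← hemp, ← sub_div]
      exact div_le_div_of_nonneg_right hsum hN'.le
    have h1 : (meanFieldMap β α t (empirical τ) M - meanFieldMap β α t ν M) * (M - m) ≤ 2 * δ := by
      refine (le_abs_self _).trans ?_
      rw [abs_mul, mul_comm 2]
      exact mul_le_mul hclose hh (abs_nonneg _) ((abs_nonneg _).trans hclose)
    have h2 : (meanFieldMap β α t ν M - m) * (M - m) ≤ 1 / 2 * (M - m) ^ 2 := by
      refine (le_abs_self _).trans ?_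
      rw [abs_mul, ← sq_abs (M - m), sq, ← mul_assoc]
      exact mul_le_mul_of_nonneg_right hlip (abs_nonneg _)
    have h3 : 2 / N * ∑ i, S i ω = 2 * ((∑ i, S i ω) / N) := by ring
    have h4 : (8 : ℝ) / N = 2 * (4 / N) := by ring
    rw [h3, h4]
    nlinarith
  have hzero : ∑ ω, clampedWeight β α t τ ω * (2 / N * ∑ i, S i ω) = 0 := by
    simp only [mul_sum]
    rw [sum_comm]
    refine sum_eq_zero fun i _ => ?_
    have := sum_clampedWeight_mul_sub_siteMean (β := β) (τ := τ) hpos ht i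
      (fun x => 2 / N * (x / N - m))
    rw [← this]
    refine sum_congr rfl fun ω _ => ?_
    simp only [hS]
    ring
  rw [clampedMean, div_le_iff₀ (sum_clampedWeight_pos hpos ht)]
  refine (sum_le_sum fun ω _ =>
    mul_le_mul_of_nonneg_left (hpoint ω) (clampedWeight_nonneg hpos ht ω)).trans_eq ?_
  simp only [mul_add (clampedWeight β α t τ _) (2 / N * _), sum_add_distrib]
  rw [hzero, zero_add, ← sum_mul, mul_comm]

lemma abs_clampedMean_sub_le {β t : ℝ} {α : ℤ → ℝ} (hpos : ∀ s ∈ Spin, 0 < α s) (ht : 0 < t)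
    {N : ℕ} {τ : Fin N → Spin} {f g : (Fin N → Spin) → ℝ} {c A C V : ℝ} (hC : 0 ≤ C)
    (hfg : ∀ ω, clampedWeight β α t τ ω ≠ 0 → |f ω - c| ≤ A + C * |g ω|)
    (hV : clampedMean β α t τ (fun ω => g ω ^ 2) ≤ V) :
    |clampedMean β α t τ f - c| ≤ A + C * √V := by
  have hZ : 0 < ∑ ω, clampedWeight β α t τ ω := sum_clampedWeight_pos hpos ht
  have hw : ∀ ω, 0 ≤ clampedWeight β α t τ ω := clampedWeight_nonneg hpos ht
  rw [clampedMean, div_le_iff₀ hZ] at hV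
  set Z := ∑ ω, clampedWeight β α t τ ω with hZdef
  have hcs : ∑ ω, clampedWeight β α t τ ω * |g ω| ≤ Z * √V := by
    have hsq : (∑ ω, clampedWeight β α t τ ω * |g ω|) ^ 2 ≤ Z * (V * Z) := by
      refine (sum_sq_le_sum_mul_sum_of_sq_le_mul univ (fun ω _ => hw ω)
        (fun ω _ => mul_nonneg (hw ω) (sq_nonneg (g ω))) fun ω _ => Eq.le ?_).trans
        (mul_le_mul_of_nonneg_left hV hZ.le)
      rw [mul_pow, sq_abs]
      ring
    calc ∑ ω, clampedWeight β α t τ ω * |g ω| ≤ √(Z * (V * Z)) := Real.le_sqrt_of_sq_le hsq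
      _ = Z * √V := by
        rw [show Z * (V * Z) = Z ^ 2 * V by ring, Real.sqrt_mul (sq_nonneg _),
          Real.sqrt_sq hZ.le]
  have hsub : clampedMean β α t τ f - c = (∑ ω, clampedWeight β α t τ ω * (f ω - c)) / Z := by
    simp only [clampedMean, mul_sub, sum_sub_distrib, ← sum_mul]
    rw [sub_div, ← hZdef, mul_div_cancel_left₀ _ hZ.ne']
  rw [hsub, abs_div, abs_of_pos hZ, div_le_iff₀ hZ]
  calc |∑ ω, clampedWeight β α t τ ω * (f ω - c)|
      ≤ ∑ ω, clampedWeight β α t τ ω * (A + C * |g ω|) := by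
        refine (abs_sum_le_sum_abs _ _).trans (sum_le_sum fun ω _ => ?_)
        rw [abs_mul, abs_of_nonneg (hw ω)]
        by_cases h : clampedWeight β α t τ ω = 0
        · simp [h]
        · exact mul_le_mul_of_nonneg_left (hfg ω h) (hw ω)
    _ = A * Z + C * ∑ ω, clampedWeight β α t τ ω * |g ω| := by
        simp only [mul_add, sum_add_distrib, ← sum_mul, mul_sum]
        rw [mul_comm A, ← hZdef]
        exact congrArg _ (sum_congr rfl fun _ _ => by ring)
    _ ≤ (A + C * √V) * Z := by
        nlinarith [mul_le_mul_of_nonneg_left hcs hC]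

/-- The Boltzmann factor of the interaction of an extra spin `s` with the configuration `ω`. -/
noncomputable def extraFactor (β : ℝ) (s : ℤ) {N : ℕ} (ω : Fin N → Spin) : ℝ :=
  exp (-(β / ((N + 1 : ℕ) : ℝ)) * (((s : ℝ) ^ 2 * occupation ω - s * magnetization ω) / 2))

lemma wrWeight_cons (β : ℝ) (α : ℤ → ℝ) {N : ℕ} (s : Spin) (ω : Fin N → Spin) :
    wrWeight β α (Fin.cons s ω : Fin (N + 1) → Spin) =
      exp (-(β / (2 * ((N + 1 : ℕ) : ℝ))) * ((occupation ω ^ 2 - magnetization ω ^ 2) / 2)) *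
        extraFactor β s ω * (α s * ∏ j, α (ω j)) := by
  have hocc : occupation (Fin.cons s ω : Fin (N + 1) → Spin) =
      ((s : ℤ) : ℝ) ^ 2 + occupation ω := by
    simp [occupation, Fin.sum_univ_succ]
  have hmag : magnetization (Fin.cons s ω : Fin (N + 1) → Spin) =
      ((s : ℤ) : ℝ) + magnetization ω := by
    simp [magnetization, Fin.sum_univ_succ]
  have hs : ((s : ℤ) : ℝ) ^ 4 = ((s : ℤ) : ℝ) ^ 2 := by
    rcases spin_cases s with h | h | h <;> norm_num [h]
  rw [wrWeight, sum_sum_indicator_eq, hocc, hmag, extraFactor, ← exp_add]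
  congr 1
  · congr 1
    field_simp
    linear_combination (-β) * hs
  · simp [Fin.prod_univ_succ]

lemma wrWeightT_cons {β t : ℝ} {α : ℤ → ℝ} (hpos : ∀ s ∈ Spin, 0 < α s) (ht : 0 < t)
    {N : ℕ} (σ : Spin) (τ : Fin N → Spin) :
    wrWeightT β α t (Fin.cons σ τ : Fin (N + 1) → Spin) =
      (∑ s : Spin, siteWeight α t s σ * clampedMean β α t τ (extraFactor β s)) *
        ∑ ω, clampedWeight β α t τ ω := by
  have hZ : (∑ ω, clampedWeight β α t τ ω) ≠ 0 := (sum_clampedWeight_pos hpos ht).ne'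
  rw [wrWeightT, ← (Fin.consEquiv fun _ => Spin).sum_comp, Fintype.sum_prod_type, sum_mul]
  refine sum_congr rfl fun s _ => ?_
  rw [mul_assoc, clampedMean, div_mul_cancel₀ _ hZ, mul_sum]
  refine sum_congr rfl fun ω _ => ?_
  change wrWeight β α (Fin.cons s ω : Fin (N + 1) → Spin) *
    ∏ i, pFlip t ((Fin.cons s ω : Fin (N + 1) → Spin) i)
      ((Fin.cons σ τ : Fin (N + 1) → Spin) i) = _
  rw [wrWeight_cons, Fin.prod_univ_succ]
  simp only [Fin.cons_zero, Fin.cons_succ, clampedWeight, siteWeight, prod_mul_distrib]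
  ring

section Limit

variable {β K t m : ℝ} {α ν : ℤ → ℝ} {τ : (N : ℕ) → Fin N → Spin}

lemma tendsto_clampedMean_extraFactor (hβ : 0 ≤ β) (hβK : β * K ≤ 1 / 2)
    (hpos : ∀ s ∈ Spin, 0 < α s) (ht : 0 < t) (hν : IsProbVec ν)
    (hK : ∀ s : Spin, ∀ z z' : ℝ, |z| ≤ β → |z'| ≤ β →
      |siteMean α t s z - siteMean α t s z'| ≤ K * |z - z'|)
    (hm : |m| ≤ 1) (hfix : meanFieldMap β α t ν m = m) (hτ : EmpConv τ ν) (s : Spin) :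
    Tendsto (fun N => clampedMean β α t (τ N) (extraFactor β s)) atTop
      (𝓝 (exp (-β * ((((s : ℤ) : ℝ) ^ 2 * (∑ r ∈ Spin, ν r * (r : ℝ) ^ 2) -
        ((s : ℤ) : ℝ) * m) / 2)))) := by
  set q := ∑ r ∈ Spin, ν r * (r : ℝ) ^ 2 with hq
  have hq0 : 0 ≤ q := sum_nonneg fun r _ => mul_nonneg (hν.1 r) (sq_nonneg _)
  have hs := abs_spin_le_one s
  set x := ((s : ℤ) : ℝ) with hx
  have hbound : ∀ᶠ N : ℕ in atTop,
      |clampedMean β α t (τ N) (extraFactor β s) - exp (-β * ((x ^ 2 * q - x * m) / 2))| ≤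
        exp β * β * (|occupation (τ N) / (N + 1) - q| + 1 / ((N : ℝ) + 1)) +
          exp β * β * √(8 / N + 4 * ∑ r ∈ Spin, |empirical (τ N) r - ν r|) := by
    filter_upwards [eventually_gt_atTop 0] with N hN
    have hN' : (0 : ℝ) < N := by exact_mod_cast hN
    refine abs_clampedMean_sub_le hpos ht (by positivity) (fun ω hω => ?_)
      (clampedMean_sq_le hβ hβK hpos ht hν hK hm hfix hN (τ N))
    have hD := abs_magnetization_le ω
    have hQ : 0 ≤ occupation ω := sum_nonneg fun _ _ => sq_nonneg _
    have hexp : -(β / ((N + 1 : ℕ) : ℝ)) * ((x ^ 2 * occupation ω - x * magnetization ω) / 2) =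
        -β * ((x ^ 2 * (occupation ω / (N + 1)) - x * (magnetization ω / (N + 1))) / 2) := by
      push_cast
      field_simp
    have hD1 : |magnetization ω / (N + 1)| ≤ 1 := by
      rw [abs_div, abs_of_pos (show (0 : ℝ) < N + 1 by positivity)]
      exact div_le_one_of_le₀ (by linarith) (by positivity)
    have hupper : ∀ Q M : ℝ, 0 ≤ Q → |M| ≤ 1 → -β * ((x ^ 2 * Q - x * M) / 2) ≤ β := by
      intro Q M hQ hM
      have h1 : x * M ≤ 1 := by
        refine (le_abs_self _).trans ?_
        rw [abs_mul]
        exact mul_le_one₀ hs (abs_nonneg _) hM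
      have h2 : 0 ≤ x ^ 2 * Q := by positivity
      nlinarith
    have hMm : |magnetization ω / (N + 1) - m| ≤ 1 / (N + 1) + |magnetization ω / N - m| := by
      have h1 : |magnetization ω / (N + 1) - magnetization ω / N| ≤ 1 / (N + 1) := by
        have : magnetization ω / (N + 1) - magnetization ω / N =
            -(magnetization ω / N * (1 / (N + 1))) := by
          field_simp
          ring
        rw [this, abs_neg, abs_mul, abs_of_pos (show (0 : ℝ) < 1 / (N + 1) by positivity)]
        refine mul_le_of_le_one_left (by positivity) ?_
        rw [abs_div, Nat.abs_cast]
        exact div_le_one_of_le₀ hD hN'.le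
      exact (abs_sub_le _ _ _).trans (add_le_add_left h1 _)
    rw [extraFactor, hexp]
    refine (abs_exp_sub_exp_le (hupper _ _ (by positivity) hD1) (hupper _ _ hq0 hm)).trans ?_
    rw [← occupation_eq_of_clampedWeight_ne_zero hω]
    have hdiff : |-β * ((x ^ 2 * (occupation ω / (N + 1)) - x * (magnetization ω / (N + 1))) / 2) -
        -β * ((x ^ 2 * q - x * m) / 2)| ≤
        β * (|occupation ω / (N + 1) - q| + |magnetization ω / (N + 1) - m|) := by
      have : -β * ((x ^ 2 * (occupation ω / (N + 1)) - x * (magnetization ω / (N + 1))) / 2) -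
          -β * ((x ^ 2 * q - x * m) / 2) = β * ((x * (magnetization ω / (N + 1) - m)) / 2 -
            (x ^ 2 * (occupation ω / (N + 1) - q)) / 2) := by ring
      rw [this, abs_mul, abs_of_nonneg hβ]
      refine mul_le_mul_of_nonneg_left ((abs_sub _ _).trans ?_) hβ
      rw [abs_div, abs_div, abs_mul, abs_mul, abs_pow, abs_two]
      have h1 := mul_le_of_le_one_left (abs_nonneg (magnetization ω / (N + 1) - m)) hs
      have h2 := mul_le_of_le_one_left (abs_nonneg (occupation ω / (N + 1) - q))
        (pow_le_one₀ (abs_nonneg x) hs (n := 2))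
      have h3 := abs_nonneg (magnetization ω / (N + 1) - m)
      have h4 := abs_nonneg (occupation ω / (N + 1) - q)
      linarith
    calc _ ≤ exp β * (β * (|occupation ω / (N + 1) - q| +
          (1 / (N + 1) + |magnetization ω / N - m|))) := by
          refine mul_le_mul_of_nonneg_left (hdiff.trans ?_) (exp_pos _).le
          gcongr
      _ = _ := by ring
  have hone : Tendsto (fun N : ℕ => 1 / ((N : ℝ) + 1)) atTop (𝓝 0) :=
    tendsto_one_div_add_atTop_nhds_zero_nat
  have hocc : Tendsto (fun N : ℕ => |occupation (τ N) / (N + 1) - q|) atTop (𝓝 0) := by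
    have h1 : Tendsto (fun N : ℕ => ∑ r ∈ Spin, empirical (τ N) r * (r : ℝ) ^ 2) atTop (𝓝 q) :=
      tendsto_finsetSum _ fun r _ => (hτ r).mul_const _
    have h2 : Tendsto (fun N : ℕ => occupation (τ N) / (N + 1)) atTop (𝓝 q) := by
      have h3 := h1.mul (hone.const_sub 1)
      rw [sub_zero, mul_one] at h3
      refine h3.congr' ?_
      filter_upwards [eventually_gt_atTop 0] with N hN
      have hN' : (0 : ℝ) < N := by exact_mod_cast hN
      rw [← sum_div_eq_sum_empirical (τ N) fun r => (r : ℝ) ^ 2, ← occupation]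
      field_simp
      ring
    simpa using (h2.sub_const q).abs
  have hemp : Tendsto (fun N : ℕ => 8 / (N : ℝ) + 4 * ∑ r ∈ Spin, |empirical (τ N) r - ν r|) atTop
      (𝓝 0) := by
    have h1 : Tendsto (fun N : ℕ => ∑ r ∈ Spin, |empirical (τ N) r - ν r|) atTop
        (𝓝 (∑ r ∈ Spin, |ν r - ν r|)) :=
      tendsto_finsetSum _ fun r _ => ((hτ r).sub_const _).abs
    simpa using (tendsto_const_div_atTop_nhds_zero_nat (8 : ℝ)).add (h1.const_mul 4)
  rw [tendsto_iff_norm_sub_tendsto_zero]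
  refine squeeze_zero' (.of_forall fun _ => norm_nonneg _) hbound ?_
  have h := ((hocc.add hone).const_mul (exp β * β)).add (hemp.sqrt.const_mul (exp β * β))
  simpa using h

lemma exists_tendsto_wrCondProbT (hβ : 0 ≤ β) (hβK : β * K ≤ 1 / 2)
    (hpos : ∀ s ∈ Spin, 0 < α s) (ht : 0 < t) (hν : IsProbVec ν)
    (hK : ∀ s : Spin, ∀ z z' : ℝ, |z| ≤ β → |z'| ≤ β →
      |siteMean α t s z - siteMean α t s z'| ≤ K * |z - z'|) (σ : Spin) :
    ∃ L : ℝ, ∀ τ : (N : ℕ) → Fin N → Spin, EmpConv τ ν →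
      Tendsto (fun N => wrCondProbT β α t σ (τ N)) atTop (𝓝 L) := by
  obtain ⟨m, hm, hfix⟩ := exists_meanFieldMap_eq_self hβ hpos ht hν hK
  set e : Spin → ℝ := fun s => exp (-β * ((((s : ℤ) : ℝ) ^ 2 * (∑ r ∈ Spin, ν r * (r : ℝ) ^ 2) -
    ((s : ℤ) : ℝ) * m) / 2))
  refine ⟨(∑ s : Spin, siteWeight α t s σ * e s) /
    ∑ σ' : Spin, ∑ s : Spin, siteWeight α t s σ' * e s, fun τ hτ => ?_⟩
  have hne : (∑ σ' : Spin, ∑ s : Spin, siteWeight α t s σ' * e s) ≠ 0 := by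
    refine ne_of_gt (sum_pos' (fun σ' _ => sum_nonneg fun s _ =>
      mul_nonneg (siteWeight_nonneg hpos ht s σ') (exp_pos _).le) ⟨σ, mem_univ σ, ?_⟩)
    exact sum_pos' (fun s _ => mul_nonneg (siteWeight_nonneg hpos ht s σ) (exp_pos _).le)
      ⟨σ, mem_univ _, mul_pos (mul_pos (hpos _ σ.2) (pFlip_self_pos t σ)) (exp_pos _)⟩
  have hlim : ∀ σ' : Spin, Tendsto (fun N => ∑ s : Spin, siteWeight α t s σ' *
      clampedMean β α t (τ N) (extraFactor β s)) atTop
      (𝓝 (∑ s : Spin, siteWeight α t s σ' * e s)) := fun σ' =>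
    tendsto_finsetSum _ fun s _ =>
      (tendsto_clampedMean_extraFactor hβ hβK hpos ht hν hK hm hfix hτ s).const_mul _
  refine ((hlim σ).div (tendsto_finsetSum _ fun σ' _ => hlim σ') hne).congr fun N => ?_
  simp only [wrCondProbT, wrWeightT_cons hpos ht, ← sum_mul]
  exact (mul_div_mul_right _ _ (sum_clampedWeight_pos hpos ht).ne').symm

end Limit

end WidomRowlinson

/-- Short-time Gibbsianness: for every `β ≥ 0` and fully supported a priori measure
`α` there is `t₀ > 0` such that for all `0 < t < t₀` the time-evolved mean-field
soft-core Widom-Rowlinson model is sequentially Gibbs (no bad empirical measures). -/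
theorem short_time_sequentially_Gibbs (β : ℝ) (hβ : 0 ≤ β) (α : ℤ → ℝ)
    (hα : IsProbVec α) (hpos : ∀ s ∈ Spin, 0 < α s) :
    ∃ t₀ : ℝ, 0 < t₀ ∧ ∀ t : ℝ, 0 < t → t < t₀ →
      ∀ ν : ℤ → ℝ, IsProbVec ν → ¬ IsBadMeasure β α t ν := by
  have h1 : 0 < α 1 := hpos 1 (by simp)
  have h2 : 0 < α (-1) := hpos (-1) (by simp)
  set A := α 1 / α (-1) + α (-1) / α 1 with hA
  have hA0 : 0 < A := by positivity
  refine ⟨1 / (8 * (β + 1) * A * exp β), by positivity, fun t ht htlt ν hν => ?_⟩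
  rintro ⟨τ, τ', hτ, hτ', σ, hσ⟩
  have hβK : β * (4 * t * A * exp β) ≤ 1 / 2 := by
    rw [lt_div_iff₀ (by positivity)] at htlt
    have : 0 < t * A * exp β := by positivity
    linarith
  obtain ⟨L, hL⟩ := WidomRowlinson.exists_tendsto_wrCondProbT hβ hβK hpos ht hν
    (fun s z z' hz hz' => WidomRowlinson.abs_siteMean_sub_le hpos ht s hz hz') σ
  exact hσ ⟨L, hL τ hτ, hL τ' hτ'⟩
end

section
/- For every symmetric a priori probability measure α on {-1,0,1} (i.e., α(1) = α(−1) > 0 and α(0) > 0), every repulsion parameter 0 < β ≤ 2, and every time t > 0, the time-evolved mean-field soft-core Widom-Rowlinson model (μ_{N,t})_{N∈ℕ} is sequentially Gibbs, i.e., the set of bad empirical measures B^{WiRo}(β,t) is empty. -/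
open Real Filter Finset Topology

open MeasureTheory ProbabilityTheory

section Laplace

/-- A strictly concave function lies below a cone with apex at its maximum, away from the
maximizer. -/
lemma StrictConcaveOn.exists_le_sub_mul_abs {h : ℝ → ℝ} (hh : StrictConcaveOn ℝ Set.univ h)
    {m : ℝ} (hm : ∀ x, h x ≤ h m) {δ : ℝ} (hδ : 0 < δ) :
    ∃ c > 0, ∀ x, δ ≤ |x - m| → h x ≤ h m - c * |x - m| := by
  have hlt : ∀ x, x ≠ m → h x < h m := by
    intro x hx
    have key := hh.2 (Set.mem_univ x) (Set.mem_univ m) hx (by norm_num : (0 : ℝ) < 1 / 2)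
      (by norm_num : (0 : ℝ) < 1 / 2) (by norm_num)
    have := hm ((1 / 2 : ℝ) • x + (1 / 2 : ℝ) • m)
    simp only [smul_eq_mul] at key this
    linarith
  have hp := hlt (m + δ) (by linarith)
  have hn := hlt (m - δ) (by linarith)
  set c := min (h m - h (m + δ)) (h m - h (m - δ)) / δ with hc
  have hcpos : 0 < c := div_pos (lt_min (by linarith) (by linarith)) hδ
  have hcδ : c * δ = min (h m - h (m + δ)) (h m - h (m - δ)) := by
    rw [hc]; field_simp
  have h1 : c * δ ≤ h m - h (m + δ) := hcδ ▸ min_le_left _ _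
  have h2 : c * δ ≤ h m - h (m - δ) := hcδ ▸ min_le_right _ _
  refine ⟨c, hcpos, fun x hx => ?_⟩
  set d := |x - m| with hd
  have hdpos : 0 < d := hδ.trans_le hx
  have key := hh.concaveOn.2 (Set.mem_univ x) (Set.mem_univ m)
    (by positivity : 0 ≤ δ / d) (sub_nonneg.2 ((div_le_one hdpos).2 hx)) (by ring)
  have hbound : h (δ / d * x + (1 - δ / d) * m) ≤ h m - c * δ := by
    rcases abs_cases (x - m) with ⟨he, _⟩ | ⟨he, _⟩
    · have : δ / d * x + (1 - δ / d) * m = m + δ := by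
        have : d = x - m := he
        field_simp
        rw [this]; ring
      rw [this]; linarith
    · have : δ / d * x + (1 - δ / d) * m = m - δ := by
        have : d = -(x - m) := he
        field_simp
        rw [this]; ring
      rw [this]; linarith
  simp only [smul_eq_mul] at key
  have h3 : δ / d * (h x - h m + c * d) ≤ 0 := by
    have : δ / d * (c * d) = c * δ := by field_simp
    linarith
  have h4 : h x - h m + c * d ≤ 0 := by
    by_contra hcon
    have := mul_pos (div_pos hδ hdpos) (not_le.1 hcon)
    linarith
  linarith

/-- Laplace principle: probability densities proportional to `exp (N * f N)`, where `f N` converges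
to a function `h` at most linearly badly at infinity, concentrate at the maximizer of `h`, provided
`h` decays linearly away from it. -/
lemma tendsto_integral_exp_mul_div_of_cone {μ : Measure ℝ} [IsFiniteMeasure μ]
    [μ.IsOpenPosMeasure] {h : ℝ → ℝ} (hcont : Continuous h) {f : ℕ → ℝ → ℝ} {ε : ℕ → ℝ}
    (hε : Tendsto ε atTop (𝓝 0)) (hf : ∀ N x, |f N x - h x| ≤ ε N * |x|)
    (hinteg : ∀ N : ℕ, Integrable (fun x => exp (N * f N x)) μ) {m : ℝ}
    (hcone : ∀ δ > 0, ∃ c > 0, ∀ x, δ ≤ |x - m| → h x ≤ h m - c * |x - m|)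
    {g : ℝ → ℝ} (hg : Integrable g μ) (hgm : ContinuousAt g m) :
    Tendsto (fun N : ℕ => (∫ x, exp (N * f N x) * g x ∂μ) / ∫ x, exp (N * f N x) ∂μ)
      atTop (𝓝 (g m)) := by
  have hμ : NeZero μ := ⟨fun h0 => by
    have := isOpen_univ.measure_pos μ (Set.univ_nonempty (α := ℝ))
    simp [h0] at this⟩
  have hZ : ∀ N : ℕ, 0 < ∫ x, exp (N * f N x) ∂μ := fun N => integral_exp_pos (hinteg N)
  have hε0 : ∀ N, 0 ≤ ε N := fun N => by simpa using (abs_nonneg _).trans (hf N 1)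
  have hunif : ∀ u : Set ℝ, IsOpen u → m ∈ u →
      TendstoUniformlyOn (fun (N : ℕ) x => exp (N * f N x) / ∫ x, exp (N * f N x) ∂μ)
        0 atTop uᶜ := by
    intro u hu hmu
    obtain ⟨δ, hδ, hball⟩ := Metric.isOpen_iff.1 hu m hmu
    obtain ⟨c, hc, hdec⟩ := hcone δ hδ
    have hcδ : 0 < c * δ := mul_pos hc hδ
    obtain ⟨r, hr, hnear⟩ := Metric.continuous_iff.1 hcont m (c * δ / 8) (by positivity)
    set ρ := min r 1
    have hρpos : 0 < ρ := lt_min hr one_pos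
    have hmass : 0 < μ.real (Metric.ball m ρ) :=
      ENNReal.toReal_pos (Metric.measure_ball_pos μ m hρpos).ne' (measure_ne_top _ _)
    have hev1 : ∀ᶠ N in atTop, ε N ≤ c / 4 :=
      (hε.eventually (gt_mem_nhds (by positivity : (0 : ℝ) < c / 4))).mono fun _ h => h.le
    have hev2 : ∀ᶠ N in atTop, ε N * (|m| + 1) ≤ c * δ / 8 := by
      have : Tendsto (fun N => ε N * (|m| + 1)) atTop (𝓝 (0 * (|m| + 1))) := hε.mul_const _
      rw [zero_mul] at this
      exact (this.eventually (gt_mem_nhds (by positivity : (0 : ℝ) < c * δ / 8))).mono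
        fun _ h => h.le
    have hlim : Tendsto (fun N : ℕ => exp (-(c * δ / 8 * N)) / μ.real (Metric.ball m ρ))
        atTop (𝓝 0) := by
      have h1 : Tendsto (fun N : ℕ => c * δ / 8 * (N : ℝ)) atTop atTop :=
        tendsto_natCast_atTop_atTop.const_mul_atTop (by positivity)
      simpa using (tendsto_exp_neg_atTop_nhds_zero.comp h1).div_const (μ.real (Metric.ball m ρ))
    rw [Metric.tendstoUniformlyOn_iff]
    intro e he
    filter_upwards [hev1, hev2, hlim.eventually (gt_mem_nhds he)] with N h1 h2 h3 x hx
    have hxm : δ ≤ |x - m| := by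
      by_contra hcon
      exact hx (hball (by rw [Metric.mem_ball, Real.dist_eq]; exact not_le.1 hcon))
    have habs : ∀ y, |y| ≤ |m| + |y - m| := fun y => by
      simpa using abs_add_le m (y - m)
    have hup : f N x ≤ h m - 5 / 8 * (c * δ) := by
      have e1 := (abs_le.1 (hf N x)).2
      have e2 := hdec x hxm
      have e3 := mul_le_mul_of_nonneg_left (habs x) (hε0 N)
      have e4 := mul_le_mul_of_nonneg_right h1 (abs_nonneg (x - m))
      have e5 := mul_le_mul_of_nonneg_left hxm hc.le
      have := hε0 N
      nlinarith
    have hlow : ∀ y ∈ Metric.ball m ρ, h m - c * δ / 4 ≤ f N y := by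
      intro y hy
      rw [Metric.mem_ball] at hy
      have e1 := (abs_le.1 (hf N y)).1
      have e2 := hnear y (hy.trans_le (min_le_left _ _))
      rw [Real.dist_eq] at e2 hy
      have e3 := (abs_lt.1 e2).1
      have e4 : |y| ≤ |m| + 1 := (habs y).trans (by linarith [hy.trans_le (min_le_right r 1)])
      have e5 := mul_le_mul_of_nonneg_left e4 (hε0 N)
      linarith
    have hZlow : exp (N * (h m - c * δ / 4)) * μ.real (Metric.ball m ρ) ≤
        ∫ x, exp (N * f N x) ∂μ := by
      calc exp (N * (h m - c * δ / 4)) * μ.real (Metric.ball m ρ)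
          = ∫ _ in Metric.ball m ρ, exp (N * (h m - c * δ / 4)) ∂μ := by
            rw [setIntegral_const, smul_eq_mul, mul_comm]
        _ ≤ ∫ x in Metric.ball m ρ, exp (N * f N x) ∂μ := by
            refine setIntegral_mono_on (by simp) (hinteg N).integrableOn
              measurableSet_ball fun y hy => ?_
            have := hlow y hy
            gcongr
        _ ≤ _ := setIntegral_le_integral (hinteg N) (Eventually.of_forall fun _ => (exp_pos _).le)
    rw [Pi.zero_apply, dist_zero_left, Real.norm_of_nonneg (div_pos (exp_pos _) (hZ N)).le]
    refine lt_of_le_of_lt ?_ h3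
    rw [div_le_div_iff₀ (hZ N) hmass]
    calc exp (N * f N x) * μ.real (Metric.ball m ρ)
        ≤ exp (-(c * δ / 8 * N)) * (exp (N * (h m - c * δ / 4)) * μ.real (Metric.ball m ρ)) := by
          rw [← mul_assoc, ← exp_add]
          gcongr
          have hN : (0 : ℝ) ≤ N := N.cast_nonneg
          have := mul_le_mul_of_nonneg_left hup hN
          nlinarith [mul_nonneg hN hcδ.le]
      _ ≤ _ := by gcongr
  have key := tendsto_integral_peak_smul_of_integrable_of_tendsto (μ := μ) (l := atTop)
    (φ := fun (N : ℕ) x => exp (N * f N x) / ∫ x, exp (N * f N x) ∂μ) (x₀ := m) (g := g)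
    MeasurableSet.univ univ_mem (measure_ne_top _ _)
    (Eventually.of_forall fun N x => (div_pos (exp_pos _) (hZ N)).le) hunif
    (by
      refine tendsto_const_nhds.congr fun N => ?_
      rw [setIntegral_univ, integral_div, div_self (hZ N).ne'])
    (Eventually.of_forall fun N => ((hinteg N).div_const _).aestronglyMeasurable) hg hgm
  refine key.congr fun N => ?_
  rw [← integral_div]
  congr 1 with x
  simp only [smul_eq_mul]
  ring

end Laplace

section Tilt

/-- The two-point Laplace transform `a * exp x + b * exp (-x)`. -/
noncomputable def twoPointMGF (a b x : ℝ) : ℝ := a * exp x + b * exp (-x)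

lemma twoPointMGF_pos {a b : ℝ} (ha : 0 < a) (hb : 0 < b) (x : ℝ) : 0 < twoPointMGF a b x := by
  unfold twoPointMGF; positivity

lemma continuous_twoPointMGF (a b : ℝ) : Continuous (twoPointMGF a b) := by
  unfold twoPointMGF; fun_prop

lemma abs_log_twoPointMGF_le {a b : ℝ} (ha : 0 < a) (hb : 0 < b) (hab : a + b = 1) (x : ℝ) :
    |log (twoPointMGF a b x)| ≤ |x| := by
  have hpos := twoPointMGF_pos ha hb x
  have h1 : exp x ≤ exp |x| := exp_le_exp.2 (le_abs_self x)
  have h2 : exp (-x) ≤ exp |x| := exp_le_exp.2 (neg_le_abs x)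
  have h3 : exp (-|x|) ≤ exp x := exp_le_exp.2 (neg_abs_le x)
  have h4 : exp (-|x|) ≤ exp (-x) := exp_le_exp.2 (neg_le_neg (le_abs_self x))
  rw [abs_le, le_log_iff_exp_le hpos, log_le_iff_le_exp hpos]
  unfold twoPointMGF
  constructor
  · calc exp (-|x|) = a * exp (-|x|) + b * exp (-|x|) := by rw [← add_mul, hab, one_mul]
      _ ≤ _ := by gcongr
  · calc a * exp x + b * exp (-x) ≤ a * exp |x| + b * exp |x| := by gcongr
      _ = _ := by rw [← add_mul, hab, one_mul]

/-- The derivative of `log (twoPointMGF a b x)`. -/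
noncomputable def twoPointMean (a b x : ℝ) : ℝ :=
  (a * exp x - b * exp (-x)) / twoPointMGF a b x

lemma hasDerivAt_log_twoPointMGF {a b : ℝ} (ha : 0 < a) (hb : 0 < b) (x : ℝ) :
    HasDerivAt (fun x => log (twoPointMGF a b x)) (twoPointMean a b x) x := by
  have h : HasDerivAt (twoPointMGF a b) (a * exp x - b * exp (-x)) x := by
    unfold twoPointMGF
    exact (((hasDerivAt_exp x).const_mul a).add
      ((hasDerivAt_neg x).exp.const_mul b)).congr_deriv (by ring)
  exact h.log (twoPointMGF_pos ha hb x).ne'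

lemma tanh_lt_self_of_pos {s : ℝ} (hs : 0 < s) : tanh s < s := by
  have hanti : StrictAntiOn (fun s : ℝ => sinh s - s * cosh s) (Set.Ici 0) := by
    refine strictAntiOn_of_deriv_neg (convex_Ici 0) (by fun_prop) fun x hx => ?_
    rw [interior_Ici, Set.mem_Ioi] at hx
    have : HasDerivAt (fun s : ℝ => sinh s - s * cosh s)
        (cosh x - (1 * cosh x + x * sinh x)) x :=
      (hasDerivAt_sinh x).sub ((hasDerivAt_id x).mul (hasDerivAt_cosh x))
    rw [this.deriv]
    nlinarith [mul_pos hx (sinh_pos_iff.2 hx)]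
  have := hanti (Set.mem_Ici.2 le_rfl) hs.le hs
  simp only [sinh_zero, zero_mul, sub_zero] at this
  rw [tanh_eq_sinh_div_cosh, div_lt_iff₀ (cosh_pos s)]
  linarith

lemma twoPointMean_sub_le {a b : ℝ} (ha : 0 < a) (hb : 0 < b) {x y : ℝ} (hxy : x < y) :
    twoPointMean a b y - twoPointMean a b x ≤ 2 * tanh ((y - x) / 2) := by
  set s := (y - x) / 2 with hs
  have hspos : 0 < s := by rw [hs]; linarith
  have hy : y = x + 2 * s := by rw [hs]; ring
  have hA := twoPointMGF_pos ha hb x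
  have hB := twoPointMGF_pos ha hb y
  have hE : 0 < exp s - exp (-s) := by rw [sub_pos, exp_lt_exp]; linarith
  have hF : 0 < exp s + exp (-s) := by positivity
  have htanh : tanh s = (exp s - exp (-s)) / (exp s + exp (-s)) := by
    rw [tanh_eq_sinh_div_cosh, sinh_eq, cosh_eq]; field_simp
  have hxinv : exp x * exp (-x) = 1 := by rw [← exp_add]; simp
  have hey : exp y = exp x * exp s ^ 2 := by rw [hy, ← exp_nat_mul, ← exp_add]; norm_num
  have heny : exp (-y) = exp (-x) * exp (-s) ^ 2 := by
    rw [hy, ← exp_nat_mul, ← exp_add]; congr 1; push_cast; ring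
  have hnum : twoPointMean a b y - twoPointMean a b x =
      2 * a * b * ((exp s - exp (-s)) * (exp s + exp (-s))) /
        (twoPointMGF a b y * twoPointMGF a b x) := by
    unfold twoPointMean
    rw [div_sub_div _ _ hB.ne' hA.ne']
    congr 1
    unfold twoPointMGF
    rw [hey, heny]
    linear_combination 2 * a * b * (exp s ^ 2 - exp (-s) ^ 2) * hxinv
  have hden : a * b * (exp s + exp (-s)) ^ 2 ≤ twoPointMGF a b y * twoPointMGF a b x := by
    have : twoPointMGF a b y * twoPointMGF a b x - a * b * (exp s + exp (-s)) ^ 2 =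
        (a * (exp x * exp s) - b * (exp (-x) * exp (-s))) ^ 2 := by
      unfold twoPointMGF
      rw [hey, heny]
      linear_combination (a * b * (exp s ^ 2 + exp (-s) ^ 2) +
        2 * a * b * exp s * exp (-s)) * hxinv
    nlinarith [sq_nonneg (a * (exp x * exp s) - b * (exp (-x) * exp (-s)))]
  rw [hnum, htanh, div_le_iff₀ (by positivity)]
  calc 2 * a * b * ((exp s - exp (-s)) * (exp s + exp (-s)))
      = 2 * ((exp s - exp (-s)) / (exp s + exp (-s))) * (a * b * (exp s + exp (-s)) ^ 2) := by
        field_simp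
    _ ≤ _ := by gcongr

/-- The exponent of the mean-field integrand, for densities `p`, `r` of plus and minus spins. -/
noncomputable def wrExponent (β a b p r x : ℝ) : ℝ :=
  -(x ^ 2 / β) + p * log (twoPointMGF a b x) + r * log (twoPointMGF b a x)

variable {β a b p r : ℝ}

lemma continuous_wrExponent (ha : 0 < a) (hb : 0 < b) : Continuous (wrExponent β a b p r) := by
  have h1 : Continuous fun x => log (twoPointMGF a b x) :=
    (continuous_twoPointMGF a b).log fun x => (twoPointMGF_pos ha hb x).ne'
  have h2 : Continuous fun x => log (twoPointMGF b a x) :=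
    (continuous_twoPointMGF b a).log fun x => (twoPointMGF_pos hb ha x).ne'
  unfold wrExponent
  fun_prop

lemma strictConcaveOn_wrExponent (ha : 0 < a) (hb : 0 < b) (hβ0 : 0 < β) (hβ2 : β ≤ 2)
    (hp : 0 ≤ p) (hr : 0 ≤ r) (hpr : p + r ≤ 1) :
    StrictConcaveOn ℝ Set.univ (wrExponent β a b p r) := by
  refine StrictAnti.strictConcaveOn_univ_of_deriv (continuous_wrExponent ha hb) ?_
  have hderiv : ∀ x, deriv (wrExponent β a b p r) x =
      -(2 * x / β) + p * twoPointMean a b x + r * twoPointMean b a x := by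
    intro x
    refine HasDerivAt.deriv ?_
    have h1 : HasDerivAt (fun x : ℝ => -(x ^ 2 / β)) (-(2 * x / β)) x :=
      ((hasDerivAt_pow 2 x).div_const β).neg.congr_deriv (by simp)
    exact (h1.add ((hasDerivAt_log_twoPointMGF ha hb x).const_mul p)).add
      ((hasDerivAt_log_twoPointMGF hb ha x).const_mul r)
  intro x y hxy
  rw [hderiv, hderiv]
  have h1 := mul_le_mul_of_nonneg_left (twoPointMean_sub_le ha hb hxy) hp
  have h2 := mul_le_mul_of_nonneg_left (twoPointMean_sub_le hb ha hxy) hr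
  have hs : 0 < (y - x) / 2 := by linarith
  have h3 := tanh_lt_self_of_pos hs
  have h4 : 0 ≤ tanh ((y - x) / 2) := by
    rw [tanh_eq_sinh_div_cosh]
    exact div_nonneg (sinh_nonneg_iff.2 hs.le) (cosh_pos _).le
  have h5 := mul_le_mul_of_nonneg_right hpr h4
  have h6 : y - x ≤ 2 * y / β - 2 * x / β := by
    rw [← sub_div, le_div_iff₀ hβ0]
    nlinarith
  linarith

lemma exists_forall_wrExponent_le (ha : 0 < a) (hb : 0 < b) (hab : a + b = 1) (hβ0 : 0 < β)
    (hp : 0 ≤ p) (hr : 0 ≤ r) (hpr : p + r ≤ 1) :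
    ∃ m, ∀ x, wrExponent β a b p r x ≤ wrExponent β a b p r m := by
  obtain ⟨m, -, hm⟩ := (isCompact_Icc (a := -β) (b := β)).exists_isMaxOn
    ⟨0, by simp [hβ0.le]⟩ (continuous_wrExponent (β := β) (p := p) (r := r) ha hb).continuousOn
  refine ⟨m, fun x => ?_⟩
  by_cases hx : |x| ≤ β
  · exact hm (abs_le.1 hx)
  · rw [not_le] at hx
    have h0 : wrExponent β a b p r 0 = 0 := by
      simp [wrExponent, twoPointMGF, hab, add_comm b a]
    have hle : wrExponent β a b p r 0 ≤ wrExponent β a b p r m := hm (by simp [hβ0.le])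
    refine le_trans ?_ (h0 ▸ hle)
    have h1 := mul_le_mul_of_nonneg_left
      ((le_abs_self _).trans (abs_log_twoPointMGF_le ha hb hab x)) hp
    have h2 := mul_le_mul_of_nonneg_left
      ((le_abs_self _).trans (abs_log_twoPointMGF_le hb ha (by linarith) x)) hr
    have h3 := mul_le_mul_of_nonneg_right hpr (abs_nonneg x)
    have h4 : |x| ≤ x ^ 2 / β := by
      rw [le_div_iff₀ hβ0, ← sq_abs]
      nlinarith
    unfold wrExponent
    linarith

lemma abs_wrExponent_sub_le (ha : 0 < a) (hb : 0 < b) (hab : a + b = 1) (p' r' x : ℝ) :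
    |wrExponent β a b p' r' x - wrExponent β a b p r x| ≤ (|p' - p| + |r' - r|) * |x| := by
  have : wrExponent β a b p' r' x - wrExponent β a b p r x =
      (p' - p) * log (twoPointMGF a b x) + (r' - r) * log (twoPointMGF b a x) := by
    unfold wrExponent; ring
  rw [this, add_mul]
  refine (abs_add_le _ _).trans (add_le_add ?_ ?_) <;> rw [abs_mul]
  · exact mul_le_mul_of_nonneg_left (abs_log_twoPointMGF_le ha hb hab x) (abs_nonneg _)
  · exact mul_le_mul_of_nonneg_left (abs_log_twoPointMGF_le hb ha (by linarith) x) (abs_nonneg _)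

end Tilt

section Representation

lemma exists_integral_gaussianReal_eq {β : ℝ} (hβ : 0 < β) (N : ℕ) :
    ∃ C > 0, ∀ s : ℝ, ∫ x, exp (-(N * x ^ 2 / β)) * exp (s * x) ∂gaussianReal 0 (β / 2).toNNReal =
      C * exp (β / (4 * (N + 1)) * s ^ 2) := by
  have hv : (β / 2).toNNReal ≠ 0 := by simpa using hβ
  have hcoe : (((β / 2).toNNReal : NNReal) : ℝ) = β / 2 := Real.coe_toNNReal _ (by positivity)
  refine ⟨(√(2 * π * (β / 2)))⁻¹ * √(π / ((N + 1) / β)), by positivity, fun s => ?_⟩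
  rw [integral_gaussianReal_eq_integral_smul hv]
  simp only [gaussianPDFReal, hcoe, smul_eq_mul]
  have hsq : ∀ x : ℝ, (√(2 * π * (β / 2)))⁻¹ * exp (-(x - 0) ^ 2 / (2 * (β / 2))) *
      (exp (-(N * x ^ 2 / β)) * exp (s * x)) =
      (√(2 * π * (β / 2)))⁻¹ * exp (β / (4 * (N + 1)) * s ^ 2) *
        exp (-((N + 1) / β) * (x - β * s / (2 * (N + 1))) ^ 2) := by
    intro x
    rw [mul_assoc (√(2 * π * (β / 2)))⁻¹, mul_assoc (√(2 * π * (β / 2)))⁻¹, ← exp_add, ← exp_add,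
      ← exp_add]
    congr 2
    field_simp
    ring
  simp_rw [hsq]
  rw [integral_const_mul, integral_sub_right_eq_self
    (fun x : ℝ => exp (-((N + 1) / β) * x ^ 2)), integral_gaussian]
  ring

lemma integrable_exp_neg_mul_exp_gaussianReal {β : ℝ} (hβ : 0 < β) (N : ℕ) (s : ℝ) :
    Integrable (fun x => exp (-(N * x ^ 2 / β)) * exp (s * x))
      (gaussianReal 0 (β / 2).toNNReal) := by
  refine (integrable_exp_mul_gaussianReal s).mono' (by fun_prop) (Eventually.of_forall fun x => ?_)
  rw [Real.norm_of_nonneg (by positivity)]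
  refine mul_le_of_le_one_left (exp_pos _).le ?_
  rw [exp_le_one_iff, neg_nonpos]
  positivity

lemma spin_cases (s : Spin) : (s : ℤ) = -1 ∨ (s : ℤ) = 0 ∨ (s : ℤ) = 1 := by
  simpa only [Spin, Finset.mem_insert, Finset.mem_singleton] using s.2

lemma sum_spin (f : ℤ → ℝ) : ∑ s : Spin, f s = f (-1) + f 0 + f 1 := by
  rw [Finset.sum_coe_sort Spin f]
  simp [Spin, add_assoc]

/-- The number of particles of a configuration. -/
noncomputable def occupation {M : ℕ} (η : Fin M → Spin) : ℝ := ∑ i, |((η i : ℤ) : ℝ)|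

lemma sum_interaction_eq {M : ℕ} (ω : Fin M → Spin) :
    ∑ i, ∑ j, (if ((ω i : ℤ) * (ω j : ℤ) = -1) then (1 : ℝ) else 0) =
      (occupation ω ^ 2 - (∑ i, ((ω i : ℤ) : ℝ)) ^ 2) / 2 := by
  rw [occupation, sq, sq, Finset.sum_mul_sum, Finset.sum_mul_sum, ← Finset.sum_sub_distrib,
    Finset.sum_div]
  refine Finset.sum_congr rfl fun i _ => ?_
  rw [← Finset.sum_sub_distrib, Finset.sum_div]
  refine Finset.sum_congr rfl fun j _ => ?_
  rcases spin_cases (ω i) with h | h | h <;> rcases spin_cases (ω j) with h' | h' | h' <;>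
    simp [h, h']

lemma pFlip_eq_zero {t : ℝ} {a b : Spin} (h : |((a : ℤ) : ℝ)| ≠ |((b : ℤ) : ℝ)|) :
    pFlip t a b = 0 := by
  rcases spin_cases a with ha | ha | ha <;> rcases spin_cases b with hb | hb | hb <;>
    simp [ha, hb, pFlip] at h ⊢

/-- The weight of a site with final spin `s` in the external field `x`. -/
noncomputable def siteWeight (α : ℤ → ℝ) (t : ℝ) (s : ℤ) (x : ℝ) : ℝ :=
  ∑ a : Spin, α a * pFlip t a s * exp ((a : ℤ) * x)

lemma wrWeight_mul_prod_pFlip (β : ℝ) (α : ℤ → ℝ) (t : ℝ) {M : ℕ} (ω η : Fin M → Spin) :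
    wrWeight β α ω * ∏ i, pFlip t (ω i) (η i) =
      exp (-(β / (4 * M)) * occupation η ^ 2) * ((∏ i, α (ω i) * pFlip t (ω i) (η i)) *
        exp (β / (4 * M) * (∑ i, ((ω i : ℤ) : ℝ)) ^ 2)) := by
  rw [Finset.prod_mul_distrib]
  by_cases h : ∃ i, |((ω i : ℤ) : ℝ)| ≠ |((η i : ℤ) : ℝ)|
  · obtain ⟨i, hi⟩ := h
    rw [Finset.prod_eq_zero (Finset.mem_univ i) (pFlip_eq_zero hi)]
    simp
  · push Not at h
    have hocc : occupation η = occupation ω := Finset.sum_congr rfl fun i _ => (h i).symm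
    rw [wrWeight, sum_interaction_eq, hocc]
    have : exp (-(β / (2 * M)) * ((occupation ω ^ 2 - (∑ i, ((ω i : ℤ) : ℝ)) ^ 2) / 2)) =
        exp (-(β / (4 * M)) * occupation ω ^ 2) *
          exp (β / (4 * M) * (∑ i, ((ω i : ℤ) : ℝ)) ^ 2) := by
      rw [← exp_add]
      congr 1
      rw [show (4 : ℝ) * M = 2 * M * 2 by ring, ← div_div]
      ring
    rw [this]
    ring

/-- Hubbard-Stratonovich representation of the time-evolved weights. -/
lemma exists_wrWeightT_eq_integral {β : ℝ} (hβ : 0 < β) (α : ℤ → ℝ) (t : ℝ) (N : ℕ) :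
    ∃ C > 0, ∀ η : Fin (N + 1) → Spin, wrWeightT β α t η =
      C * exp (-(β / (4 * (N + 1))) * occupation η ^ 2) *
        ∫ x, exp (-(N * x ^ 2 / β)) * ∏ i, siteWeight α t (η i) x
          ∂gaussianReal 0 (β / 2).toNNReal := by
  obtain ⟨C, hC, hinteg⟩ := exists_integral_gaussianReal_eq hβ N
  refine ⟨C⁻¹, inv_pos.2 hC, fun η => ?_⟩
  have hexpand : ∀ x : ℝ, exp (-(N * x ^ 2 / β)) * ∏ i, siteWeight α t (η i) x =
      ∑ ω : Fin (N + 1) → Spin, (∏ i, α (ω i) * pFlip t (ω i) (η i)) *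
        (exp (-(N * x ^ 2 / β)) * exp ((∑ i, ((ω i : ℤ) : ℝ)) * x)) := by
    intro x
    unfold siteWeight
    rw [Fintype.prod_sum, Finset.mul_sum]
    refine Finset.sum_congr rfl fun ω _ => ?_
    rw [Finset.prod_mul_distrib, ← exp_sum, ← Finset.sum_mul]
    ring
  simp_rw [hexpand]
  rw [integral_finsetSum _ fun ω _ =>
    (integrable_exp_neg_mul_exp_gaussianReal hβ N _).const_mul _]
  simp_rw [integral_const_mul, hinteg]
  unfold wrWeightT
  rw [Finset.mul_sum]
  refine Finset.sum_congr rfl fun ω _ => ?_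
  rw [wrWeight_mul_prod_pFlip]
  push_cast
  field_simp

end Representation

section Limit

/-- The number of sites of `τ` with spin `s`. -/
def spinCount {N : ℕ} (τ : Fin N → Spin) (s : ℤ) : ℕ :=
  (univ.filter fun i : Fin N => (τ i : ℤ) = s).card

lemma spinCount_div_mul {N : ℕ} (τ : Fin N → Spin) (s : ℤ) :
    (N : ℝ) * (spinCount τ s / N) = spinCount τ s := by
  rcases Nat.eq_zero_or_pos N with rfl | hN
  · simp [spinCount]
  · field_simp

lemma occupation_eq {N : ℕ} (τ : Fin N → Spin) :
    occupation τ = spinCount τ 1 + spinCount τ (-1) := by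
  simp only [occupation, spinCount, Finset.card_filter, Nat.cast_sum, ← Finset.sum_add_distrib]
  refine Finset.sum_congr rfl fun i _ => ?_
  rcases spin_cases (τ i) with h | h | h <;> simp [h]

lemma occupation_cons {N : ℕ} (σ : Spin) (τ : Fin N → Spin) :
    occupation (Fin.cons σ τ : Fin (N + 1) → Spin) = |((σ : ℤ) : ℝ)| + occupation τ := by
  simp [occupation, Fin.sum_univ_succ]

variable {α : ℤ → ℝ} {β t : ℝ}

lemma siteWeight_zero (x : ℝ) : siteWeight α t 0 x = α 0 := by
  rw [siteWeight, sum_spin fun a => α a * pFlip t a 0 * exp (a * x)]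
  simp [pFlip]

lemma siteWeight_one (hsym : α 1 = α (-1)) (x : ℝ) : siteWeight α t 1 x =
    α 1 * twoPointMGF ((1 + exp (-2 * t)) / 2) ((1 - exp (-2 * t)) / 2) x := by
  rw [siteWeight, sum_spin fun a => α a * pFlip t a 1 * exp (a * x)]
  simp [pFlip, twoPointMGF, ← hsym]
  ring

lemma siteWeight_neg_one (hsym : α 1 = α (-1)) (x : ℝ) : siteWeight α t (-1) x =
    α 1 * twoPointMGF ((1 - exp (-2 * t)) / 2) ((1 + exp (-2 * t)) / 2) x := by
  rw [siteWeight, sum_spin fun a => α a * pFlip t a (-1) * exp (a * x)]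
  simp [pFlip, twoPointMGF, ← hsym]
  ring

lemma prod_siteWeight (hsym : α 1 = α (-1)) {N : ℕ} (τ : Fin N → Spin) (x : ℝ) :
    ∏ i, siteWeight α t (τ i) x = (∏ i, if (τ i : ℤ) = 0 then α 0 else α 1) *
      (twoPointMGF ((1 + exp (-2 * t)) / 2) ((1 - exp (-2 * t)) / 2) x ^ spinCount τ 1 *
        twoPointMGF ((1 - exp (-2 * t)) / 2) ((1 + exp (-2 * t)) / 2) x ^ spinCount τ (-1)) := by
  simp only [spinCount, ← Finset.prod_const, Finset.prod_filter]
  rw [← Finset.prod_mul_distrib, ← Finset.prod_mul_distrib]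
  refine Finset.prod_congr rfl fun i _ => ?_
  rcases spin_cases (τ i) with h | h | h <;>
    simp [h, siteWeight_zero, siteWeight_one hsym, siteWeight_neg_one hsym]

lemma exp_mul_wrExponent {a b : ℝ} (ha : 0 < a) (hb : 0 < b) {N : ℕ} (τ : Fin N → Spin) (x : ℝ) :
    exp (N * wrExponent β a b (spinCount τ 1 / N) (spinCount τ (-1) / N) x) =
      exp (-(N * x ^ 2 / β)) *
        (twoPointMGF a b x ^ spinCount τ 1 * twoPointMGF b a x ^ spinCount τ (-1)) := by
  have h : N * wrExponent β a b (spinCount τ 1 / N) (spinCount τ (-1) / N) x =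
      -(N * x ^ 2 / β) + (spinCount τ 1 * log (twoPointMGF a b x) +
        spinCount τ (-1) * log (twoPointMGF b a x)) := by
    rw [wrExponent]
    linear_combination log (twoPointMGF a b x) * spinCount_div_mul τ 1 +
      log (twoPointMGF b a x) * spinCount_div_mul τ (-1)
  rw [h, exp_add, exp_add, exp_nat_mul, exp_nat_mul, exp_log (twoPointMGF_pos ha hb x),
    exp_log (twoPointMGF_pos hb ha x)]

lemma integrable_exp_mul_wrExponent (hβ : 0 < β) {a b : ℝ} (ha : 0 < a) (hb : 0 < b)
    (hab : a + b = 1) {N : ℕ} {p r : ℝ} (hp : 0 ≤ p) (hr : 0 ≤ r) :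
    Integrable (fun x => exp (N * wrExponent β a b p r x))
      (gaussianReal 0 (β / 2).toNNReal) := by
  set c := N * (p + r)
  refine ((integrable_exp_mul_gaussianReal c).add (integrable_exp_mul_gaussianReal (-c))).mono'
    (continuous_exp.comp
      (continuous_const.mul (continuous_wrExponent ha hb))).aestronglyMeasurable
    (Eventually.of_forall fun x => ?_)
  rw [Real.norm_of_nonneg (exp_pos _).le, Pi.add_apply]
  have hle : N * wrExponent β a b p r x ≤ c * |x| := by
    have h1 := mul_le_mul_of_nonneg_left
      ((le_abs_self _).trans (abs_log_twoPointMGF_le ha hb hab x)) hp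
    have h2 := mul_le_mul_of_nonneg_left
      ((le_abs_self _).trans (abs_log_twoPointMGF_le hb ha (by linarith) x)) hr
    have h3 : 0 ≤ x ^ 2 / β := by positivity
    have h4 : wrExponent β a b p r x ≤ (p + r) * |x| := by unfold wrExponent; linarith
    exact (mul_le_mul_of_nonneg_left h4 N.cast_nonneg).trans_eq (by ring)
  rcases abs_cases x with ⟨hx, _⟩ | ⟨hx, _⟩ <;> rw [hx] at hle
  · exact (exp_le_exp.2 hle).trans (le_add_of_nonneg_right (exp_pos _).le)
  · refine (exp_le_exp.2 (hle.trans_eq ?_)).trans (le_add_of_nonneg_left (exp_pos _).le)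
    ring

lemma siteWeight_pos (hsym : α 1 = α (-1)) (h1 : 0 < α 1) (h0 : 0 < α 0) (ht : 0 < t)
    (s : Spin) (x : ℝ) : 0 < siteWeight α t s x := by
  have hq : exp (-2 * t) < 1 := by rw [exp_lt_one_iff]; linarith
  have ha : 0 < (1 + exp (-2 * t)) / 2 := by positivity
  have hb : 0 < (1 - exp (-2 * t)) / 2 := by linarith
  rcases spin_cases s with h | h | h <;> rw [h]
  · rw [siteWeight_neg_one hsym]
    exact mul_pos h1 (twoPointMGF_pos hb ha x)
  · rwa [siteWeight_zero]
  · rw [siteWeight_one hsym]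
    exact mul_pos h1 (twoPointMGF_pos ha hb x)

lemma continuous_siteWeight (s : ℤ) : Continuous (siteWeight α t s) := by
  unfold siteWeight
  fun_prop

lemma integrable_siteWeight (s : ℤ) (v : NNReal) :
    Integrable (siteWeight α t s) (gaussianReal 0 v) := by
  unfold siteWeight
  exact integrable_finsetSum _ fun a _ => (integrable_exp_mul_gaussianReal _).const_mul _

/-- The change of the repulsion energy caused by adding one spin `σ` converges. -/
lemma tendsto_exp_repulsion {τ : (N : ℕ) → Fin N → Spin} {ν : ℤ → ℝ} (hτ : EmpConv τ ν) (u : ℝ) :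
    Tendsto (fun N : ℕ => exp (-(β / (4 * (N + 1))) *
      ((u + occupation (τ N)) ^ 2 - occupation (τ N) ^ 2)))
      atTop (𝓝 (exp (-(β / 4) * ((2 * u * (ν 1 + ν (-1)) + 0) * 1)))) := by
  have h1 : Tendsto (fun N : ℕ => (spinCount (τ N) 1 : ℝ) / N + spinCount (τ N) (-1) / N)
      atTop (𝓝 (ν 1 + ν (-1))) := (hτ 1).add (hτ (-1))
  have h2 : Tendsto (fun N : ℕ => u ^ 2 / (N : ℝ)) atTop (𝓝 0) :=
    tendsto_const_div_atTop_nhds_zero_nat _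
  have h3 : Tendsto (fun N : ℕ => (N : ℝ) / (N + 1)) atTop (𝓝 1) :=
    tendsto_natCast_div_add_atTop 1
  refine ((((h1.const_mul (2 * u)).add h2).mul h3).const_mul (-(β / 4))).rexp.congr' ?_
  filter_upwards [eventually_gt_atTop 0] with N hN
  have hN' : (0 : ℝ) < N := by exact_mod_cast hN
  rw [occupation_eq]
  congr 1
  field_simp
  ring

lemma exists_wrWeightT_cons_eq (hβ : 0 < β) (hsym : α 1 = α (-1)) (h1 : 0 < α 1) (h0 : 0 < α 0)
    (ht : 0 < t) {N : ℕ} (τ : Fin N → Spin) :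
    ∃ D > 0, ∀ σ : Spin, wrWeightT β α t (Fin.cons σ τ : Fin (N + 1) → Spin) =
      D * (exp (-(β / (4 * (N + 1))) *
        ((|((σ : ℤ) : ℝ)| + occupation τ) ^ 2 - occupation τ ^ 2)) *
        ∫ x, exp (N * wrExponent β ((1 + exp (-2 * t)) / 2) ((1 - exp (-2 * t)) / 2)
          (spinCount τ 1 / N) (spinCount τ (-1) / N) x) * siteWeight α t σ x
          ∂gaussianReal 0 (β / 2).toNNReal) := by
  have hq : exp (-2 * t) < 1 := by rw [exp_lt_one_iff]; linarith
  have ha : 0 < (1 + exp (-2 * t)) / 2 := by positivity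
  have hb : 0 < (1 - exp (-2 * t)) / 2 := by linarith
  obtain ⟨C, hC, hrep⟩ := exists_wrWeightT_eq_integral hβ α t N
  set K := ∏ i, if (τ i : ℤ) = 0 then α 0 else α 1
  have hKpos : 0 < K := Finset.prod_pos fun i _ => by split_ifs <;> assumption
  refine ⟨C * exp (-(β / (4 * (N + 1))) * occupation τ ^ 2) * K, by positivity, fun σ => ?_⟩
  rw [hrep, occupation_cons]
  have hprod : ∀ x : ℝ, exp (-(N * x ^ 2 / β)) *
      ∏ i, siteWeight α t ((Fin.cons σ τ : Fin (N + 1) → Spin) i) x =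
      K * (exp (N * wrExponent β ((1 + exp (-2 * t)) / 2) ((1 - exp (-2 * t)) / 2)
          (spinCount τ 1 / N) (spinCount τ (-1) / N) x) * siteWeight α t σ x) := by
    intro x
    rw [exp_mul_wrExponent ha hb, Fin.prod_univ_succ]
    simp only [Fin.cons_zero, Fin.cons_succ]
    rw [prod_siteWeight hsym]
    ring
  simp_rw [hprod]
  rw [integral_const_mul]
  have hsplit : exp (-(β / (4 * (N + 1))) * (|((σ : ℤ) : ℝ)| + occupation τ) ^ 2) =
      exp (-(β / (4 * (N + 1))) * occupation τ ^ 2) * exp (-(β / (4 * (N + 1))) *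
        ((|((σ : ℤ) : ℝ)| + occupation τ) ^ 2 - occupation τ ^ 2)) := by
    rw [← exp_add]
    congr 1
    ring
  rw [hsplit]
  ring

lemma exists_forall_tendsto_wrCondProbT (hsym : α 1 = α (-1)) (h1 : 0 < α 1) (h0 : 0 < α 0)
    (hβ0 : 0 < β) (hβ2 : β ≤ 2) (ht : 0 < t) {ν : ℤ → ℝ} (hν : IsProbVec ν) (σ : Spin) :
    ∃ L : ℝ, ∀ τ : (N : ℕ) → Fin N → Spin, EmpConv τ ν →
      Tendsto (fun N : ℕ => wrCondProbT β α t σ (τ N)) atTop (𝓝 L) := by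
  have hq : exp (-2 * t) < 1 := by rw [exp_lt_one_iff]; linarith
  set a := (1 + exp (-2 * t)) / 2 with ha_def
  set b := (1 - exp (-2 * t)) / 2 with hb_def
  have ha : 0 < a := by positivity
  have hb : 0 < b := by rw [hb_def]; linarith
  have hab : a + b = 1 := by rw [ha_def, hb_def]; ring
  have hp : 0 ≤ ν 1 := hν.1 1
  have hr : 0 ≤ ν (-1) := hν.1 (-1)
  have hpr : ν 1 + ν (-1) ≤ 1 := by
    have hsum := hν.2.2
    rw [← Finset.sum_coe_sort Spin ν, sum_spin] at hsum
    linarith [hν.1 0]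
  obtain ⟨m, hm⟩ := exists_forall_wrExponent_le ha hb hab hβ0 hp hr hpr
  set γ := gaussianReal 0 (β / 2).toNNReal
  have hopen : γ.IsOpenPosMeasure :=
    (gaussianReal_absolutelyContinuous' 0 (by simpa using hβ0)).isOpenPosMeasure
  set w : Spin → ℝ := fun s => exp (-(β / 4) *
    ((2 * |((s : ℤ) : ℝ)| * (ν 1 + ν (-1)) + 0) * 1)) * siteWeight α t s m
  have hwpos : ∀ s, 0 < w s := fun s =>
    mul_pos (exp_pos _) (siteWeight_pos hsym h1 h0 ht s m)
  refine ⟨w σ / ∑ s, w s, fun τ hτ => ?_⟩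
  set f : ℕ → ℝ → ℝ := fun N =>
    wrExponent β a b (spinCount (τ N) 1 / N) (spinCount (τ N) (-1) / N)
  have hinteg : ∀ N : ℕ, Integrable (fun x => exp (N * f N x)) γ := fun N =>
    integrable_exp_mul_wrExponent hβ0 ha hb hab (by positivity) (by positivity)
  have hε : Tendsto (fun N : ℕ => |(spinCount (τ N) 1 : ℝ) / N - ν 1| +
      |(spinCount (τ N) (-1) : ℝ) / N - ν (-1)|) atTop (𝓝 0) := by
    simpa [spinCount] using ((hτ 1).sub_const (ν 1)).abs.add ((hτ (-1)).sub_const (ν (-1))).abs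
  set J : ℕ → Spin → ℝ := fun N s => exp (-(β / (4 * (N + 1))) *
    ((|((s : ℤ) : ℝ)| + occupation (τ N)) ^ 2 - occupation (τ N) ^ 2)) *
    ((∫ x, exp (N * f N x) * siteWeight α t s x ∂γ) / ∫ x, exp (N * f N x) ∂γ)
  have hJlim : ∀ s, Tendsto (fun N => J N s) atTop (𝓝 (w s)) := fun s =>
    (tendsto_exp_repulsion hτ _).mul (tendsto_integral_exp_mul_div_of_cone
      (continuous_wrExponent ha hb) hε (fun N x => abs_wrExponent_sub_le ha hb hab _ _ x) hinteg
      (fun δ hδ => (strictConcaveOn_wrExponent ha hb hβ0 hβ2 hp hr hpr).exists_le_sub_mul_abs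
        hm hδ) (integrable_siteWeight _ _) (continuous_siteWeight _).continuousAt)
  refine ((hJlim σ).div (tendsto_finsetSum _ fun s _ => hJlim s)
    (Finset.sum_pos (fun s _ => hwpos s) ⟨σ, Finset.mem_univ _⟩).ne').congr fun N => ?_
  obtain ⟨D, hD, hW⟩ := exists_wrWeightT_cons_eq hβ0 hsym h1 h0 ht (τ N)
  have hZ : 0 < ∫ x, exp (N * f N x) ∂γ := integral_exp_pos (hinteg N)
  have hWJ : ∀ s, wrWeightT β α t (Fin.cons s (τ N) : Fin (N + 1) → Spin) =
      (D * ∫ x, exp (N * f N x) ∂γ) * J N s := by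
    have hcancel : ∀ E I Z : ℝ, 0 < Z → D * (E * I) = D * Z * (E * (I / Z)) := by
      intro E I Z hZ
      field_simp
    exact fun s => (hW s).trans (hcancel _ _ _ hZ)
  rw [wrCondProbT, hWJ]
  simp_rw [hWJ]
  rw [← Finset.mul_sum, mul_div_mul_left _ _ (mul_pos hD hZ).ne']
  rfl

end Limit

/-- For a symmetric a priori measure and small repulsion strength `0 < β ≤ 2`, the
time-evolved mean-field soft-core Widom-Rowlinson model is sequentially Gibbs at
all times `t > 0` (no bad empirical measures). -/
theorem small_beta_always_sequentially_Gibbs (α : ℤ → ℝ) (hα : IsProbVec α)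
    (hsym : α 1 = α (-1)) (h1 : 0 < α 1) (h0 : 0 < α 0)
    (β : ℝ) (hβ0 : 0 < β) (hβ2 : β ≤ 2) (t : ℝ) (ht : 0 < t) :
    ∀ ν : ℤ → ℝ, IsProbVec ν → ¬ IsBadMeasure β α t ν := by
  rintro ν hν ⟨τ, τ', hτ, hτ', σ, hbad⟩
  obtain ⟨L, hL⟩ := exists_forall_tendsto_wrCondProbT hsym h1 h0 hβ0 hβ2 ht hν σ
  exact hbad ⟨L, hL τ hτ, hL τ' hτ'⟩
end
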